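/- arXiv:2511.08211 — 13 statements merged into one kernel-verified Lean document; each statement's English description precedes it below -/
import Mathlib

section
/- Let β > 1 be a real number and let K, f ∈ L¹(ℝ) be functions such that |K(x)| ≤ C|x|^{−β} for all x ≠ 0 and |f(x)| ≤ C⟨x⟩^{−β} for all x ∈ ℝ (for some constant C > 0). Assume that |x|^β K(x) → K₀ as |x| → ∞ for some K₀ ∈ ℝ, and that |x|^β f(x) → 0 as |x| → ∞. Then the convolution K ∗ f is defined at every point of ℝ and |x|^β (K ∗ f)(x) → K₀ ∫_ℝ f(y) dy as |x| → ∞. -/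
open MeasureTheory Filter Real

lemma aux_bd (β : ℝ) (hβ : 1 < β) (g : ℝ → ℝ) (C : ℝ) (hC : 0 < C)
    (h : ∀ x : ℝ, x ≠ 0 → |g x| ≤ C * |x| ^ (-β)) (x w : ℝ) (hxw : |x| ≤ 2 * |w|) :
    |x| ^ β * |g w| ≤ C * 2 ^ β := by
  by_cases hw : w = 0
  · have hx : |x| = 0 := by
      apply le_antisymm _ (abs_nonneg x)
      simpa [hw] using hxw
    rw [hx, Real.zero_rpow (by linarith)]
    simp only [zero_mul]
    positivity
  · have hw' : 0 < |w| := abs_pos.mpr hw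
    calc |x| ^ β * |g w| ≤ (2 * |w|) ^ β * (C * |w| ^ (-β)) := by
          gcongr
          exact h w hw
      _ = C * 2 ^ β := by
          rw [Real.mul_rpow (by norm_num) hw'.le, Real.rpow_neg hw'.le]
          have : |w| ^ β ≠ 0 := (Real.rpow_pos_of_pos hw' β).ne'
          field_simp

lemma aux_large (r : ℝ) : ∀ᶠ x : ℝ in cocompact ℝ, r < |x| :=
  (tendsto_norm_cocompact_atTop (E := ℝ)).eventually_gt_atTop r

lemma aux_shift (y : ℝ) : Tendsto (fun x : ℝ => x - y) (cocompact ℝ) (cocompact ℝ) :=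
  (Homeomorph.subRight y).isClosedEmbedding.tendsto_cocompact

lemma aux_lim (β : ℝ) (g : ℝ → ℝ) (L : ℝ)
    (hg : Tendsto (fun x : ℝ => |x| ^ β * g x) (cocompact ℝ) (nhds L)) (y : ℝ) :
    Tendsto (fun x : ℝ => |x| ^ β * g (x - y)) (cocompact ℝ) (nhds L) := by
  have h1 := hg.comp (aux_shift y)
  have hinv : Tendsto (fun x : ℝ => (x - y)⁻¹) (cocompact ℝ) (nhds 0) :=
    (tendsto_inv₀_cobounded (α := ℝ)).comp
      (by rw [Metric.cobounded_eq_cocompact]; exact aux_shift y)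
  have h2 : Tendsto (fun x : ℝ => |1 + y * (x - y)⁻¹| ^ β) (cocompact ℝ) (nhds 1) := by
    have h3 : Tendsto (fun x : ℝ => |1 + y * (x - y)⁻¹|) (cocompact ℝ) (nhds 1) := by
      simpa using ((hinv.const_mul y).const_add 1).abs
    simpa using h3.rpow_const (p := β) (Or.inl one_ne_zero)
  have h4 := h2.mul h1
  rw [one_mul] at h4
  refine h4.congr' ?_
  filter_upwards [aux_large |y|] with x hx
  have hxy : x - y ≠ 0 := by
    intro h
    have : x = y := by linarith
    simp [this] at hx
  simp only [Function.comp]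
  rw [← mul_assoc, ← Real.mul_rpow (abs_nonneg _) (abs_nonneg _), ← abs_mul]
  congr 3
  field_simp
  ring_nf

/-- one half of the convolution, by dominated convergence -/
lemma aux_half (β : ℝ) (hβ : 1 < β) (g h : ℝ → ℝ) (hg : Integrable g) (hh : Integrable h)
    (C : ℝ) (hC : 0 < C) (hbd : ∀ x : ℝ, x ≠ 0 → |g x| ≤ C * |x| ^ (-β)) (L : ℝ)
    (hlim : Tendsto (fun x : ℝ => |x| ^ β * g x) (cocompact ℝ) (nhds L))
    (P : ℝ → ℝ → Prop) (hPm : ∀ x, MeasurableSet {y | P x y})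
    (hP : ∀ x y, P x y → |x| ≤ 2 * |x - y|) (hP' : ∀ x y, 2 * |y| < |x| → P x y) :
    Tendsto (fun x : ℝ => ∫ y, {y | P x y}.indicator (fun y => |x| ^ β * (g (x - y) * h y)) y)
      (cocompact ℝ) (nhds (L * ∫ y, h y)) := by
  have : (cocompact ℝ).IsCountablyGenerated := by
    rw [← Metric.cobounded_eq_cocompact, ← comap_norm_atTop]; infer_instance
  rw [← integral_const_mul]
  apply tendsto_integral_filter_of_dominated_convergence (fun y => C * 2 ^ β * |h y|)
  · refine Eventually.of_forall fun x => ?_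
    refine AEStronglyMeasurable.indicator ?_ (hPm x)
    exact (((hg.comp_sub_left x).aestronglyMeasurable).mul hh.aestronglyMeasurable).const_mul _
  · refine Eventually.of_forall fun x => Eventually.of_forall fun y => ?_
    by_cases hxy : P x y
    · rw [Set.indicator_of_mem (show y ∈ {y | P x y} from hxy)]
      rw [Real.norm_eq_abs, abs_mul, abs_mul, ← mul_assoc,
        abs_of_nonneg (Real.rpow_nonneg (abs_nonneg x) β)]
      exact mul_le_mul_of_nonneg_right (aux_bd β hβ g C hC hbd x _ (hP x y hxy)) (abs_nonneg _)
    · rw [Set.indicator_of_notMem (show y ∉ {y | P x y} from hxy), norm_zero]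
      positivity
  · exact (hh.abs.const_mul _)
  · refine Eventually.of_forall fun y => ?_
    refine ((aux_lim β g L hlim y).mul_const (h y)).congr' ?_
    filter_upwards [aux_large (2 * |y|)] with x hx
    rw [Set.indicator_of_mem (show y ∈ {y | P x y} from hP' x y hx), mul_assoc]

/-- If `K, f ∈ L¹(ℝ)` satisfy `|K(x)| ≤ C|x|^{-β}` (x ≠ 0), `|f(x)| ≤ C⟨x⟩^{-β}`,
`|x|^β K(x) → K₀` and `|x|^β f(x) → 0` as `|x| → ∞`, then the convolution `K ∗ f`
is defined everywhere and `|x|^β (K ∗ f)(x) → K₀ ∫ f`. -/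
theorem decay_of_convolution (β : ℝ) (hβ : 1 < β) (K f : ℝ → ℝ)
    (hKint : Integrable K) (hfint : Integrable f)
    (C : ℝ) (hC : 0 < C)
    (hKbd : ∀ x : ℝ, x ≠ 0 → |K x| ≤ C * |x| ^ (-β))
    (hfbd : ∀ x : ℝ, |f x| ≤ C * (1 + x ^ 2) ^ (-β / 2))
    (K₀ : ℝ)
    (hKlim : Tendsto (fun x : ℝ => |x| ^ β * K x) (cocompact ℝ) (nhds K₀))
    (hflim : Tendsto (fun x : ℝ => |x| ^ β * f x) (cocompact ℝ) (nhds 0)) :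
    (∀ x : ℝ, Integrable (fun y : ℝ => K (x - y) * f y)) ∧
      Tendsto (fun x : ℝ => |x| ^ β * ∫ y : ℝ, K (x - y) * f y) (cocompact ℝ)
        (nhds (K₀ * ∫ y : ℝ, f y)) := by
  have hint : ∀ x : ℝ, Integrable (fun y : ℝ => K (x - y) * f y) := by
    intro x
    refine (hKint.comp_sub_left x).mul_bdd (c := C) hfint.aestronglyMeasurable
      (Eventually.of_forall fun y => ?_)
    rw [Real.norm_eq_abs]
    refine (hfbd y).trans ?_
    have : (1 + y ^ 2) ^ (-β / 2) ≤ 1 :=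
      Real.rpow_le_one_of_one_le_of_nonpos (by nlinarith [sq_nonneg y]) (by linarith)
    nlinarith
  refine ⟨hint, ?_⟩
  have hfbd' : ∀ x : ℝ, x ≠ 0 → |f x| ≤ C * |x| ^ (-β) := by
    intro x hx
    refine (hfbd x).trans ?_
    gcongr
    have h1 : |x| ^ (-β) = (x ^ 2) ^ (-β / 2) := by
      rw [← sq_abs, ← Real.rpow_natCast, ← Real.rpow_mul (abs_nonneg x)]
      congr 1
      push_cast
      ring
    rw [h1]
    exact Real.rpow_le_rpow_of_nonpos (by positivity) (by linarith) (by linarith)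
  have hA := aux_half β hβ K f hKint hfint C hC hKbd K₀ hKlim (fun x y => |x| < 2 * |x - y|)
    (fun x => measurableSet_lt (by fun_prop) (by fun_prop)) (fun x y h => h.le)
    (fun x y h => by
      have := abs_sub_abs_le_abs_sub x y
      linarith)
  have hB := aux_half β hβ f K hfint hKint C hC hfbd' 0 hflim (fun x y => ¬ |x| < 2 * |y|)
    (fun x => (measurableSet_lt (f := fun _ : ℝ => |x|) (g := fun y : ℝ => 2 * |y|)
      (by fun_prop) (by fun_prop)).compl) (fun x y h => by
      have := abs_sub_abs_le_abs_sub x y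
      linarith)
    (fun x y h => by linarith)
  have hAB := hA.add hB
  rw [zero_mul, add_zero] at hAB
  refine hAB.congr fun x => ?_
  have hm : MeasurableSet {y : ℝ | |x| < 2 * |x - y|} :=
    measurableSet_lt (by fun_prop) (by fun_prop)
  rw [← integral_sub_left_eq_self (fun y => {y | ¬ |x| < 2 * |y|}.indicator
    (fun y => |x| ^ β * (f (x - y) * K y)) y) volume x, ← integral_const_mul,
    ← integral_add_compl hm ((hint x).const_mul _), integral_indicator hm]
  congr 1
  rw [← integral_indicator hm.compl]
  congr 1
  ext y
  simp only [Set.indicator, Set.mem_setOf_eq, Set.mem_compl_iff, sub_sub_cancel, mul_comm (f y)]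
end

section
/- Let 1 < σ < 2 and define G_σ(x) := (1/(2π)) ∫_ℝ e^{iξx}/(1 + |ξ|^σ) dξ (the integrand is absolutely integrable, so G_σ is a well-defined continuous real-valued function). Then: (i) G_σ ∈ L¹(ℝ); (ii) G_σ is positive and even; (iii) there exists a constant C_σ > 0 such that |x|^{1+σ} G_σ(x) → C_σ as |x| → ∞. -/
open MeasureTheory Filter Real

/-- `G_σ(x) = (1/(2π)) ∫_ℝ e^{iξx}/(1 + |ξ|^σ) dξ` (a real number, taken as the real part
of the absolutely convergent complex integral). -/
noncomputable def Gsigma (σ : ℝ) (x : ℝ) : ℝ :=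
  (1 / (2 * π)) *
    (∫ ξ : ℝ, Complex.exp (Complex.I * (ξ : ℂ) * (x : ℂ)) / ((1 + |ξ| ^ σ : ℝ) : ℂ)).re

namespace GS

lemma integrable_base {s : ℝ} (hs : 1 < s) : Integrable (fun x : ℝ => 1 / (1 + |x| ^ s)) := by
  have h := (integrable_one_add_norm (E := ℝ) (μ := volume) (r := s) (by simpa using hs)).const_mul (2 ^ s)
  refine h.mono' (Measurable.aestronglyMeasurable (by fun_prop)) ?_
  · refine Eventually.of_forall fun x => ?_
    have ha : 0 ≤ |x| := abs_nonneg x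
    have hp : 0 ≤ |x| ^ s := rpow_nonneg ha s
    rw [Real.norm_of_nonneg (by positivity), Real.norm_eq_abs, rpow_neg (by positivity),
      ← div_eq_mul_inv, div_le_div_iff₀ (by positivity) (by positivity), one_mul]
    rcases le_total |x| 1 with h1 | h1
    · calc (1 + |x|) ^ s ≤ 2 ^ s := rpow_le_rpow (by positivity) (by linarith) (by linarith)
        _ ≤ 2 ^ s * (1 + |x| ^ s) := le_mul_of_one_le_right (by positivity) (by linarith)
    · calc (1 + |x|) ^ s ≤ (2 * |x|) ^ s := rpow_le_rpow (by positivity) (by linarith) (by linarith)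
        _ = 2 ^ s * |x| ^ s := mul_rpow (by norm_num) ha
        _ ≤ 2 ^ s * (1 + |x| ^ s) := by gcongr; linarith

noncomputable def F (σ x : ℝ) (z : ℂ) : ℂ := Complex.exp (Complex.I * z * x) / (1 + z ^ (σ : ℂ))

lemma den_ne {σ : ℝ} (hσ1 : 1 < σ) (hσ2 : σ < 2) {z : ℂ} (h1 : 0 ≤ z.re) (h2 : 0 ≤ z.im) :
    1 + z ^ (σ : ℂ) ≠ 0 := by
  intro h
  have hre := congrArg Complex.re h
  have him := congrArg Complex.im h
  simp only [Complex.add_re, Complex.add_im, Complex.one_re, Complex.one_im, Complex.zero_re,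
    Complex.zero_im, Complex.cpow_ofReal_re, Complex.cpow_ofReal_im] at hre him
  have a0 : 0 ≤ z.arg := Complex.arg_nonneg_iff.2 h2
  have a1 : z.arg ≤ π / 2 := Complex.arg_le_pi_div_two_iff.2 (Or.inl h1)
  have hz : 0 ≤ ‖z‖ ^ σ := by positivity
  rcases eq_or_lt_of_le a0 with h0 | h0
  · rw [← h0] at hre; simp at hre; linarith
  · have : 0 < Real.sin (z.arg * σ) := by
      apply Real.sin_pos_of_pos_of_lt_pi (by positivity)
      nlinarith [pi_pos]
    have hz0 : ‖z‖ ^ σ = 0 := by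
      rw [zero_add] at him
      exact (mul_eq_zero.1 him).resolve_right this.ne'
    rw [hz0] at hre; simp at hre

lemma F_cont {σ : ℝ} (hσ1 : 1 < σ) (hσ2 : σ < 2) (x : ℝ) :
    ContinuousOn (F σ x) {z : ℂ | 0 ≤ z.re ∧ 0 ≤ z.im} := by
  intro z hz
  apply ContinuousAt.continuousWithinAt
  unfold F
  refine ContinuousAt.div (by fun_prop) ?_ (den_ne hσ1 hσ2 hz.1 hz.2)
  exact continuousAt_const.add
    (Complex.continuousAt_cpow_const_of_re_pos (Or.inl hz.1) (by simp; linarith))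

lemma exp_norm {x : ℝ} (hx : 0 ≤ x) {z : ℂ} (h2 : 0 ≤ z.im) :
    ‖Complex.exp (Complex.I * z * x)‖ ≤ 1 := by
  rw [Complex.norm_exp]
  simp
  positivity

lemma norm_cpow' (σ : ℝ) (hσ : 0 < σ) (z : ℂ) : ‖z ^ (σ : ℂ)‖ = ‖z‖ ^ σ := by
  exact Complex.norm_cpow_real z σ

lemma F_bound {σ : ℝ} (hσ1 : 1 < σ) {x : ℝ} (hx : 0 ≤ x) {z : ℂ} (h2 : 0 ≤ z.im)
    {R : ℝ} (hR : 1 < R) (hz : R ≤ ‖z‖) : ‖F σ x z‖ ≤ 1 / (R ^ σ - 1) := by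
  have h1 : 1 < R ^ σ := one_lt_rpow hR (by linarith)
  unfold F
  rw [norm_div]
  refine div_le_div₀ zero_le_one (exp_norm hx h2) (by linarith) ?_
  have h3 : R ^ σ ≤ ‖z‖ ^ σ := rpow_le_rpow (by linarith) hz (by linarith)
  have h4 := norm_sub_norm_le (z ^ (σ : ℂ)) (-1)
  rw [norm_cpow' σ (by linarith)] at h4
  simp at h4
  rw [add_comm]
  linarith

lemma F_real {σ : ℝ} (x : ℝ) {t : ℝ} (ht : 0 < t) :
    F σ x t = Complex.exp (Complex.I * t * x) / ((1 + t ^ σ : ℝ) : ℂ) := by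
  unfold F; push_cast; rw [Complex.ofReal_cpow ht.le]

lemma F_real_int {σ : ℝ} (hσ1 : 1 < σ) (hσ2 : σ < 2) {x : ℝ} (hx : 0 ≤ x) :
    IntegrableOn (fun t : ℝ => F σ x t) (Set.Ioi 0) := by
  refine (integrable_base hσ1).integrableOn.mono' ?_ ?_
  · apply ContinuousOn.aestronglyMeasurable _ measurableSet_Ioi
    apply (F_cont hσ1 hσ2 x).comp (by fun_prop)
    intro t ht; simpa using le_of_lt ht
  · refine (ae_restrict_iff' measurableSet_Ioi).2 (Eventually.of_forall fun t ht => ?_)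
    have ht : 0 < t := ht
    rw [F_real x ht, norm_div, Complex.norm_real, Real.norm_of_nonneg (by positivity), abs_of_pos ht]
    gcongr
    exact exp_norm hx (by simp)

noncomputable def D (σ t : ℝ) : ℝ := 1 + 2 * Real.cos (π / 2 * σ) * t ^ σ + (t ^ σ) ^ 2

noncomputable def k (σ : ℝ) : ℝ := (1 + Real.cos (π / 2 * σ)) / 2

lemma k_pos {σ : ℝ} (hσ1 : 1 < σ) (hσ2 : σ < 2) : 0 < k σ := by
  have := Real.cos_lt_cos_of_nonneg_of_le_pi (x := π / 2 * σ) (y := π) (by positivity) le_rfl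
    (by nlinarith [pi_pos])
  rw [Real.cos_pi] at this
  unfold k; linarith

lemma k_le (σ : ℝ) : k σ ≤ 1 := by
  unfold k; linarith [Real.cos_le_one (π / 2 * σ)]

lemma sin_pos' {σ : ℝ} (hσ1 : 1 < σ) (hσ2 : σ < 2) : 0 < Real.sin (π / 2 * σ) :=
  Real.sin_pos_of_pos_of_lt_pi (by positivity) (by nlinarith [pi_pos])

lemma D_ge (σ t : ℝ) : k σ * (1 + t ^ σ) ^ 2 ≤ D σ t := by
  unfold k D
  nlinarith [mul_nonneg (sub_nonneg.2 (Real.cos_le_one (π / 2 * σ))) (sq_nonneg (1 - t ^ σ))]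

lemma D_ge_k {σ : ℝ} (hσ1 : 1 < σ) (hσ2 : σ < 2) {t : ℝ} (ht : 0 < t) : k σ ≤ D σ t := by
  have := D_ge σ t
  have h := k_pos hσ1 hσ2
  have h2 : 0 < t ^ σ := by positivity
  have h3 : 1 ≤ (1 + t ^ σ) ^ 2 := by nlinarith
  exact (le_mul_of_one_le_right h.le h3).trans this

lemma cpow_im {σ : ℝ} {t : ℝ} (ht : 0 < t) : ((t * Complex.I : ℂ) ^ (σ : ℂ)).re = t ^ σ * Real.cos (π / 2 * σ)
   ∧ ((t * Complex.I : ℂ) ^ (σ : ℂ)).im = t ^ σ * Real.sin (π / 2 * σ) := by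
  rw [Complex.cpow_ofReal_re, Complex.cpow_ofReal_im, Complex.arg_real_mul _ ht, Complex.arg_I]
  simp [abs_of_pos ht]

lemma normSq_den {σ : ℝ} {t : ℝ} (ht : 0 < t) :
    Complex.normSq (1 + (t * Complex.I : ℂ) ^ (σ : ℂ)) = D σ t := by
  obtain ⟨h1, h2⟩ := cpow_im (σ := σ) ht
  rw [Complex.normSq_apply, Complex.add_re, Complex.add_im, h1, h2]
  simp only [Complex.one_re, Complex.one_im, D]
  nlinarith [Real.sin_sq_add_cos_sq (π / 2 * σ)]

lemma F_im_re {σ : ℝ} (x : ℝ) {t : ℝ} (ht : 0 < t) :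
    (Complex.I * F σ x (t * Complex.I)).re =
      Real.sin (π / 2 * σ) * (Real.exp (-(t * x)) * t ^ σ / D σ t) := by
  obtain ⟨h1, h2⟩ := cpow_im (σ := σ) ht
  have he : Complex.exp (Complex.I * (t * Complex.I) * x) = ((Real.exp (-(t * x)) : ℝ) : ℂ) := by
    push_cast
    congr 1
    linear_combination (t * x : ℂ) * Complex.I_sq
  unfold F
  rw [he, Complex.I_mul_re, Complex.div_im, normSq_den ht, Complex.add_re, Complex.add_im, h1, h2,
    Complex.ofReal_re, Complex.ofReal_im]
  simp
  ring

lemma F_im_int {σ : ℝ} (hσ1 : 1 < σ) (hσ2 : σ < 2) {x : ℝ} (hx : 0 ≤ x) :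
    IntegrableOn (fun t : ℝ => F σ x (t * Complex.I)) (Set.Ioi 0) := by
  refine ((integrable_base hσ1).const_mul (1 / k σ)).integrableOn.mono' ?_ ?_
  · apply ContinuousOn.aestronglyMeasurable _ measurableSet_Ioi
    apply (F_cont hσ1 hσ2 x).comp (by fun_prop)
    intro t ht; simpa using le_of_lt ht
  · refine (ae_restrict_iff' measurableSet_Ioi).2 (Eventually.of_forall fun t ht => ?_)
    have ht : 0 < t := ht
    have hk := k_pos hσ1 hσ2
    unfold F
    rw [norm_div, abs_of_pos ht, one_div_mul_one_div]
    refine div_le_div₀ zero_le_one (exp_norm hx (by simpa using ht.le)) (by positivity) ?_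
    apply le_of_sq_le_sq _ (norm_nonneg _)
    rw [← Complex.normSq_eq_norm_sq, normSq_den ht]
    refine le_trans ?_ (D_ge σ t)
    have := k_le σ
    have : 0 < (1 + t ^ σ) ^ 2 := by positivity
    rw [mul_pow]
    gcongr
    nlinarith

lemma rect {σ : ℝ} (hσ1 : 1 < σ) (hσ2 : σ < 2) (x : ℝ) {R : ℝ} (hR : 0 < R) :
    (∫ t in (0 : ℝ)..R, F σ x t) - (∫ t in (0 : ℝ)..R, F σ x (t + R * Complex.I)) +
      Complex.I * (∫ t in (0 : ℝ)..R, F σ x (R + t * Complex.I)) -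
      Complex.I * (∫ t in (0 : ℝ)..R, F σ x (t * Complex.I)) = 0 := by
  have := Complex.integral_boundary_rect_eq_zero_of_continuousOn_of_differentiableOn (F σ x) 0
    (R + R * Complex.I) ?_ ?_
  · simpa using this
  · apply (F_cont hσ1 hσ2 x).mono
    intro z hz
    rw [Complex.mem_reProdIm] at hz
    simp [Set.uIcc_of_le hR.le] at hz
    exact ⟨hz.1.1, hz.2.1⟩
  · intro z hz
    rw [Complex.mem_reProdIm] at hz
    simp [hR.le] at hz
    apply DifferentiableAt.differentiableWithinAt
    unfold F
    refine DifferentiableAt.div (by fun_prop) ?_ (den_ne hσ1 hσ2 hz.1.1.le hz.2.1.le)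
    refine (differentiableAt_const _).add (DifferentiableAt.cpow_const differentiableAt_id ?_)
    exact Or.inl hz.1.1

lemma side_tendsto {σ : ℝ} (hσ1 : 1 < σ) {x : ℝ} (hx : 0 ≤ x) (p : ℝ → ℝ → ℂ)
    (hp : ∀ R t, 0 < R → 0 < t → 0 ≤ (p R t).im ∧ R ≤ ‖p R t‖) :
    Tendsto (fun R : ℝ => ∫ t in (0 : ℝ)..R, F σ x (p R t)) atTop (nhds 0) := by
  have hb : Tendsto (fun R : ℝ => 2 * R ^ (-(σ - 1))) atTop (nhds 0) := by
    simpa using (tendsto_rpow_neg_atTop (by linarith : 0 < σ - 1)).const_mul 2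
  refine squeeze_zero_norm' ?_ hb
  have h2 : ∀ᶠ R : ℝ in atTop, 2 ≤ R ^ σ :=
    (tendsto_rpow_atTop (by linarith : 0 < σ)).eventually_ge_atTop 2
  filter_upwards [eventually_gt_atTop 1, h2] with R hR h2
  have := intervalIntegral.norm_integral_le_of_norm_le_const (a := 0) (b := R)
    (f := fun t => F σ x (p R t)) (C := 1 / (R ^ σ - 1)) ?_
  · refine this.trans ?_
    rw [sub_zero, abs_of_pos (by linarith), neg_sub, rpow_sub (by linarith), rpow_one, ← mul_div_assoc,
      one_div_mul_eq_div, div_le_div_iff₀ (by linarith) (by linarith)]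
    nlinarith
  · intro t ht
    rw [Set.uIoc_of_le (by linarith)] at ht
    obtain ⟨h3, h4⟩ := hp R t (by linarith) ht.1
    exact F_bound hσ1 hx h3 hR h4

lemma rotate {σ : ℝ} (hσ1 : 1 < σ) (hσ2 : σ < 2) {x : ℝ} (hx : 0 ≤ x) :
    ∫ t in Set.Ioi (0 : ℝ), F σ x t = ∫ t in Set.Ioi (0 : ℝ), Complex.I * F σ x (t * Complex.I) := by
  have h1 := intervalIntegral_tendsto_integral_Ioi 0 (F_real_int hσ1 hσ2 hx) tendsto_id
  have h2 := (intervalIntegral_tendsto_integral_Ioi 0 (F_im_int hσ1 hσ2 hx) tendsto_id).const_mul Complex.I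
  have h3 := side_tendsto hσ1 hx (fun R t => t + R * Complex.I) (fun R t hR ht => by
    constructor
    · simp [hR.le]
    · simpa [abs_of_pos hR] using Complex.abs_im_le_norm (t + R * Complex.I))
  have h4 := (side_tendsto hσ1 hx (fun R t => R + t * Complex.I) (fun R t hR ht => by
    constructor
    · simp [ht.le]
    · simpa [abs_of_pos hR] using Complex.abs_re_le_norm (R + t * Complex.I))).const_mul Complex.I
  have h5 := ((h1.sub h3).add h4).sub h2
  have h6 := h5.congr' (f₂ := fun _ => 0) (by
    filter_upwards [eventually_gt_atTop 0] with R hR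
    exact rect hσ1 hσ2 x hR)
  have h7 := tendsto_nhds_unique h6 tendsto_const_nhds
  rw [integral_const_mul]
  linear_combination h7

lemma G_cos {σ : ℝ} (hσ1 : 1 < σ) (x : ℝ) :
    Gsigma σ x = 1 / (2 * π) * ∫ ξ : ℝ, Real.cos (ξ * x) / (1 + |ξ| ^ σ) := by
  unfold Gsigma
  congr 1
  have hi : Integrable (fun ξ : ℝ => Complex.exp (Complex.I * (ξ : ℂ) * (x : ℂ)) / ((1 + |ξ| ^ σ : ℝ) : ℂ)) := by
    refine (integrable_base hσ1).mono' ?_ ?_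
    · apply Measurable.aestronglyMeasurable
      fun_prop
    · refine Eventually.of_forall fun t => ?_
      rw [norm_div, Complex.norm_real, Real.norm_of_nonneg (by positivity), Complex.norm_exp]
      simp
  have := integral_re hi
  simp only [RCLike.re_to_complex] at this
  rw [← this]
  congr 1
  ext ξ
  rw [Complex.div_ofReal_re, Complex.exp_re]
  simp

lemma G_even {σ : ℝ} (hσ1 : 1 < σ) (x : ℝ) : Gsigma σ (-x) = Gsigma σ x := by
  simp [G_cos hσ1]

noncomputable def H (σ x : ℝ) : ℝ := ∫ t in Set.Ioi (0 : ℝ), Real.exp (-(t * x)) * t ^ σ / D σ t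

lemma G_eq {σ : ℝ} (hσ1 : 1 < σ) (hσ2 : σ < 2) {x : ℝ} (hx : 0 ≤ x) :
    Gsigma σ x = Real.sin (π / 2 * σ) / π * H σ x := by
  rw [G_cos hσ1]
  have e1 : ∫ ξ : ℝ, Real.cos (ξ * x) / (1 + |ξ| ^ σ) =
      2 * ∫ ξ in Set.Ioi (0 : ℝ), Real.cos (ξ * x) / (1 + ξ ^ σ) := by
    rw [← integral_comp_abs (f := fun ξ => Real.cos (ξ * x) / (1 + ξ ^ σ))]
    congr 1
    ext ξ
    rcases abs_choice ξ with h | h <;> simp [h]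
  have e2 : ∫ ξ in Set.Ioi (0 : ℝ), Real.cos (ξ * x) / (1 + ξ ^ σ) =
      (∫ t in Set.Ioi (0 : ℝ), F σ x t).re := by
    have := integral_re (F_real_int hσ1 hσ2 hx)
    simp only [RCLike.re_to_complex] at this
    rw [← this]
    refine setIntegral_congr_fun measurableSet_Ioi fun t ht => ?_
    rw [F_real x ht, Complex.div_ofReal_re, Complex.exp_re]
    simp
  have e3 : (∫ t in Set.Ioi (0 : ℝ), F σ x t).re = Real.sin (π / 2 * σ) * H σ x := by
    rw [rotate hσ1 hσ2 hx]
    have := integral_re ((F_im_int hσ1 hσ2 hx).const_mul Complex.I)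
    simp only [RCLike.re_to_complex] at this
    rw [← this, H, ← integral_const_mul]
    exact setIntegral_congr_fun measurableSet_Ioi fun t ht => F_im_re x ht
  rw [e1, e2, e3]
  field_simp

lemma H_int {σ : ℝ} (hσ1 : 1 < σ) (hσ2 : σ < 2) {x : ℝ} (hx : 0 ≤ x) :
    IntegrableOn (fun t => Real.exp (-(t * x)) * t ^ σ / D σ t) (Set.Ioi 0) := by
  have := (((F_im_int hσ1 hσ2 hx).const_mul Complex.I).re).const_mul (1 / Real.sin (π / 2 * σ))
  refine IntegrableOn.congr_fun this (fun t ht => ?_) measurableSet_Ioi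
  simp only [RCLike.re_to_complex]
  rw [F_im_re x ht]
  rw [← mul_assoc, one_div_mul_cancel (sin_pos' hσ1 hσ2).ne', one_mul]

lemma H_pos {σ : ℝ} (hσ1 : 1 < σ) (hσ2 : σ < 2) {x : ℝ} (hx : 0 ≤ x) : 0 < H σ x := by
  have hp : ∀ t ∈ Set.Ioi (0 : ℝ), 0 < Real.exp (-(t * x)) * t ^ σ / D σ t := by
    intro t ht
    have ht : 0 < t := ht
    have := (k_pos hσ1 hσ2).trans_le (D_ge_k hσ1 hσ2 ht)
    positivity
  unfold H
  rw [setIntegral_pos_iff_support_of_nonneg_ae _ (H_int hσ1 hσ2 hx)]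
  · rw [Set.inter_eq_right.2 (fun t ht => Function.mem_support.2 (hp t ht).ne')]
    simp
  · exact (ae_restrict_iff' measurableSet_Ioi).2 (Eventually.of_forall fun t ht => (hp t ht).le)

lemma G_pos {σ : ℝ} (hσ1 : 1 < σ) (hσ2 : σ < 2) (x : ℝ) : 0 < Gsigma σ x := by
  wlog hx : 0 ≤ x
  · rw [← G_even hσ1]; exact this hσ1 hσ2 _ (by linarith)
  rw [G_eq hσ1 hσ2 hx]
  have := sin_pos' hσ1 hσ2
  have := H_pos hσ1 hσ2 hx
  positivity

lemma G_abs {σ : ℝ} (hσ1 : 1 < σ) (x : ℝ) : Gsigma σ |x| = Gsigma σ x := by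
  rcases abs_choice x with h | h <;> rw [h]
  exact G_even hσ1 x

lemma H_scale {σ : ℝ} {x : ℝ} (hx : 0 < x) :
    x ^ (1 + σ) * H σ x = ∫ s in Set.Ioi (0 : ℝ), Real.exp (-s) * s ^ σ / D σ (x⁻¹ * s) := by
  have h := integral_comp_mul_left_Ioi (fun t => Real.exp (-(t * x)) * t ^ σ / D σ t) 0
    (inv_pos.2 hx)
  rw [mul_zero, inv_inv, smul_eq_mul] at h
  rw [rpow_add hx, rpow_one, mul_comm x, mul_assoc, H, ← h, ← integral_const_mul]
  refine setIntegral_congr_fun measurableSet_Ioi fun t ht => ?_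
  have ht : 0 < t := ht
  rw [mul_rpow (by positivity) ht.le, inv_rpow hx.le]
  have : x⁻¹ * t * x = t := by field_simp
  have : 0 < x ^ σ := by positivity
  rw [‹x⁻¹ * t * x = t›]
  field_simp

lemma gam_int {σ : ℝ} (hσ1 : 1 < σ) :
    IntegrableOn (fun s => 1 / k σ * (Real.exp (-s) * s ^ σ)) (Set.Ioi 0) := by
  have := Real.GammaIntegral_convergent (s := σ + 1) (by linarith)
  simp only [add_sub_cancel_right] at this
  exact this.const_mul _

lemma ptbound {σ : ℝ} (hσ1 : 1 < σ) (hσ2 : σ < 2) {x : ℝ} (hx : 0 < x) {s : ℝ} (hs : 0 < s) :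
    ‖Real.exp (-s) * s ^ σ / D σ (x⁻¹ * s)‖ ≤ 1 / k σ * (Real.exp (-s) * s ^ σ) := by
  have hk := k_pos hσ1 hσ2
  have hD := D_ge_k hσ1 hσ2 (t := x⁻¹ * s) (by positivity)
  have := hk.trans_le hD
  rw [Real.norm_of_nonneg (by positivity), one_div_mul_eq_div]
  gcongr

lemma H_tendsto {σ : ℝ} (hσ1 : 1 < σ) (hσ2 : σ < 2) :
    Tendsto (fun x => x ^ (1 + σ) * H σ x) atTop (nhds (Real.Gamma (σ + 1))) := by
  have h : Tendsto (fun x : ℝ => ∫ s in Set.Ioi (0 : ℝ), Real.exp (-s) * s ^ σ / D σ (x⁻¹ * s))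
      atTop (nhds (∫ s in Set.Ioi (0 : ℝ), Real.exp (-s) * s ^ σ)) := by
    refine tendsto_integral_filter_of_dominated_convergence
      (fun s => 1 / k σ * (Real.exp (-s) * s ^ σ)) ?_ ?_ (gam_int hσ1) ?_
    · refine Eventually.of_forall fun x => ?_
      apply Measurable.aestronglyMeasurable
      unfold D
      fun_prop
    · filter_upwards [eventually_gt_atTop 0] with x hx
      exact (ae_restrict_iff' measurableSet_Ioi).2 (Eventually.of_forall fun s hs =>
        ptbound hσ1 hσ2 hx hs)
    · refine Eventually.of_forall fun s => ?_
      have h0 : Tendsto (fun x : ℝ => x⁻¹ * s) atTop (nhds 0) := by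
        simpa using tendsto_inv_atTop_zero.mul_const s
      have hc : Continuous (D σ) := by
        have : Continuous fun t : ℝ => t ^ σ := Real.continuous_rpow_const (by linarith)
        unfold D
        fun_prop
      have h1 : Tendsto (fun x : ℝ => D σ (x⁻¹ * s)) atTop (nhds 1) := by
        have := (hc.tendsto 0).comp h0
        have e : D σ 0 = 1 := by simp [D, zero_rpow (by linarith : σ ≠ 0)]
        rwa [e] at this
      have h2 := (tendsto_const_nhds (x := Real.exp (-s) * s ^ σ)).div h1 one_ne_zero
      rw [div_one] at h2
      exact h2
  have e := Real.Gamma_eq_integral (s := σ + 1) (by linarith)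
  simp only [add_sub_cancel_right] at e
  rw [e]
  refine h.congr' ?_
  filter_upwards [eventually_gt_atTop 0] with x hx
  exact (H_scale hx).symm

lemma G_tendsto {σ : ℝ} (hσ1 : 1 < σ) (hσ2 : σ < 2) :
    Tendsto (fun x : ℝ => |x| ^ (1 + σ) * Gsigma σ x) (cocompact ℝ)
      (nhds (Real.sin (π / 2 * σ) / π * Real.Gamma (σ + 1))) := by
  have h := ((H_tendsto hσ1 hσ2).const_mul (Real.sin (π / 2 * σ) / π)).comp
    (tendsto_norm_cocompact_atTop (E := ℝ))
  refine h.congr fun x => ?_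
  simp only [Function.comp, Real.norm_eq_abs]
  rw [← G_abs hσ1 x, G_eq hσ1 hσ2 (abs_nonneg x)]
  ring

lemma G_integrable {σ : ℝ} (hσ1 : 1 < σ) (hσ2 : σ < 2) : Integrable (Gsigma σ) := by
  have hc : Continuous (Gsigma σ) := by
    have : Gsigma σ = fun x => 1 / (2 * π) * ∫ ξ : ℝ, Real.cos (ξ * x) / (1 + |ξ| ^ σ) :=
      funext (G_cos hσ1)
    rw [this]
    refine continuous_const.mul (continuous_of_dominated (bound := fun x : ℝ => 1 / (1 + |x| ^ σ)) ?_ ?_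
      (integrable_base hσ1) ?_)
    · intro x
      apply Measurable.aestronglyMeasurable
      fun_prop
    · intro x
      refine Eventually.of_forall fun t => ?_
      rw [norm_div, Real.norm_of_nonneg (by positivity : 0 ≤ 1 + |t| ^ σ)]
      gcongr
      exact Real.abs_cos_le_one _
    · refine Eventually.of_forall fun t => ?_
      fun_prop
  have hO : Gsigma σ =O[cocompact ℝ] fun x : ℝ => 1 / (1 + |x| ^ (1 + σ)) := by
    have h1 := (G_tendsto hσ1 hσ2).eventually (eventually_le_nhds (lt_add_one _))
    set C := Real.sin (π / 2 * σ) / π * Real.Gamma (σ + 1) + 1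
    refine Asymptotics.IsBigO.of_bound (2 * C) ?_
    filter_upwards [h1, (tendsto_norm_cocompact_atTop (E := ℝ)).eventually_ge_atTop 1] with x hx hx1
    rw [Real.norm_eq_abs] at hx1
    have hG := G_pos hσ1 hσ2 x
    have hp : 1 ≤ |x| ^ (1 + σ) := one_le_rpow hx1 (by linarith)
    rw [Real.norm_of_nonneg hG.le, Real.norm_of_nonneg (by positivity), mul_one_div,
      le_div_iff₀ (by positivity)]
    nlinarith
  exact hc.locallyIntegrable.integrable_of_isBigO_cocompact hO
    ((integrable_base (by linarith : 1 < 1 + σ)).integrableAtFilter _)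

end GS

theorem Gsigma_properties (σ : ℝ) (hσ1 : 1 < σ) (hσ2 : σ < 2) :
    Integrable (Gsigma σ) ∧
      (∀ x : ℝ, 0 < Gsigma σ x) ∧
      (∀ x : ℝ, Gsigma σ (-x) = Gsigma σ x) ∧
      ∃ C : ℝ, 0 < C ∧
        Tendsto (fun x : ℝ => |x| ^ (1 + σ) * Gsigma σ x) (cocompact ℝ) (nhds C) := by
  refine ⟨GS.G_integrable hσ1 hσ2, GS.G_pos hσ1 hσ2, GS.G_even hσ1, _, ?_, GS.G_tendsto hσ1 hσ2⟩
  have := GS.sin_pos' hσ1 hσ2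
  have := Real.Gamma_pos_of_pos (by linarith : 0 < σ + 1)
  positivity
end

section
/- For every x > 0, the improper integral g₁(x) := lim_{R→∞} ∫₀^R cos(ξx)/(1 + ξ) dξ exists, and it satisfies the identity x² g₁(x) = 2 ∫₀^∞ (1 − cos(ξx))/(1 + ξ)³ dξ, where the integral on the right-hand side converges absolutely. -/
open MeasureTheory Filter Real

/-- For `x > 0` the improper integral `g₁(x) = lim_{R→∞} ∫₀^R cos(ξx)/(1+ξ) dξ` exists and
`x² g₁(x) = 2 ∫₀^∞ (1 − cos(ξx))/(1+ξ)³ dξ`, the right-hand integral converging absolutely. -/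
theorem improper_integral_identity (x : ℝ) (hx : 0 < x) :
    ∃ L : ℝ,
      Tendsto (fun R : ℝ => ∫ ξ in (0:ℝ)..R, Real.cos (ξ * x) / (1 + ξ)) atTop (nhds L) ∧
      IntegrableOn (fun ξ : ℝ => (1 - Real.cos (ξ * x)) / (1 + ξ) ^ 3) (Set.Ioi 0) ∧
      x ^ 2 * L = 2 * ∫ ξ in Set.Ioi (0:ℝ), (1 - Real.cos (ξ * x)) / (1 + ξ) ^ 3 := by
  have hinv : Tendsto (fun ξ : ℝ => (1 + ξ)⁻¹) atTop (nhds 0) :=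
    tendsto_inv_atTop_zero.comp (tendsto_atTop_add_const_left _ 1 tendsto_id)
  have hdom : IntegrableOn (fun ξ : ℝ => 2 / (1 + ξ) ^ 3) (Set.Ioi 0) := by
    refine integrableOn_Ioi_deriv_of_nonneg' (g := fun ξ : ℝ => -((1 + ξ)⁻¹) ^ 2) (l := 0) ?_ ?_ ?_
    · intro ξ hξ
      have h0 : (1 + ξ) ≠ 0 := by
        have : (0:ℝ) ≤ ξ := hξ
        positivity
      have h1 := ((((hasDerivAt_id ξ).const_add 1).inv h0).pow 2).neg
      refine h1.congr_deriv ?_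
      simp
      field_simp
    · intro ξ hξ
      have : (0:ℝ) < ξ := hξ
      positivity
    · simpa using (hinv.pow 2).neg
  have hint : IntegrableOn (fun ξ : ℝ => (1 - Real.cos (ξ * x)) / (1 + ξ) ^ 3) (Set.Ioi 0) := by
    refine Integrable.mono' hdom ?_ ?_
    · exact Measurable.aestronglyMeasurable (by fun_prop)
    · refine (ae_restrict_iff' measurableSet_Ioi).2 (Eventually.of_forall fun ξ hξ => ?_)
      have h0 : (0:ℝ) < ξ := hξ
      have h1 := Real.cos_le_one (ξ * x)
      have h2 := Real.neg_one_le_cos (ξ * x)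
      rw [Real.norm_eq_abs, abs_of_nonneg (div_nonneg (by linarith) (by positivity))]
      gcongr
      linarith
  set I := ∫ ξ in Set.Ioi (0:ℝ), (1 - Real.cos (ξ * x)) / (1 + ξ) ^ 3 with hI
  set F : ℝ → ℝ := fun ξ => Real.sin (ξ * x) / x * (1 + ξ)⁻¹
    + (1 - Real.cos (ξ * x)) / x ^ 2 * ((1 + ξ)⁻¹) ^ 2 with hF
  have hlimI := intervalIntegral_tendsto_integral_Ioi 0 hint tendsto_id
  have hFlim : Tendsto F atTop (nhds 0) := by
    have a1 : Tendsto (fun ξ : ℝ => Real.sin (ξ * x) / x * (1 + ξ)⁻¹) atTop (nhds 0) := by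
      refine bdd_le_mul_tendsto_zero' (1 / x) (Eventually.of_forall fun ξ => ?_) hinv
      rw [abs_div, abs_of_pos hx]
      gcongr
      exact Real.abs_sin_le_one _
    have a2 : Tendsto (fun ξ : ℝ => (1 - Real.cos (ξ * x)) / x ^ 2 * ((1 + ξ)⁻¹) ^ 2)
        atTop (nhds 0) := by
      refine bdd_le_mul_tendsto_zero' (2 / x ^ 2) (Eventually.of_forall fun ξ => ?_)
        (by simpa using hinv.pow 2)
      rw [abs_div, abs_of_pos (pow_pos hx 2)]
      gcongr
      rw [abs_le]
      constructor <;> linarith [Real.cos_le_one (ξ * x), Real.neg_one_le_cos (ξ * x)]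
    have a3 := a1.add a2
    rw [add_zero] at a3
    exact a3
  have hid : ∀ R : ℝ, 0 ≤ R → ∫ ξ in (0:ℝ)..R, Real.cos (ξ * x) / (1 + ξ) =
      F R + 2 / x ^ 2 * ∫ ξ in (0:ℝ)..R, (1 - Real.cos (ξ * x)) / (1 + ξ) ^ 3 := by
    intro R hR
    have hne : ∀ ξ ∈ Set.uIcc 0 R, 1 + ξ ≠ 0 := by
      intro ξ hξ
      rw [Set.uIcc_of_le hR] at hξ
      have := hξ.1
      positivity
    have i1 : IntervalIntegrable (fun ξ : ℝ => Real.cos (ξ * x) / (1 + ξ)) volume 0 R :=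
      ContinuousOn.intervalIntegrable (ContinuousOn.div (by fun_prop) (by fun_prop) hne)
    have i2 : IntervalIntegrable (fun ξ : ℝ => (1 - Real.cos (ξ * x)) / (1 + ξ) ^ 3) volume 0 R :=
      ContinuousOn.intervalIntegrable (ContinuousOn.div (by fun_prop) (by fun_prop)
        (fun ξ hξ => pow_ne_zero 3 (hne ξ hξ)))
    have key := intervalIntegral.integral_eq_sub_of_hasDerivAt (f := F)
      (f' := fun ξ => Real.cos (ξ * x) / (1 + ξ)
        - 2 / x ^ 2 * ((1 - Real.cos (ξ * x)) / (1 + ξ) ^ 3)) (a := 0) (b := R) ?_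
        (i1.sub (i2.const_mul _))
    · rw [intervalIntegral.integral_sub i1 (i2.const_mul _),
        intervalIntegral.integral_const_mul] at key
      have hF0 : F 0 = 0 := by simp [hF]
      linarith
    · intro ξ hξ
      have h0 := hne ξ hξ
      have hm : HasDerivAt (fun ξ : ℝ => ξ * x) x ξ := by
        simpa using (hasDerivAt_id ξ).mul_const x
      have hi := ((hasDerivAt_id ξ).const_add 1).inv h0
      have h1 := ((hm.sin.div_const x).mul hi).add
        (((hm.cos.const_sub 1).div_const (x ^ 2)).mul (hi.pow 2))
      refine h1.congr_deriv ?_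
      simp
      field_simp
      ring
  refine ⟨2 / x ^ 2 * I, ?_, hint, ?_⟩
  · have := hFlim.add (hlimI.const_mul (2 / x ^ 2))
    rw [zero_add] at this
    refine this.congr' ?_
    filter_upwards [eventually_ge_atTop 0] with R hR
    exact (hid R hR).symm
  · field_simp
end

section
/- For every x > 0, it holds that 0 ≤ g₁(x) ≤ 2/x², where g₁(x) := lim_{R→∞} ∫₀^R cos(ξx)/(1 + ξ) dξ. In particular there exists C > 0 such that g₁(x) ≤ C/x² for all x ≥ 1. -/
open MeasureTheory Filter Real

/-- `g₁(x) := lim_{R→∞} ∫₀^R cos(ξx)/(1+ξ) dξ`. -/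
noncomputable def g1 (x : ℝ) : ℝ :=
  limUnder atTop (fun R : ℝ => ∫ ξ in (0:ℝ)..R, Real.cos (ξ * x) / (1 + ξ))

lemma g1_aux (x : ℝ) (hx : 0 < x) :
    ∃ L : ℝ, Tendsto (fun R : ℝ => ∫ ξ in (0:ℝ)..R, Real.cos (ξ * x) / (1 + ξ)) atTop (nhds L) ∧
      0 ≤ L ∧ L ≤ 2 / x ^ 2 := by
  set f : ℝ → ℝ := fun ξ => 2 * (1 - Real.cos (ξ * x)) / (x ^ 2 * (1 + ξ) ^ 3) with hf
  set H : ℝ → ℝ := fun ξ => Real.sin (ξ * x) / (x * (1 + ξ)) +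
    (1 - Real.cos (ξ * x)) / (x ^ 2 * (1 + ξ) ^ 2) with hH
  have hfc : ∀ R : ℝ, 0 ≤ R → ContinuousOn f (Set.uIcc 0 R) := by
    intro R hR
    rw [Set.uIcc_of_le hR]
    refine ContinuousOn.div (by fun_prop) (by fun_prop) ?_
    intro t ht
    have : 0 < 1 + t := by linarith [ht.1]
    positivity
  have hcc : ∀ R : ℝ, 0 ≤ R →
      ContinuousOn (fun ξ : ℝ => Real.cos (ξ * x) / (1 + ξ)) (Set.uIcc 0 R) := by
    intro R hR
    rw [Set.uIcc_of_le hR]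
    refine ContinuousOn.div (by fun_prop) (by fun_prop) ?_
    intro t ht
    have : 0 < 1 + t := by linarith [ht.1]
    positivity
  have hfnn : ∀ t : ℝ, 0 ≤ t → 0 ≤ f t := by
    intro t ht
    have := Real.cos_le_one (t * x)
    have h2 : 0 ≤ 1 - Real.cos (t * x) := by linarith
    simp only [hf]
    positivity
  have hder : ∀ t : ℝ, 0 ≤ t → HasDerivAt H (Real.cos (t * x) / (1 + t) - f t) t := by
    intro t ht
    have h1 : (1 + t) ≠ 0 := by positivity
    have hm : HasDerivAt (fun ξ : ℝ => ξ * x) x t := by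
      simpa using (hasDerivAt_id t).mul_const x
    have ha : HasDerivAt (fun ξ : ℝ => 1 + ξ) 1 t := (hasDerivAt_id t).const_add 1
    have e1 := (hm.sin).div (ha.const_mul x) (by positivity)
    have e2 := ((hm.cos).const_sub 1).div ((ha.pow 2).const_mul (x ^ 2))
      (by simp only [Pi.pow_apply]; positivity)
    refine (e1.add e2).congr_deriv ?_
    simp only [hf, Pi.pow_apply]
    field_simp
    ring
  have hparts : ∀ R : ℝ, 0 ≤ R →
      (∫ ξ in (0:ℝ)..R, Real.cos (ξ * x) / (1 + ξ)) = H R + ∫ ξ in (0:ℝ)..R, f ξ := by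
    intro R hR
    have h := intervalIntegral.integral_eq_sub_of_hasDerivAt (a := 0) (b := R) (f := H)
      (f' := fun t => Real.cos (t * x) / (1 + t) - f t)
      (fun t ht => hder t (by rw [Set.uIcc_of_le hR] at ht; exact ht.1))
      (((hcc R hR).sub (hfc R hR)).intervalIntegrable)
    rw [intervalIntegral.integral_sub (hcc R hR).intervalIntegrable
      (hfc R hR).intervalIntegrable] at h
    have h0 : H 0 = 0 := by simp [hH]
    linarith
  have hbd : ∀ R : ℝ, 0 ≤ R → (∫ ξ in (0:ℝ)..R, f ξ) ≤ 2 / x ^ 2 := by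
    intro R hR
    have hkc : ContinuousOn (fun t : ℝ => 4 / (x ^ 2 * (1 + t) ^ 3)) (Set.uIcc 0 R) := by
      rw [Set.uIcc_of_le hR]
      refine ContinuousOn.div (by fun_prop) (by fun_prop) ?_
      intro t ht
      have : 0 < 1 + t := by linarith [ht.1]
      positivity
    have h := intervalIntegral.integral_eq_sub_of_hasDerivAt (a := 0) (b := R)
      (f := fun t => (-2) / (x ^ 2 * (1 + t) ^ 2))
      (f' := fun t => 4 / (x ^ 2 * (1 + t) ^ 3))
      (fun t ht => by
        rw [Set.uIcc_of_le hR] at ht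
        have h1 : 0 < 1 + t := by linarith [ht.1]
        have ha : HasDerivAt (fun ξ : ℝ => 1 + ξ) 1 t := (hasDerivAt_id t).const_add 1
        have e2 := (hasDerivAt_const t (-2 : ℝ)).div ((ha.pow 2).const_mul (x ^ 2))
          (by simp only [Pi.pow_apply]; positivity)
        refine e2.congr_deriv ?_
        simp only [Pi.pow_apply]
        field_simp
        ring)
      hkc.intervalIntegrable
    have hle : (∫ ξ in (0:ℝ)..R, f ξ) ≤ ∫ t in (0:ℝ)..R, 4 / (x ^ 2 * (1 + t) ^ 3) := by
      refine intervalIntegral.integral_mono_on hR (hfc R hR).intervalIntegrable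
        hkc.intervalIntegrable ?_
      intro t ht
      have h1 : 0 < 1 + t := by linarith [ht.1]
      simp only [hf]
      gcongr
      linarith [Real.neg_one_le_cos (t * x)]
    rw [h] at hle
    refine hle.trans ?_
    have : (-2) / (x ^ 2 * (1 + R) ^ 2) ≤ 0 :=
      div_nonpos_of_nonpos_of_nonneg (by norm_num) (by positivity)
    have e : (-2) / (x ^ 2 * (1 + (0:ℝ)) ^ 2) = - (2 / x ^ 2) := by
      rw [add_zero, one_pow, mul_one, neg_div]
    simp only [e]
    linarith
  have hint : IntegrableOn f (Set.Ioi 0) := by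
    refine integrableOn_Ioi_of_intervalIntegral_norm_bounded (b := fun n : ℕ => (n : ℝ))
      (l := atTop) (2 / x ^ 2) 0 ?_ tendsto_natCast_atTop_atTop ?_
    · intro n
      exact ((hfc n n.cast_nonneg).intervalIntegrable (μ := volume)).1
    · refine Eventually.of_forall fun n => ?_
      refine le_trans (le_of_eq ?_) (hbd n n.cast_nonneg)
      refine intervalIntegral.integral_congr fun t ht => ?_
      rw [Set.uIcc_of_le n.cast_nonneg] at ht
      exact Real.norm_of_nonneg (hfnn t ht.1)
  have hlim := intervalIntegral_tendsto_integral_Ioi 0 hint (tendsto_id (α := ℝ))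
  have hpos : ∀ᶠ R : ℝ in atTop, 0 ≤ R := eventually_ge_atTop 0
  have hinv : Tendsto (fun R : ℝ => (1 + R)⁻¹) atTop (nhds 0) :=
    tendsto_inv_atTop_zero.comp (tendsto_atTop_add_const_left _ 1 tendsto_id)
  have hHlim : Tendsto H atTop (nhds 0) := by
    have hb : Tendsto (fun R : ℝ => (1 / x + 2 / x ^ 2) * (1 + R)⁻¹) atTop (nhds 0) := by
      simpa using hinv.const_mul (1 / x + 2 / x ^ 2)
    refine squeeze_zero_norm' ?_ hb
    filter_upwards [hpos] with R hR
    have h1 : 1 ≤ 1 + R := by linarith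
    have h10 : 0 < 1 + R := by linarith
    refine (norm_add_le _ _).trans ?_
    rw [Real.norm_eq_abs, Real.norm_eq_abs, abs_div, abs_div,
      abs_of_pos (by positivity : 0 < x * (1 + R)),
      abs_of_pos (by positivity : 0 < x ^ 2 * (1 + R) ^ 2), add_mul]
    have b1 : |Real.sin (R * x)| / (x * (1 + R)) ≤ 1 / x * (1 + R)⁻¹ := by
      calc _ ≤ 1 / (x * (1 + R)) := by gcongr; exact Real.abs_sin_le_one _
        _ = _ := by field_simp
    have b2 : |1 - Real.cos (R * x)| / (x ^ 2 * (1 + R) ^ 2) ≤ 2 / x ^ 2 * (1 + R)⁻¹ := by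
      calc _ ≤ 2 / (x ^ 2 * (1 + R)) := by
            gcongr
            · rw [abs_le]
              constructor <;> linarith [Real.neg_one_le_cos (R * x), Real.cos_le_one (R * x)]
            · nlinarith
        _ = _ := by field_simp
    linarith
  refine ⟨∫ t in Set.Ioi 0, f t, ?_, ?_, ?_⟩
  · have := hHlim.add hlim
    rw [zero_add] at this
    refine this.congr' ?_
    filter_upwards [hpos] with R hR
    exact (hparts R hR).symm
  · exact setIntegral_nonneg measurableSet_Ioi fun t ht => hfnn t (le_of_lt ht)
  · refine le_of_tendsto hlim ?_
    filter_upwards [hpos] with R hR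
    exact hbd R hR

/-- For every `x > 0`, the improper integral defining `g₁(x)` converges and
`0 ≤ g₁(x) ≤ 2/x²`; in particular there is `C > 0` with `g₁(x) ≤ C/x²` for `x ≥ 1`. -/
theorem g1_decay_bound :
    (∀ x : ℝ, 0 < x →
      Tendsto (fun R : ℝ => ∫ ξ in (0:ℝ)..R, Real.cos (ξ * x) / (1 + ξ)) atTop (nhds (g1 x)) ∧
      0 ≤ g1 x ∧ g1 x ≤ 2 / x ^ 2) ∧
    ∃ C : ℝ, 0 < C ∧ ∀ x : ℝ, 1 ≤ x → g1 x ≤ C / x ^ 2 := by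
  have key : ∀ x : ℝ, 0 < x →
      Tendsto (fun R : ℝ => ∫ ξ in (0:ℝ)..R, Real.cos (ξ * x) / (1 + ξ)) atTop (nhds (g1 x)) ∧
      0 ≤ g1 x ∧ g1 x ≤ 2 / x ^ 2 := by
    intro x hx
    obtain ⟨L, hL, h0, h2⟩ := g1_aux x hx
    have e : g1 x = L := hL.limUnder_eq
    rw [e]
    exact ⟨hL, h0, h2⟩
  exact ⟨key, 2, by norm_num, fun x hx => (key x (by linarith)).2.2⟩
end

section
/- For every x > 0, the improper integral ∫_{π/x}^∞ cos(ξx)/(1 + ξ) dξ := lim_{R→∞} ∫_{π/x}^R cos(ξx)/(1 + ξ) dξ exists, and it satisfies |∫_{π/x}^∞ cos(ξx)/(1 + ξ) dξ| ≤ 1/π. -/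
open MeasureTheory Filter Real

/-- For every `x > 0`, the improper integral `∫_{π/x}^∞ cos(ξx)/(1+ξ) dξ` exists and is
bounded in absolute value by `1/π`. -/
theorem tail_cos_integral_bound (x : ℝ) (hx : 0 < x) :
    ∃ L : ℝ,
      Tendsto (fun R : ℝ => ∫ ξ in (π / x)..R, Real.cos (ξ * x) / (1 + ξ)) atTop (nhds L) ∧
      |L| ≤ 1 / π := by
  have hpi := Real.pi_pos
  obtain ⟨a, ha⟩ : ∃ a, a = π / x := ⟨_, rfl⟩
  have ha0 : 0 < a := ha ▸ div_pos hpi hx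
  have hax : a * x = π := by rw [ha]; field_simp
  rw [← ha]
  have hG : ∀ t ∈ Set.Ici a, HasDerivAt (fun t : ℝ => -(1 / (x * (1 + t))))
      (1 / (x * (1 + t) ^ 2)) t := by
    intro t ht
    have ht0 : 0 < 1 + t := by have := Set.mem_Ici.1 ht; linarith
    have h1 : HasDerivAt (fun t : ℝ => x * (1 + t)) x t := by
      simpa using ((hasDerivAt_id t).const_add 1).const_mul x
    have h2 := ((hasDerivAt_const t (1 : ℝ)).div h1 (by positivity)).neg
    refine h2.congr_deriv ?_
    field_simp
    ring
  have hlin : Tendsto (fun t : ℝ => x * (1 + t)) atTop atTop :=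
    (tendsto_atTop_add_const_left _ 1 tendsto_id).const_mul_atTop hx
  have hinv : Tendsto (fun t : ℝ => 1 / (x * (1 + t))) atTop (nhds 0) := by
    simpa only [one_div, Function.comp_def] using tendsto_inv_atTop_zero.comp hlin
  have hGt : Tendsto (fun t : ℝ => -(1 / (x * (1 + t)))) atTop (nhds 0) := by
    simpa using hinv.neg
  have hpos : ∀ t ∈ Set.Ioi a, 0 ≤ 1 / (x * (1 + t) ^ 2) := fun t ht => by positivity
  have hgi : IntegrableOn (fun t : ℝ => 1 / (x * (1 + t) ^ 2)) (Set.Ioi a) :=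
    integrableOn_Ioi_deriv_of_nonneg' hG hpos hGt
  have hgv := integral_Ioi_of_hasDerivAt_of_nonneg' hG hpos hGt
  have hbd : ∀ t : ℝ, ‖Real.sin (t * x) / (x * (1 + t) ^ 2)‖ ≤ 1 / (x * (1 + t) ^ 2) := by
    intro t
    rw [norm_div, Real.norm_eq_abs, Real.norm_eq_abs, abs_of_nonneg (a := x * _) (by positivity)]
    gcongr
    exact Real.abs_sin_le_one _
  have hsi : IntegrableOn (fun t : ℝ => Real.sin (t * x) / (x * (1 + t) ^ 2)) (Set.Ioi a) :=
    Integrable.mono' hgi (by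
      apply Measurable.aestronglyMeasurable
      fun_prop) (ae_of_all _ hbd)
  refine ⟨∫ t in Set.Ioi a, Real.sin (t * x) / (x * (1 + t) ^ 2), ?_, ?_⟩
  · have h1 := intervalIntegral_tendsto_integral_Ioi a hsi tendsto_id
    have h2 : Tendsto (fun t : ℝ => Real.sin (t * x) / (x * (1 + t))) atTop (nhds 0) := by
      refine squeeze_zero_norm' ?_ hinv
      filter_upwards [eventually_ge_atTop 0] with t ht
      rw [norm_div, Real.norm_eq_abs, Real.norm_eq_abs, abs_of_nonneg (a := x * _) (by positivity)]
      gcongr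
      exact Real.abs_sin_le_one _
    have h3 := h2.add h1
    rw [zero_add] at h3
    refine h3.congr' ?_
    filter_upwards [eventually_ge_atTop a] with R hR
    have hne : ∀ t ∈ Set.uIcc a R, 0 < 1 + t := by
      intro t ht
      rw [Set.uIcc_of_le hR] at ht
      linarith [ht.1]
    have hc1 : IntervalIntegrable (fun t : ℝ => Real.cos (t * x) / (1 + t)) volume a R := by
      apply ContinuousOn.intervalIntegrable
      exact ContinuousOn.div (by fun_prop) (by fun_prop) fun t ht => (hne t ht).ne'
    have hc2 : IntervalIntegrable (fun t : ℝ => Real.sin (t * x) / (x * (1 + t) ^ 2)) volume a R := by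
      apply ContinuousOn.intervalIntegrable
      exact ContinuousOn.div (by fun_prop) (by fun_prop) fun t ht => by
        have := hne t ht
        positivity
    have hF := intervalIntegral.integral_eq_sub_of_hasDerivAt
      (f := fun t : ℝ => Real.sin (t * x) / (x * (1 + t)))
      (f' := fun t => Real.cos (t * x) / (1 + t) - Real.sin (t * x) / (x * (1 + t) ^ 2))
      (a := a) (b := R) (by
        intro t ht
        have ht0 := hne t ht
        have h1 : HasDerivAt (fun t : ℝ => x * (1 + t)) x t := by
          simpa using ((hasDerivAt_id t).const_add 1).const_mul x
        have h0 : HasDerivAt (fun t : ℝ => t * x) x t := by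
          simpa using (hasDerivAt_id t).mul_const x
        refine (h0.sin.div h1 (by positivity)).congr_deriv ?_
        field_simp) (hc1.sub hc2)
    rw [intervalIntegral.integral_sub hc1 hc2, hax, Real.sin_pi, zero_div] at hF
    simp only [id]
    linarith
  · have h := norm_integral_le_of_norm_le hgi (ae_of_all _ hbd)
    rw [hgv, Real.norm_eq_abs] at h
    refine h.trans ?_
    rw [zero_sub, neg_neg]
    apply one_div_le_one_div_of_le hpi
    nlinarith
end

section
/- For every x ∈ (0, 1), it holds that |g₁(x) − log(1/x)| ≤ log(π + 1) + π²/4 + 1/π, where g₁(x) := lim_{R→∞} ∫₀^R cos(ξx)/(1 + ξ) dξ. -/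
open MeasureTheory Filter Real

lemma aux_ii (f : ℝ → ℝ) (hf : Continuous f) (n : ℕ) (a b : ℝ) (ha : 0 ≤ a) (hb : 0 ≤ b) :
    IntervalIntegrable (fun ξ => f ξ / (1 + ξ) ^ n) volume a b := by
  apply ContinuousOn.intervalIntegrable
  apply ContinuousOn.div hf.continuousOn (by fun_prop)
  intro y hy
  have : 0 ≤ y := le_trans (le_min ha hb) hy.1
  positivity

lemma aux_parts (x : ℝ) (hx0 : 0 < x) (a b : ℝ) (ha : 0 ≤ a) (hb : 0 ≤ b) :
    ∫ ξ in a..b, Real.cos (ξ * x) / (1 + ξ) =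
      sin (b * x) / (1 + b) / x - sin (a * x) / (1 + a) / x
        + (∫ ξ in a..b, sin (ξ * x) / (1 + ξ) ^ 2) / x := by
  have h1 := aux_ii (fun ξ => cos (ξ * x)) (by fun_prop) 1 a b ha hb
  simp only [pow_one] at h1
  have h2 := (aux_ii (fun ξ => sin (ξ * x)) (by fun_prop) 2 a b ha hb).div_const x
  have key : ∫ ξ in a..b, (Real.cos (ξ * x) / (1 + ξ) - sin (ξ * x) / (1 + ξ) ^ 2 / x) =
      sin (b * x) / (1 + b) / x - sin (a * x) / (1 + a) / x := by
    apply intervalIntegral.integral_eq_sub_of_hasDerivAt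
      (f := fun ξ => sin (ξ * x) / (1 + ξ) / x) _ (h1.sub h2)
    intro y hy
    have hy0 : 0 ≤ y := le_trans (le_min ha hb) hy.1
    have hy1 : 1 + y ≠ 0 := by positivity
    have e1 : HasDerivAt (fun ξ : ℝ => ξ * x) x y := by
      simpa using (hasDerivAt_id y).mul_const x
    have e2 : HasDerivAt (fun ξ : ℝ => 1 + ξ) 1 y := (hasDerivAt_id y).const_add 1
    refine HasDerivAt.congr_deriv (f := fun ξ => sin (ξ * x) / (1 + ξ) / x) ((e1.sin.div e2 hy1).div_const x) ?_
    field_simp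
  rw [intervalIntegral.integral_sub h1 h2, intervalIntegral.integral_div] at key
  linarith

lemma aux_inv (a b : ℝ) (ha : 0 ≤ a) (hb : 0 ≤ b) :
    ∫ ξ in a..b, 1 / (1 + ξ) ^ 2 = 1 / (1 + a) - 1 / (1 + b) := by
  have h2 := aux_ii (fun _ => 1) (by fun_prop) 2 a b ha hb
  rw [intervalIntegral.integral_eq_sub_of_hasDerivAt (f := fun ξ => - (1 + ξ)⁻¹) _ h2]
  · simp only [one_div]; ring
  intro y hy
  have hy0 : 0 ≤ y := le_trans (le_min ha hb) hy.1
  have hy1 : 1 + y ≠ 0 := by positivity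
  have e2 : HasDerivAt (fun ξ : ℝ => 1 + ξ) 1 y := (hasDerivAt_id y).const_add 1
  refine HasDerivAt.congr_deriv (f := fun ξ : ℝ => - (1 + ξ)⁻¹) (e2.inv hy1).neg ?_
  ring

lemma aux_log (b : ℝ) (hb : 0 ≤ b) :
    ∫ ξ in (0:ℝ)..b, 1 / (1 + ξ) = log (1 + b) := by
  have h2 := aux_ii (fun _ => 1) (by fun_prop) 1 0 b le_rfl hb
  simp only [pow_one] at h2
  rw [intervalIntegral.integral_eq_sub_of_hasDerivAt (f := fun ξ => log (1 + ξ)) _ h2]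
  · simp
  intro y hy
  have hy0 : 0 ≤ y := le_trans (le_min le_rfl hb) hy.1
  have hy1 : 1 + y ≠ 0 := by positivity
  have e2 : HasDerivAt (fun ξ : ℝ => 1 + ξ) 1 y := (hasDerivAt_id y).const_add 1
  exact e2.log hy1

lemma aux_tendsto (x : ℝ) (hx0 : 0 < x) : ∃ l : ℝ,
    Tendsto (fun R : ℝ => ∫ ξ in (0:ℝ)..R, Real.cos (ξ * x) / (1 + ξ)) atTop (nhds l) := by
  have hint : IntegrableOn (fun ξ : ℝ => sin (ξ * x) / (1 + ξ) ^ 2) (Set.Ioi 0) := by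
    refine Integrable.mono' (integrable_inv_one_add_sq.integrableOn) ?_ ?_
    · exact Measurable.aestronglyMeasurable (by fun_prop)
    · filter_upwards [ae_restrict_mem measurableSet_Ioi] with y hy
      have hy : 0 < y := hy
      rw [norm_div, norm_pow, Real.norm_eq_abs, Real.norm_eq_abs, abs_of_pos (by linarith : 0 < 1 + y),
        inv_eq_one_div]
      apply div_le_div₀ zero_le_one (abs_sin_le_one _) (by positivity)
      nlinarith
  have h1 := intervalIntegral_tendsto_integral_Ioi 0 hint tendsto_id
  have h2 : Tendsto (fun R : ℝ => sin (R * x) / (1 + R)) atTop (nhds 0) := by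
    have : Tendsto (fun R : ℝ => (1 + R)⁻¹) atTop (nhds 0) :=
      tendsto_inv_atTop_zero.comp (tendsto_atTop_add_const_left _ 1 tendsto_id)
    refine squeeze_zero_norm' ?_ this
    filter_upwards [eventually_ge_atTop 0] with R hR
    rw [norm_div, Real.norm_eq_abs, Real.norm_eq_abs, abs_of_pos (by linarith : 0 < 1 + R),
      inv_eq_one_div]
    have := abs_sin_le_one (R * x)
    gcongr
  refine ⟨_, ((h2.div_const x).add (h1.div_const x)).congr' ?_⟩
  filter_upwards [eventually_ge_atTop 0] with R hR
  rw [aux_parts x hx0 0 R le_rfl hR]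
  simp

lemma aux_tail (x : ℝ) (hx0 : 0 < x) (a b : ℝ) (ha : 0 ≤ a) (hb : a ≤ b) :
    |∫ ξ in a..b, Real.cos (ξ * x) / (1 + ξ)| ≤ 2 / (1 + a) / x := by
  have hb0 := ha.trans hb
  rw [aux_parts x hx0 a b ha hb0]
  have h3 : |∫ ξ in a..b, sin (ξ * x) / (1 + ξ) ^ 2| ≤ 1 / (1 + a) - 1 / (1 + b) := by
    rw [← aux_inv a b ha hb0, ← Real.norm_eq_abs]
    apply intervalIntegral.norm_integral_le_of_norm_le hb _
      (aux_ii (fun _ => 1) (by fun_prop) 2 a b ha hb0)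
    filter_upwards with y hy
    have hy : 0 < 1 + y := by linarith [hy.1]
    rw [norm_div, norm_pow, Real.norm_eq_abs, Real.norm_eq_abs, abs_of_pos hy]
    have := abs_sin_le_one (y * x)
    gcongr
  have hs : ∀ c : ℝ, 0 ≤ c → |sin (c * x) / (1 + c)| ≤ 1 / (1 + c) := by
    intro c hc
    rw [abs_div, abs_of_pos (by linarith : 0 < 1 + c)]
    have := abs_sin_le_one (c * x)
    gcongr
  have hA := abs_le.1 (hs a ha)
  have hB := abs_le.1 (hs b hb0)
  have h3 := abs_le.1 h3
  rw [← sub_div, ← add_div, abs_div, abs_of_pos hx0]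
  gcongr
  have : 2 / (1 + a) = 2 * (1 / (1 + a)) := by ring
  rw [this, abs_le]
  constructor <;> linarith [hA.1, hA.2, hB.1, hB.2, h3.1, h3.2]

lemma aux_head (x : ℝ) (hx0 : 0 < x) (a : ℝ) (ha : 0 ≤ a) :
    |(∫ ξ in (0:ℝ)..a, Real.cos (ξ * x) / (1 + ξ)) - log (1 + a)| ≤ (a * x) ^ 2 / 4 := by
  have h1 := aux_ii (fun ξ => cos (ξ * x)) (by fun_prop) 1 0 a le_rfl ha
  have h2 := aux_ii (fun _ => 1) (by fun_prop) 1 0 a le_rfl ha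
  simp only [pow_one] at h1 h2
  rw [← aux_log a ha, ← intervalIntegral.integral_sub h1 h2, ← Real.norm_eq_abs]
  have h4 : ∫ ξ in (0:ℝ)..a, x ^ 2 / 2 * ξ = (a * x) ^ 2 / 4 := by
    rw [intervalIntegral.integral_const_mul, integral_id]; ring
  rw [← h4]
  apply intervalIntegral.norm_integral_le_of_norm_le ha _
    (Continuous.intervalIntegrable (by fun_prop) _ _)
  filter_upwards with y hy
  have hy0 : 0 < y := hy.1
  have hy1 : 0 < 1 + y := by linarith
  rw [← sub_div, norm_div, Real.norm_eq_abs, Real.norm_eq_abs, abs_of_pos hy1, div_le_iff₀ hy1,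
    abs_sub_comm, abs_of_nonneg (by linarith [cos_le_one (y * x)])]
  have := one_sub_sq_div_two_le_cos (x := y * x)
  nlinarith [mul_pos (pow_pos hx0 2) hy0]

/-- For `x ∈ (0,1)`, `|g₁(x) − log(1/x)| ≤ log(π+1) + π²/4 + 1/π`. -/
theorem g1_log_asymptotic_bound (x : ℝ) (hx0 : 0 < x) (hx1 : x < 1) :
    |g1 x - Real.log (1 / x)| ≤ Real.log (π + 1) + π ^ 2 / 4 + 1 / π := by
  obtain ⟨l, hl⟩ := aux_tendsto x hx0
  have hg : g1 x = l := hl.limUnder_eq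
  rw [hg]
  refine le_of_tendsto ((hl.sub_const _).abs) ?_
  have hA : 0 < 1 / x := by positivity
  filter_upwards [eventually_ge_atTop (1 / x)] with R hR
  have hi := fun a b ha hb => aux_ii (fun ξ => cos (ξ * x)) (by fun_prop) 1 a b ha hb
  simp only [pow_one] at hi
  rw [← intervalIntegral.integral_add_adjacent_intervals (hi 0 (1 / x) le_rfl hA.le)
    (hi (1 / x) R hA.le (hA.le.trans hR))]
  have t := aux_tail x hx0 (1 / x) R hA.le hR
  have h := aux_head x hx0 (1 / x) hA.le
  have e1 : 2 / (1 + 1 / x) / x ≤ 2 := by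
    rw [div_div, div_le_iff₀ (by positivity)]
    have : (1 + 1 / x) * x = x + 1 := by field_simp
    linarith
  have e2 : (1 / x * x) ^ 2 / 4 = 1 / 4 := by field_simp
  have e3 : log (1 + 1 / x) = log (1 / x) + log (1 + x) := by
    rw [← log_mul (by positivity) (by positivity)]
    congr 1; field_simp
    try ring
  have e4 : 0 ≤ log (1 + x) := log_nonneg (by linarith)
  have e5 : log (1 + x) ≤ log (π + 1) := log_le_log (by positivity) (by linarith [pi_gt_three])
  have e6 : 9 / 4 ≤ π ^ 2 / 4 := by nlinarith [pi_gt_three]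
  have e7 : 0 < 1 / π := by positivity
  rw [e2, e3] at h
  have t := abs_le.1 (t.trans e1)
  have h := abs_le.1 h
  rw [abs_le]
  constructor <;> linarith [t.1, t.2, h.1, h.2]
end

section
/- The quotient g₁(x)/log(1/x) converges to 1 as x → 0⁺, where g₁(x) := lim_{R→∞} ∫₀^R cos(ξx)/(1 + ξ) dξ. -/
open MeasureTheory Filter Real

theorem g1_tail (x : ℝ) (hx : 0 < x) (a b : ℝ) (ha : 0 ≤ a) (hab : a ≤ b) :
    |∫ ξ in a..b, Real.cos (ξ * x) / (1 + ξ)| ≤ 2 / (x * (1 + a)) := by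
  have hpos : ∀ ξ ∈ Set.uIcc a b, 0 < 1 + ξ := by
    intro ξ hξ
    rw [Set.uIcc_of_le hab] at hξ
    linarith [hξ.1]
  have hne : ∀ ξ ∈ Set.uIcc a b, 1 + ξ ≠ 0 := fun ξ hξ => (hpos ξ hξ).ne'
  have hi1 : IntervalIntegrable (fun ξ => Real.cos (ξ * x) / (1 + ξ)) volume a b := by
    apply ContinuousOn.intervalIntegrable
    exact ContinuousOn.div (by fun_prop) (by fun_prop) hne
  have hi2 : IntervalIntegrable (fun ξ => Real.sin (ξ * x) / (x * (1 + ξ) ^ 2)) volume a b := by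
    apply ContinuousOn.intervalIntegrable
    exact ContinuousOn.div (by fun_prop) (by fun_prop)
      (fun ξ hξ => mul_ne_zero hx.ne' (pow_ne_zero _ (hne ξ hξ)))
  have hi3 : IntervalIntegrable (fun ξ => 1 / (x * (1 + ξ) ^ 2)) volume a b := by
    apply ContinuousOn.intervalIntegrable
    exact ContinuousOn.div (by fun_prop) (by fun_prop)
      (fun ξ hξ => mul_ne_zero hx.ne' (pow_ne_zero _ (hne ξ hξ)))
  have e1 : ∫ ξ in a..b, (Real.cos (ξ * x) / (1 + ξ) - Real.sin (ξ * x) / (x * (1 + ξ) ^ 2))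
      = Real.sin (b * x) / (x * (1 + b)) - Real.sin (a * x) / (x * (1 + a)) := by
    apply intervalIntegral.integral_eq_sub_of_hasDerivAt
      (f := fun ξ => Real.sin (ξ * x) / (x * (1 + ξ))) _ (hi1.sub hi2)
    intro ξ hξ
    have h0 := hne ξ hξ
    have h1 : HasDerivAt (fun ξ => Real.sin (ξ * x)) (Real.cos (ξ * x) * (1 * x)) ξ :=
      ((hasDerivAt_id ξ).mul_const x).sin
    have h2 : HasDerivAt (fun ξ : ℝ => x * (1 + ξ)) (x * 1) ξ :=
      ((hasDerivAt_id ξ).const_add 1).const_mul x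
    refine (h1.fun_div h2 (mul_ne_zero hx.ne' h0)).congr_deriv ?_
    field_simp
  have e2 : ∫ ξ in a..b, 1 / (x * (1 + ξ) ^ 2)
      = (-1) / (x * (1 + b)) - (-1) / (x * (1 + a)) := by
    apply intervalIntegral.integral_eq_sub_of_hasDerivAt
      (f := fun ξ => (-1) / (x * (1 + ξ))) _ hi3
    intro ξ hξ
    have h0 := hne ξ hξ
    have h2 : HasDerivAt (fun ξ : ℝ => x * (1 + ξ)) (x * 1) ξ :=
      ((hasDerivAt_id ξ).const_add 1).const_mul x
    refine ((hasDerivAt_const ξ (-1 : ℝ)).fun_div h2 (mul_ne_zero hx.ne' h0)).congr_deriv ?_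
    field_simp
    ring
  have e3 : |∫ ξ in a..b, Real.sin (ξ * x) / (x * (1 + ξ) ^ 2)|
      ≤ ∫ ξ in a..b, 1 / (x * (1 + ξ) ^ 2) := by
    rw [← Real.norm_eq_abs]
    apply intervalIntegral.norm_integral_le_of_norm_le hab _ hi3
    refine Eventually.of_forall fun ξ hξ => ?_
    have : 0 < 1 + ξ := by linarith [hξ.1]
    rw [Real.norm_eq_abs, abs_div, abs_of_pos (by positivity : 0 < x * (1 + ξ) ^ 2)]
    gcongr
    exact Real.abs_sin_le_one _
  rw [intervalIntegral.integral_sub hi1 hi2] at e1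
  rw [e2] at e3
  have pa : 0 < x * (1 + a) := by positivity
  have pb : 0 < x * (1 + b) := mul_pos hx (by linarith)
  have sa : |Real.sin (a * x) / (x * (1 + a))| ≤ 1 / (x * (1 + a)) := by
    rw [abs_div, abs_of_pos pa]
    gcongr
    exact Real.abs_sin_le_one _
  have sb : |Real.sin (b * x) / (x * (1 + b))| ≤ 1 / (x * (1 + b)) := by
    rw [abs_div, abs_of_pos pb]
    gcongr
    exact Real.abs_sin_le_one _
  rw [neg_div, neg_div] at e3
  have h2 : 2 / (x * (1 + a)) = 1 / (x * (1 + a)) + 1 / (x * (1 + a)) := by ring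
  rw [h2]
  rw [abs_le] at *
  constructor <;> linarith [e3.1, e3.2, sa.1, sa.2, sb.1, sb.2]

theorem g1_head (x : ℝ) (hx : 0 < x) :
    |(∫ ξ in (0:ℝ)..(1 / x), Real.cos (ξ * x) / (1 + ξ)) - Real.log (1 + 1 / x)| ≤ 1 := by
  have hA : (0:ℝ) ≤ 1 / x := by positivity
  have hne : ∀ ξ ∈ Set.uIcc 0 (1 / x), 1 + ξ ≠ 0 := by
    intro ξ hξ
    rw [Set.uIcc_of_le hA] at hξ
    linarith [hξ.1]
  have hi1 : IntervalIntegrable (fun ξ => Real.cos (ξ * x) / (1 + ξ)) volume 0 (1 / x) := by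
    apply ContinuousOn.intervalIntegrable
    exact ContinuousOn.div (by fun_prop) (by fun_prop) hne
  have hi2 : IntervalIntegrable (fun ξ : ℝ => 1 / (1 + ξ)) volume 0 (1 / x) := by
    apply ContinuousOn.intervalIntegrable
    exact ContinuousOn.div (by fun_prop) (by fun_prop) hne
  have e : ∫ ξ in (0:ℝ)..(1 / x), 1 / (1 + ξ) = Real.log (1 + 1 / x) - Real.log (1 + 0) := by
    apply intervalIntegral.integral_eq_sub_of_hasDerivAt
      (f := fun ξ => Real.log (1 + ξ)) _ hi2
    intro ξ hξ
    exact ((hasDerivAt_id ξ).const_add 1).log (hne ξ hξ)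
  rw [add_zero, Real.log_one, sub_zero] at e
  rw [← e, ← intervalIntegral.integral_sub hi1 hi2, ← Real.norm_eq_abs]
  have := intervalIntegral.norm_integral_le_of_norm_le_const (a := 0) (b := 1 / x) (C := x)
    (f := fun ξ => Real.cos (ξ * x) / (1 + ξ) - 1 / (1 + ξ)) ?_
  · refine this.trans (le_of_eq ?_)
    rw [sub_zero, abs_of_nonneg hA]
    field_simp
  · intro ξ hξ
    rw [Set.uIoc_of_le hA] at hξ
    have h0 : 0 < ξ := hξ.1
    have h1 : ξ * x ≤ 1 := by
      have := hξ.2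
      rwa [le_div_iff₀ hx] at this
    have h2 := Real.one_sub_sq_div_two_le_cos (x := ξ * x)
    have h3 := Real.cos_le_one (ξ * x)
    have h4 : 0 < ξ * x := by positivity
    rw [← sub_div, Real.norm_eq_abs, abs_div, abs_of_pos (by linarith : 0 < 1 + ξ),
      div_le_iff₀ (by linarith), abs_of_nonpos (by linarith)]
    nlinarith

theorem g1_bound (x : ℝ) (hx : 0 < x) : |g1 x - Real.log (1 + 1 / x)| ≤ 3 := by
  have hii : ∀ a b : ℝ, 0 ≤ a → 0 ≤ b →
      IntervalIntegrable (fun ξ => Real.cos (ξ * x) / (1 + ξ)) volume a b := by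
    intro a b ha hb
    apply ContinuousOn.intervalIntegrable
    refine ContinuousOn.div (by fun_prop) (by fun_prop) ?_
    intro ξ hξ
    have : 0 ≤ ξ := (le_min ha hb).trans hξ.1
    linarith
  have hsplit : ∀ a b : ℝ, 0 ≤ a → 0 ≤ b →
      (∫ ξ in (0:ℝ)..b, Real.cos (ξ * x) / (1 + ξ)) - (∫ ξ in (0:ℝ)..a, Real.cos (ξ * x) / (1 + ξ))
      = ∫ ξ in a..b, Real.cos (ξ * x) / (1 + ξ) := fun a b ha hb =>
    intervalIntegral.integral_interval_sub_left (hii 0 b le_rfl hb) (hii 0 a le_rfl ha)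
  have hc : CauchySeq (fun R : ℝ => ∫ ξ in (0:ℝ)..R, Real.cos (ξ * x) / (1 + ξ)) := by
    rw [Metric.cauchySeq_iff']
    intro ε hε
    refine ⟨2 / (x * ε), fun n hn => ?_⟩
    have hN : 0 < 2 / (x * ε) := by positivity
    rw [Real.dist_eq, hsplit _ _ hN.le (hN.le.trans hn)]
    refine (g1_tail x hx _ _ hN.le hn).trans_lt ?_
    rw [div_lt_iff₀ (by positivity)]
    have : ε * (x * (1 + 2 / (x * ε))) = ε * x + 2 := by field_simp
    rw [this]
    have : 0 < ε * x := by positivity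
    linarith
  have ht : Tendsto (fun R : ℝ => ∫ ξ in (0:ℝ)..R, Real.cos (ξ * x) / (1 + ξ)) atTop
      (nhds (g1 x)) := tendsto_nhds_limUnder (cauchySeq_tendsto_of_complete hc)
  have hA : (0:ℝ) < 1 / x := by positivity
  refine le_of_tendsto ((ht.sub_const _).abs) ?_
  filter_upwards [eventually_ge_atTop (1 / x)] with R hR
  have h1 := g1_tail x hx _ _ hA.le hR
  rw [← hsplit _ _ hA.le (hA.le.trans hR)] at h1
  have h2 := g1_head x hx
  have h3 : 2 / (x * (1 + 1 / x)) ≤ 2 := by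
    rw [div_le_iff₀ (by positivity)]
    have : x * (1 + 1 / x) = x + 1 := by field_simp
    rw [this]
    linarith
  rw [abs_le] at *
  constructor <;> linarith [h1.1, h1.2, h2.1, h2.2]

/-- `g₁(x)/log(1/x) → 1` as `x → 0⁺`. -/
theorem g1_log_asymptotic :
    Tendsto (fun x : ℝ => g1 x / Real.log (1 / x)) (nhdsWithin 0 (Set.Ioi 0)) (nhds 1) := by
  have hL : Tendsto (fun x : ℝ => Real.log (1 / x)) (nhdsWithin 0 (Set.Ioi 0)) atTop := by
    simp only [one_div]
    exact Real.tendsto_log_atTop.comp tendsto_inv_nhdsGT_zero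
  have h0 : Tendsto (fun x : ℝ => 4 / Real.log (1 / x)) (nhdsWithin 0 (Set.Ioi 0)) (nhds 0) :=
    hL.const_div_atTop 4
  rw [tendsto_iff_dist_tendsto_zero]
  refine squeeze_zero' (Eventually.of_forall fun _ => dist_nonneg) ?_ h0
  filter_upwards [hL.eventually_gt_atTop 0, self_mem_nhdsWithin,
    mem_nhdsWithin_of_mem_nhds (Iio_mem_nhds (zero_lt_one' ℝ))] with x hl hx hx1
  have hx : 0 < x := hx
  have hx1 : x < 1 := hx1
  have hb := g1_bound x hx
  have e : Real.log (1 + 1 / x) = Real.log (1 + x) + Real.log (1 / x) := by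
    rw [← Real.log_mul (by positivity) (by positivity)]
    congr 1
    field_simp
    ring
  have u1 := Real.log_le_sub_one_of_pos (by linarith : 0 < 1 + x)
  have u2 := Real.log_nonneg (by linarith : 1 ≤ 1 + x)
  rw [Real.dist_eq, div_sub_one hl.ne', abs_div, abs_of_pos hl]
  gcongr
  rw [abs_le] at *
  constructor <;> linarith [hb.1, hb.2]
end

section
/- The function g₁ defined for x > 0 by the improper integral g₁(x) := lim_{R→∞} ∫₀^R cos(ξx)/(1 + ξ) dξ is (Lebesgue) integrable on (0, ∞); equivalently, the even extension of g₁ to ℝ (which is, up to a constant factor, the inverse Fourier transform of ξ ↦ 1/(1 + |ξ|)) belongs to L¹(ℝ). -/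
open MeasureTheory Filter Real

noncomputable def gG (x : ℝ) : ℝ := ∫ ξ in Set.Ioi (0:ℝ), Real.sin (ξ * x) / (1 + ξ) ^ 2

lemma phi_int : IntegrableOn (fun ξ : ℝ => (ξ + 1) ^ (-(3/2) : ℝ)) (Set.Ioi 0) :=
  integrableOn_add_rpow_Ioi_of_lt (by norm_num) (by norm_num)

lemma pow_two_le {ξ : ℝ} (h : 0 < ξ) : 1 / (1 + ξ) ^ 2 ≤ (ξ + 1) ^ (-(3/2) : ℝ) := by
  have : 1 / (1 + ξ) ^ 2 = (ξ + 1) ^ (-2 : ℝ) := by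
    rw [Real.rpow_neg (by linarith), add_comm]; norm_num
  rw [this]
  exact Real.rpow_le_rpow_of_exponent_le (by linarith) (by norm_num)

lemma pow_three_le {ξ : ℝ} (h : 0 < ξ) : 1 / (1 + ξ) ^ 3 ≤ (ξ + 1) ^ (-(3/2) : ℝ) := by
  refine le_trans ?_ (pow_two_le h)
  exact one_div_le_one_div_of_le (by positivity) (pow_le_pow_right₀ (by linarith) (by norm_num))

lemma sqrt_le {ξ : ℝ} (h : 0 < ξ) : √ξ / (1 + ξ) ^ 2 ≤ (ξ + 1) ^ (-(3/2) : ℝ) := by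
  have h1 : (ξ + 1) ^ (-(3/2) : ℝ) = √(1 + ξ) / (1 + ξ) ^ 2 := by
    rw [Real.sqrt_eq_rpow, add_comm 1 ξ, ← Real.rpow_natCast, ← Real.rpow_sub (by linarith)]
    norm_num
  rw [h1]
  gcongr
  linarith

lemma sin_int (x : ℝ) :
    IntegrableOn (fun ξ : ℝ => Real.sin (ξ * x) / (1 + ξ) ^ 2) (Set.Ioi 0) := by
  refine phi_int.mono' (Measurable.aestronglyMeasurable (by fun_prop)) ?_
  filter_upwards [ae_restrict_mem measurableSet_Ioi] with ξ hξ
  have hξ : 0 < ξ := hξ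
  refine le_trans ?_ (pow_two_le hξ)
  rw [norm_div, Real.norm_eq_abs, Real.norm_eq_abs, abs_of_pos (by positivity : 0 < (1 + ξ) ^ 2)]
  gcongr
  exact Real.abs_sin_le_one _

lemma cos_int (x : ℝ) :
    IntegrableOn (fun ξ : ℝ => Real.cos (ξ * x) / (1 + ξ) ^ 3) (Set.Ioi 0) := by
  refine phi_int.mono' (Measurable.aestronglyMeasurable (by fun_prop)) ?_
  filter_upwards [ae_restrict_mem measurableSet_Ioi] with ξ hξ
  have hξ : 0 < ξ := hξ
  refine le_trans ?_ (pow_three_le hξ)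
  rw [norm_div, Real.norm_eq_abs, Real.norm_eq_abs, abs_of_pos (by positivity : 0 < (1 + ξ) ^ 3)]
  gcongr
  exact Real.abs_cos_le_one _

lemma abs_sin_le_sqrt {t : ℝ} (h : 0 ≤ t) : |Real.sin t| ≤ √t := by
  rcases le_total t 1 with h1 | h1
  · have h2 : |Real.sin t| ≤ t := by
      simpa [abs_of_nonneg h] using Real.abs_sin_le_abs (x := t)
    refine h2.trans (Real.le_sqrt_of_sq_le (by nlinarith))
  · exact (Real.abs_sin_le_one _).trans (Real.one_le_sqrt.2 h1)

lemma gG_small {x : ℝ} (hx : 0 < x) :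
    |gG x| ≤ √x * ∫ ξ in Set.Ioi (0:ℝ), (ξ + 1) ^ (-(3/2) : ℝ) := by
  rw [← integral_const_mul, ← Real.norm_eq_abs]
  refine norm_integral_le_of_norm_le (phi_int.const_mul _) ?_
  filter_upwards [ae_restrict_mem measurableSet_Ioi] with ξ hξ
  have hξ : 0 < ξ := hξ
  rw [norm_div, Real.norm_eq_abs, Real.norm_eq_abs, abs_of_pos (by positivity : 0 < (1 + ξ) ^ 2)]
  calc _ ≤ √(ξ * x) / (1 + ξ) ^ 2 := by gcongr; exact abs_sin_le_sqrt (by positivity)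
    _ = √x * (√ξ / (1 + ξ) ^ 2) := by rw [Real.sqrt_mul hξ.le]; ring
    _ ≤ _ := by gcongr; exact sqrt_le hξ

lemma cos_bd (x : ℝ) : |∫ ξ in Set.Ioi (0:ℝ), Real.cos (ξ * x) / (1 + ξ) ^ 3| ≤
    ∫ ξ in Set.Ioi (0:ℝ), (ξ + 1) ^ (-(3/2) : ℝ) := by
  rw [← Real.norm_eq_abs]
  refine norm_integral_le_of_norm_le phi_int ?_
  filter_upwards [ae_restrict_mem measurableSet_Ioi] with ξ hξ
  have hξ : 0 < ξ := hξ
  refine le_trans ?_ (pow_three_le hξ)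
  rw [norm_div, Real.norm_eq_abs, Real.norm_eq_abs, abs_of_pos (by positivity : 0 < (1 + ξ) ^ 3)]
  gcongr
  exact Real.abs_cos_le_one _

lemma inv_tendsto : Tendsto (fun ξ : ℝ => 1 / (1 + ξ)) atTop (nhds 0) := by
  simp only [one_div]
  exact tendsto_inv_atTop_zero.comp (tendsto_atTop_add_const_left _ _ tendsto_id)

lemma gG_eq {x : ℝ} (hx : 0 < x) :
    gG x = 1 / x - 2 / x * ∫ ξ in Set.Ioi (0:ℝ), Real.cos (ξ * x) / (1 + ξ) ^ 3 := by
  have key : ∫ ξ in Set.Ioi (0:ℝ), (Real.sin (ξ * x) / (1 + ξ) ^ 2 +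
      2 / x * (Real.cos (ξ * x) / (1 + ξ) ^ 3)) =
      0 - (fun ξ : ℝ => - Real.cos (ξ * x) / (x * (1 + ξ) ^ 2)) 0 := by
    have hi : IntegrableOn (fun ξ : ℝ => Real.sin (ξ * x) / (1 + ξ) ^ 2 +
      2 / x * (Real.cos (ξ * x) / (1 + ξ) ^ 3)) (Set.Ioi 0) :=
      (sin_int x).add ((cos_int x).const_mul _)
    refine integral_Ioi_of_hasDerivAt_of_tendsto'
      (f := fun ξ : ℝ => - Real.cos (ξ * x) / (x * (1 + ξ) ^ 2)) ?_ hi ?_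
    · intro ξ hξ
      have hξ : 0 ≤ ξ := hξ
      have hp : 0 < 1 + ξ := by linarith
      have h1 : HasDerivAt (fun ξ : ℝ => - Real.cos (ξ * x)) (Real.sin (ξ * x) * x) ξ := by
        have h := ((hasDerivAt_id ξ).mul_const x).cos.neg
        convert! h using 1
        simp
      have h2 : HasDerivAt (fun ξ : ℝ => x * (1 + ξ) ^ 2) (x * (2 * (1 + ξ))) ξ := by
        simpa using (((hasDerivAt_id ξ).const_add 1).pow 2).const_mul x
      convert! h1.div h2 (by positivity) using 1
      field_simp
      ring
    · refine squeeze_zero_norm' (a := fun ξ : ℝ => 1 / x * (1 / (1 + ξ))) ?_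
        (by simpa using inv_tendsto.const_mul (1 / x))
      filter_upwards [eventually_gt_atTop 0] with ξ hξ
      rw [norm_div, norm_neg, Real.norm_eq_abs, Real.norm_eq_abs,
        abs_of_pos (by positivity : 0 < x * (1 + ξ) ^ 2),
        one_div_mul_one_div]
      gcongr
      · exact Real.abs_cos_le_one _
      · nlinarith
  rw [integral_add (sin_int x) ((cos_int x).const_mul _), integral_const_mul] at key
  simp at key
  unfold gG
  have e : -(-1 / x) = 1 / x := by ring
  rw [e] at key
  linarith

lemma g1_eq {x : ℝ} (hx : 0 < x) : g1 x = 1 / x * gG x := by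
  apply Tendsto.limUnder_eq
  have h1 : Tendsto (fun R : ℝ => Real.sin (R * x) / (x * (1 + R)) +
      1 / x * ∫ ξ in (0:ℝ)..R, Real.sin (ξ * x) / (1 + ξ) ^ 2) atTop (nhds (0 + 1 / x * gG x)) := by
    refine Tendsto.add ?_ ((intervalIntegral_tendsto_integral_Ioi 0 (sin_int x)
      tendsto_id).const_mul _)
    refine squeeze_zero_norm' (a := fun ξ : ℝ => 1 / x * (1 / (1 + ξ))) ?_
        (by simpa using inv_tendsto.const_mul (1 / x))
    filter_upwards [eventually_gt_atTop 0] with ξ hξ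
    rw [norm_div, Real.norm_eq_abs, Real.norm_eq_abs,
        abs_of_pos (by positivity : 0 < x * (1 + ξ)), one_div_mul_one_div]
    gcongr
    exact Real.abs_sin_le_one _
  rw [zero_add] at h1
  refine h1.congr' ?_
  filter_upwards [eventually_gt_atTop 0] with R hR
  have hne : ∀ ξ ∈ Set.uIcc 0 R, 1 + ξ ≠ 0 := by
    intro ξ hξ
    rw [Set.uIcc_of_le hR.le] at hξ
    linarith [hξ.1]
  have hc : IntervalIntegrable (fun ξ : ℝ => Real.cos (ξ * x) / (1 + ξ)) volume 0 R :=
    ContinuousOn.intervalIntegrable (ContinuousOn.div (by fun_prop) (by fun_prop) hne)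
  have hs : IntervalIntegrable (fun ξ : ℝ => Real.sin (ξ * x) / (1 + ξ) ^ 2) volume 0 R :=
    ContinuousOn.intervalIntegrable (ContinuousOn.div (by fun_prop) (by fun_prop)
      (fun ξ hξ => pow_ne_zero _ (hne ξ hξ)))
  have key := intervalIntegral.integral_eq_sub_of_hasDerivAt (a := 0) (b := R)
    (f := fun ξ : ℝ => Real.sin (ξ * x) / (x * (1 + ξ)))
    (f' := fun ξ : ℝ => Real.cos (ξ * x) / (1 + ξ) - 1 / x * (Real.sin (ξ * x) / (1 + ξ) ^ 2))
    (by
      intro ξ hξ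
      have hp := hne ξ hξ
      have h1 : HasDerivAt (fun ξ : ℝ => Real.sin (ξ * x)) (Real.cos (ξ * x) * x) ξ := by
        simpa using ((hasDerivAt_id ξ).mul_const x).sin
      have h2 : HasDerivAt (fun ξ : ℝ => x * (1 + ξ)) x ξ := by
        simpa using ((hasDerivAt_id ξ).const_add 1).const_mul x
      convert! h1.div h2 (mul_ne_zero hx.ne' hp) using 1
      field_simp) (hc.sub (hs.const_mul _))
  rw [intervalIntegral.integral_sub hc (hs.const_mul _),
    intervalIntegral.integral_const_mul] at key
  simp only [zero_mul, Real.sin_zero, zero_div, sub_zero] at key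
  linarith

lemma gG_meas : StronglyMeasurable gG := by
  unfold gG
  exact StronglyMeasurable.integral_prod_right
    (f := fun x ξ : ℝ => Real.sin (ξ * x) / (1 + ξ) ^ 2)
    (Measurable.stronglyMeasurable (by unfold Function.uncurry; fun_prop))

lemma g1_on : IntegrableOn g1 (Set.Ioi 0) := by
  have heq : Set.EqOn (fun x => 1 / x * gG x) g1 (Set.Ioi 0) := fun x hx => (g1_eq hx).symm
  refine IntegrableOn.congr_fun ?_ heq measurableSet_Ioi
  have hm : Measurable (fun x => 1 / x * gG x) :=
    (measurable_const.div measurable_id).mul gG_meas.measurable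
  set C := ∫ ξ in Set.Ioi (0:ℝ), (ξ + 1) ^ (-(3/2) : ℝ) with hC
  rw [← Set.Ioc_union_Ioi_eq_Ioi (zero_le_one : (0:ℝ) ≤ 1)]
  refine IntegrableOn.union ?_ ?_
  · have h : IntegrableOn (fun x : ℝ => C * x ^ (-(1/2) : ℝ)) (Set.Ioc 0 1) :=
      (((intervalIntegrable_iff_integrableOn_Ioc_of_le zero_le_one).1
        (intervalIntegral.intervalIntegrable_rpow' (by norm_num))).const_mul _)
    refine h.mono' hm.aestronglyMeasurable ?_
    filter_upwards [ae_restrict_mem measurableSet_Ioc] with x hx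
    have hx : 0 < x := hx.1
    rw [norm_mul, Real.norm_eq_abs, Real.norm_eq_abs, abs_of_pos (by positivity : 0 < 1 / x)]
    have e : x ^ (-(1/2) : ℝ) = 1 / x * √x := by
      rw [Real.sqrt_eq_rpow, one_div x, ← Real.rpow_neg_one x, ← Real.rpow_add hx]
      norm_num
    calc _ ≤ 1 / x * (√x * C) := by gcongr; exact gG_small hx
      _ = _ := by rw [e]; ring
  · have h : IntegrableOn (fun x : ℝ => (1 + 2 * C) * x ^ (-2 : ℝ)) (Set.Ioi 1) :=
      (integrableOn_Ioi_rpow_of_lt (by norm_num) one_pos).const_mul _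
    refine h.mono' hm.aestronglyMeasurable ?_
    filter_upwards [ae_restrict_mem measurableSet_Ioi] with x hx
    have hx : 0 < x := zero_lt_one.trans hx
    rw [norm_mul, Real.norm_eq_abs, Real.norm_eq_abs, abs_of_pos (by positivity : 0 < 1 / x)]
    have e : x ^ (-2 : ℝ) = 1 / x * (1 / x) := by
      rw [Real.rpow_neg hx.le]
      norm_num
      ring
    have b : |gG x| ≤ 1 / x + 2 / x * C := by
      rw [gG_eq hx]
      refine (abs_sub _ _).trans ?_
      rw [abs_mul, abs_of_pos (by positivity : 0 < 1 / x), abs_of_pos (by positivity : 0 < 2 / x)]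
      gcongr
      exact cos_bd x
    calc _ ≤ 1 / x * (1 / x + 2 / x * C) := by gcongr
      _ = _ := by rw [e]; ring

/-- `g₁` is Lebesgue integrable on `(0,∞)`; equivalently, its even extension
`x ↦ g₁(|x|)` belongs to `L¹(ℝ)`. -/
theorem g1_integrable :
    IntegrableOn g1 (Set.Ioi 0) ∧ Integrable (fun x : ℝ => g1 |x|) := by
  refine ⟨g1_on, ?_⟩
  have h := (integrable_indicator_iff measurableSet_Ioi).2 g1_on
  refine (h.add h.comp_neg).congr ?_
  have h0 : ∀ᵐ x : ℝ, x ≠ 0 := by simp [ae_iff]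
  filter_upwards [h0] with x hx
  rcases lt_or_gt_of_ne hx with hx | hx
  · simp [Set.indicator, hx, not_lt.2 hx.le, abs_of_neg hx]
  · simp [Set.indicator, hx, not_lt.2 hx.le, abs_of_pos hx]
end

section
/- Let 1 < σ < 2 and let k, m be positive integers with 1 ≤ m ≤ k. Define K(x) := ∫₀^∞ ξ^{σm}/(1 + ξ^σ)^{1+k} cos(xξ) dξ for x ≥ 0 (the integral converges absolutely since σ(k + 1 − m) > 1). Then: (i) K is bounded on [0, ∞); (ii) there exists a constant C > 0 such that |K(x)| ≤ C x^{−(1+σ)} for all x ≥ 1; (iii) K is (Lebesgue) integrable on (0, ∞). -/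
open MeasureTheory Filter Real

inductive KSpan (σ : ℝ) : (ℝ → ℝ) → Prop
  | base (a b : ℕ) (ha : 1 ≤ a) (hab : a + 1 ≤ b) :
      KSpan σ (fun ξ => (ξ ^ σ) ^ a / (1 + ξ ^ σ) ^ b)
  | comb (c d : ℝ) (f g : ℝ → ℝ) (hf : KSpan σ f) (hg : KSpan σ g) :
      KSpan σ (fun ξ => c * f ξ + d * g ξ)

theorem KSpan.deriv {σ : ℝ} {f : ℝ → ℝ} (hf : KSpan σ f) :
    ∃ g, KSpan σ g ∧ ∀ ξ : ℝ, 0 < ξ → HasDerivAt f (g ξ / ξ) ξ := by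
  induction hf with
  | base a b ha hab =>
    refine ⟨_, KSpan.comb (σ * a) (-(σ * b)) _ _ (KSpan.base a b ha hab)
      (KSpan.base (a+1) (b+1) (by omega) (by omega)), ?_⟩
    intro ξ hξ
    have hu : HasDerivAt (fun ξ : ℝ => ξ ^ σ) (σ * ξ ^ σ / ξ) ξ := by
      have := Real.hasDerivAt_rpow_const (x := ξ) (p := σ) (Or.inl hξ.ne')
      rw [Real.rpow_sub_one hξ.ne'] at this
      convert this using 1
      ring
    have hpos : 0 < ξ ^ σ := Real.rpow_pos_of_pos hξ σ
    have h1 := (hu.fun_pow a).fun_div ((hu.const_add 1).fun_pow b) (by positivity)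
    refine h1.congr_deriv ?_
    obtain ⟨a, rfl⟩ : ∃ a', a = a' + 1 := ⟨a - 1, by omega⟩
    obtain ⟨b, rfl⟩ : ∃ b', b = b' + 1 := ⟨b - 1, by omega⟩
    simp only [Nat.add_sub_cancel]
    generalize ξ ^ σ = u at *
    have : (1 + u) ≠ 0 := by positivity
    field_simp
    push_cast
    ring
  | comb c d f g hf hg ihf ihg =>
    obtain ⟨f', hf', hf''⟩ := ihf
    obtain ⟨g', hg', hg''⟩ := ihg
    refine ⟨_, KSpan.comb c d _ _ hf' hg', ?_⟩
    intro ξ hξ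
    have := ((hf'' ξ hξ).const_mul c).fun_add ((hg'' ξ hξ).const_mul d)
    refine this.congr_deriv ?_
    ring

theorem KSpan.bound {σ : ℝ} {f : ℝ → ℝ} (hf : KSpan σ f) :
    ∃ C, 0 < C ∧ ∀ ξ : ℝ, 0 < ξ → |f ξ| ≤ C * ξ ^ σ ∧ |f ξ| ≤ C * ξ ^ (-σ) := by
  induction hf with
  | base a b ha hab =>
    refine ⟨1, one_pos, fun ξ hξ => ?_⟩
    have hpos : 0 < ξ ^ σ := Real.rpow_pos_of_pos hξ σ
    rw [Real.rpow_neg hξ.le]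
    beta_reduce
    generalize ξ ^ σ = u at *
    rw [abs_of_nonneg (by positivity), one_mul, one_mul]
    have h1 : (1:ℝ) ≤ 1 + u := by linarith
    constructor
    · rw [div_le_iff₀ (by positivity)]
      obtain ⟨a, rfl⟩ : ∃ a', a = a' + 1 := ⟨a - 1, by omega⟩
      have : u ^ a ≤ (1 + u) ^ b :=
        (pow_le_pow_left₀ hpos.le (by linarith) a).trans (pow_le_pow_right₀ h1 (by omega))
      rw [pow_succ]
      nlinarith
    · rw [div_le_iff₀ (by positivity), inv_mul_eq_div, le_div_iff₀ hpos, ← pow_succ]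
      exact (pow_le_pow_left₀ hpos.le (by linarith) (a+1)).trans (pow_le_pow_right₀ h1 (by omega))
  | comb c d f g hf hg ihf ihg =>
    obtain ⟨A, hA, hf'⟩ := ihf
    obtain ⟨B, hB, hg'⟩ := ihg
    refine ⟨|c| * A + |d| * B + 1, by positivity, fun ξ hξ => ?_⟩
    have key : ∀ v : ℝ, 0 < v → |f ξ| ≤ A * v → |g ξ| ≤ B * v →
        |c * f ξ + d * g ξ| ≤ (|c| * A + |d| * B + 1) * v := by
      intro v hv h1 h2
      calc |c * f ξ + d * g ξ| ≤ |c| * |f ξ| + |d| * |g ξ| := by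
            rw [← abs_mul, ← abs_mul]; exact abs_add_le _ _
        _ ≤ |c| * (A * v) + |d| * (B * v) := by gcongr
        _ ≤ _ := by nlinarith
    exact ⟨key _ (Real.rpow_pos_of_pos hξ _) (hf' ξ hξ).1 (hg' ξ hξ).1,
      key _ (Real.rpow_pos_of_pos hξ _) (hf' ξ hξ).2 (hg' ξ hξ).2⟩

theorem KSpan.tendsto {σ : ℝ} (hσ : 0 < σ) {f : ℝ → ℝ} (hf : KSpan σ f) :
    Tendsto f atTop (nhds 0) := by
  obtain ⟨C, hC, h⟩ := hf.bound
  have h0 : Tendsto (fun ξ : ℝ => C * ξ ^ (-σ)) atTop (nhds 0) := by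
    simpa using (tendsto_rpow_neg_atTop hσ).const_mul C
  refine squeeze_zero_norm' ?_ h0
  filter_upwards [eventually_gt_atTop 0] with ξ hξ
  exact (h ξ hξ).2

theorem KSpan.contOn {σ : ℝ} {f : ℝ → ℝ} (hf : KSpan σ f) :
    ContinuousOn f (Set.Ioi 0) := by
  obtain ⟨g, _, hg⟩ := hf.deriv
  exact fun ξ hξ => (hg ξ hξ).continuousAt.continuousWithinAt

theorem KSpan.integrableOn {σ : ℝ} (hσ : 1 < σ) {f : ℝ → ℝ} (hf : KSpan σ f) :
    IntegrableOn f (Set.Ioi 0) := by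
  obtain ⟨C, hC, h⟩ := hf.bound
  rw [← Set.Ioc_union_Ioi_eq_Ioi (zero_le_one (α := ℝ))]
  refine IntegrableOn.union ?_ ?_
  · refine Integrable.mono' (g := fun _ => C) (integrableOn_const (by simp))
      ((hf.contOn.mono Set.Ioc_subset_Ioi_self).aestronglyMeasurable measurableSet_Ioc) ?_
    refine (ae_restrict_iff' measurableSet_Ioc).2 (Eventually.of_forall fun ξ hξ => ?_)
    refine (h ξ hξ.1).1.trans ?_
    have : ξ ^ σ ≤ 1 := Real.rpow_le_one hξ.1.le hξ.2 (by linarith)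
    nlinarith
  · have hi : IntegrableOn (fun ξ : ℝ => C * ξ ^ (-σ)) (Set.Ioi 1) :=
      (integrableOn_Ioi_rpow_of_lt (by linarith) one_pos).const_mul C
    refine Integrable.mono' hi ((hf.contOn.mono
      (Set.Ioi_subset_Ioi zero_le_one)).aestronglyMeasurable measurableSet_Ioi) ?_
    refine (ae_restrict_iff' measurableSet_Ioi).2 (Eventually.of_forall fun ξ hξ => ?_)
    exact (h ξ (zero_lt_one.trans hξ)).2

theorem KSpan.decay {σ : ℝ} (hσ1 : 1 < σ) (hσ2 : σ < 2) {f : ℝ → ℝ} (hf : KSpan σ f) :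
    ∃ C : ℝ, 0 < C ∧ ∀ x : ℝ, 1 ≤ x →
      |∫ ξ in Set.Ioi (0:ℝ), f ξ * Real.cos (x * ξ)| ≤ C * x ^ (-(1 + σ)) := by
  obtain ⟨g, hg, hfg⟩ := hf.deriv
  obtain ⟨p, hp, hgp⟩ := hg.deriv
  obtain ⟨q, hq, hpq⟩ := hp.deriv
  obtain ⟨C0, hC0, b0⟩ := hf.bound
  obtain ⟨C1, hC1, b1⟩ := hg.bound
  obtain ⟨C2, hC2, b2⟩ := hp.bound
  obtain ⟨C3, hC3, b3⟩ := hq.bound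
  obtain ⟨D, hD⟩ : ∃ D, D = C3 + 3 * C2 + 2 * C1 := ⟨_, rfl⟩
  have hDpos : 0 < D := by rw [hD]; positivity
  have h2σ : 0 < 2 - σ := by linarith
  refine ⟨C0 + (C0 + C1 + (C2 + C1)) + D / (2 - σ), by positivity, fun x hx => ?_⟩
  have hx0 : 0 < x := by linarith
  obtain ⟨a, ha⟩ : ∃ a, a = x⁻¹ := ⟨_, rfl⟩
  have ha0 : 0 < a := by rw [ha]; positivity
  have hxa : x = a⁻¹ := by rw [ha, inv_inv]
  have hfint : IntegrableOn (fun ξ => f ξ * Real.cos (x * ξ)) (Set.Ioi 0) := by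
    refine Integrable.mono (hf.integrableOn hσ1) ?_ ?_
    · exact (hf.contOn.mul (by fun_prop)).aestronglyMeasurable measurableSet_Ioi
    · refine Eventually.of_forall fun ξ => ?_
      rw [norm_mul]
      exact mul_le_of_le_one_right (norm_nonneg _) (Real.abs_cos_le_one _)
  -- target power
  have hpow : x ^ (-(1 + σ)) = a ^ σ * a := by
    rw [hxa, Real.inv_rpow ha0.le, Real.rpow_neg ha0.le, inv_inv, add_comm, Real.rpow_add_one ha0.ne']
  have haσ : 0 < a ^ σ := Real.rpow_pos_of_pos ha0 σ
  -- near part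
  have near : |∫ ξ in Set.Ioc 0 a, f ξ * Real.cos (x * ξ)| ≤ C0 * a ^ σ * a := by
    have := norm_setIntegral_le_of_norm_le_const (μ := volume) (s := Set.Ioc 0 a)
      (f := fun ξ => f ξ * Real.cos (x * ξ)) (C := C0 * a ^ σ) (by simp) ?_
    · simpa [ha0.le] using this
    · intro ξ hξ
      rw [norm_mul]
      refine (mul_le_of_le_one_right (norm_nonneg _) (Real.abs_cos_le_one _)).trans ?_
      refine (b0 ξ hξ.1).1.trans ?_
      have : ξ ^ σ ≤ a ^ σ := Real.rpow_le_rpow hξ.1.le hξ.2 (by linarith)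
      gcongr
  -- remainder function
  have hRb : ∀ ξ : ℝ, a < ξ → ‖(q ξ - 3 * p ξ + 2 * g ξ) / ξ ^ 3 * Real.sin (x * ξ) * a ^ 3‖
      ≤ (a ^ 3 * D) * ξ ^ (σ - 3) := by
    intro ξ hξ
    have hξ0 : 0 < ξ := ha0.trans hξ
    have e : ξ ^ (σ - 3) = ξ ^ σ / ξ ^ 3 := by
      rw [Real.rpow_sub hξ0]; norm_cast
    have t : |q ξ - 3 * p ξ + 2 * g ξ| ≤ D * ξ ^ σ := by
      have h1 := abs_le.1 (b1 ξ hξ0).1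
      have h2 := abs_le.1 (b2 ξ hξ0).1
      have h3 := abs_le.1 (b3 ξ hξ0).1
      rw [abs_le, hD]
      constructor <;> linarith [h1.1, h1.2, h2.1, h2.2, h3.1, h3.2]
    rw [norm_mul, norm_mul, norm_div, Real.norm_eq_abs, Real.norm_eq_abs, Real.norm_eq_abs,
      Real.norm_eq_abs, abs_of_pos (pow_pos hξ0 3), abs_of_pos (pow_pos ha0 3), e]
    calc _ ≤ D * ξ ^ σ / ξ ^ 3 * 1 * a ^ 3 := by
          gcongr
          exact Real.abs_sin_le_one _
      _ = _ := by ring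
  have hRi0 : IntegrableOn (fun ξ : ℝ => (a ^ 3 * D) * ξ ^ (σ - 3)) (Set.Ioi a) :=
      (integrableOn_Ioi_rpow_of_lt (by linarith) ha0).const_mul _
  have hae := (ae_restrict_iff' (μ := volume) (measurableSet_Ioi (a := a))).2 (Eventually.of_forall hRb)
  have hRi : IntegrableOn (fun ξ => (q ξ - 3 * p ξ + 2 * g ξ) / ξ ^ 3 * Real.sin (x * ξ) * a ^ 3)
      (Set.Ioi a) := by
    refine Integrable.mono' hRi0 ?_ hae
    refine ContinuousOn.aestronglyMeasurable ?_ measurableSet_Ioi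
    have hsub : Set.Ioi a ⊆ Set.Ioi (0:ℝ) := Set.Ioi_subset_Ioi ha0.le
    have c1 := hg.contOn.mono hsub
    have c2 := hp.contOn.mono hsub
    have c3 := hq.contOn.mono hsub
    refine ContinuousOn.mul (ContinuousOn.mul (ContinuousOn.div ?_ (by fun_prop) ?_)
      (by fun_prop)) (by fun_prop)
    · fun_prop
    · intro ξ hξ
      exact (pow_pos (ha0.trans hξ) 3).ne'
  have hRint : |∫ ξ in Set.Ioi a, (q ξ - 3 * p ξ + 2 * g ξ) / ξ ^ 3 * Real.sin (x * ξ) * a ^ 3|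
      ≤ D / (2 - σ) * (a ^ σ * a) := by
    refine (norm_integral_le_of_norm_le hRi0 hae).trans (le_of_eq ?_)
    rw [integral_const_mul, integral_Ioi_rpow_of_lt (by linarith) ha0]
    have e : a ^ (σ - 3 + 1) = a ^ σ / a ^ 2 := by
      rw [show σ - 3 + 1 = σ - 2 by ring, Real.rpow_sub ha0]; norm_cast
    rw [e, show σ - 3 + 1 = -(2 - σ) by ring]
    field_simp
  -- antiderivative
  obtain ⟨G, hG⟩ : ∃ G : ℝ → ℝ, G = fun ξ => f ξ * Real.sin (x * ξ) * a
    + g ξ / ξ * Real.cos (x * ξ) * a ^ 2 - (p ξ - g ξ) / ξ ^ 2 * Real.sin (x * ξ) * a ^ 3 := ⟨_, rfl⟩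
  have hGd : ∀ ξ : ℝ, 0 < ξ → HasDerivAt G (f ξ * Real.cos (x * ξ) -
      (q ξ - 3 * p ξ + 2 * g ξ) / ξ ^ 3 * Real.sin (x * ξ) * a ^ 3) ξ := by
    intro ξ hξ
    have hl : HasDerivAt (fun ξ : ℝ => x * ξ) x ξ := by
      simpa using (hasDerivAt_id ξ).const_mul x
    have d1 := ((hfg ξ hξ).fun_mul hl.sin).mul_const a
    have d2 := (((hgp ξ hξ).fun_div (hasDerivAt_id' ξ) hξ.ne').fun_mul hl.cos).mul_const (a ^ 2)
    have d3 := ((((hpq ξ hξ).fun_sub (hgp ξ hξ)).fun_div ((hasDerivAt_id' ξ).fun_pow 2)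
      (pow_ne_zero 2 hξ.ne')).fun_mul hl.sin).mul_const (a ^ 3)
    have d := (d1.fun_add d2).fun_sub d3
    rw [hG]
    refine d.congr_deriv ?_
    rw [hxa]
    field_simp
    push_cast
    ring
  have hsinb : ∀ (u : ℝ → ℝ), Tendsto u atTop (nhds 0) →
      Tendsto (fun ξ => u ξ * Real.sin (x * ξ)) atTop (nhds 0) := by
    intro u hu
    refine squeeze_zero_norm (fun ξ => ?_) (by simpa using hu.norm)
    rw [norm_mul]
    exact mul_le_of_le_one_right (norm_nonneg _) (Real.abs_sin_le_one _)
  have hcosb : ∀ (u : ℝ → ℝ), Tendsto u atTop (nhds 0) →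
      Tendsto (fun ξ => u ξ * Real.cos (x * ξ)) atTop (nhds 0) := by
    intro u hu
    refine squeeze_zero_norm (fun ξ => ?_) (by simpa using hu.norm)
    rw [norm_mul]
    exact mul_le_of_le_one_right (norm_nonneg _) (Real.abs_cos_le_one _)
  have hσ0 : 0 < σ := by linarith
  have hGt : Tendsto G atTop (nhds 0) := by
    have t1 := (hsinb f (hf.tendsto hσ0)).mul_const a
    have t2 := (hcosb _ ((hg.tendsto hσ0).div_atTop tendsto_id)).mul_const (a ^ 2)
    have t3 := (hsinb _ (((hp.tendsto hσ0).sub (hg.tendsto hσ0)).div_atTop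
      (tendsto_pow_atTop (two_ne_zero)))).mul_const (a ^ 3)
    have t := (t1.add t2).sub t3
    rw [hG]
    simpa using t
  have hfa : IntegrableOn (fun ξ => f ξ * Real.cos (x * ξ)) (Set.Ioi a) :=
    hfint.mono_set (Set.Ioi_subset_Ioi ha0.le)
  have hFTC := integral_Ioi_of_hasDerivAt_of_tendsto' (a := a) (f := G) (m := 0)
    (fun ξ hξ => hGd ξ (lt_of_lt_of_le ha0 hξ)) (hfa.sub hRi) hGt
  rw [integral_sub hfa hRi] at hFTC
  have hGa : |G a| ≤ (C0 + C1 + (C2 + C1)) * (a ^ σ * a) := by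
    have hs : ∀ (y M t : ℝ), |y| ≤ M → |t| ≤ 1 → |y * t| ≤ M := by
      intro y M t h1 h2
      rw [abs_mul]
      exact (mul_le_of_le_one_right (abs_nonneg _) h2).trans h1
    have e : G a = (f a * Real.sin (x * a) + g a * Real.cos (x * a)
        - (p a - g a) * Real.sin (x * a)) * a := by
      rw [hG]; field_simp
    rw [e, abs_mul, abs_of_pos ha0, ← mul_assoc]
    refine mul_le_mul_of_nonneg_right ?_ ha0.le
    have i1 := hs _ _ (Real.sin (x * a)) (b0 a ha0).1 (Real.abs_sin_le_one _)
    have i2 := hs _ _ (Real.cos (x * a)) (b1 a ha0).1 (Real.abs_cos_le_one _)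
    have i3 := hs (p a - g a) (C2 * a ^ σ + C1 * a ^ σ) (Real.sin (x * a))
      ((abs_sub _ _).trans (add_le_add (b2 a ha0).1 (b1 a ha0).1)) (Real.abs_sin_le_one _)
    rw [abs_le] at *
    constructor <;> linarith [i1.1, i1.2, i2.1, i2.2, i3.1, i3.2]
  have hsplit : ∫ ξ in Set.Ioi (0:ℝ), f ξ * Real.cos (x * ξ) =
      (∫ ξ in Set.Ioc 0 a, f ξ * Real.cos (x * ξ)) + ∫ ξ in Set.Ioi a, f ξ * Real.cos (x * ξ) := by
    rw [← Set.Ioc_union_Ioi_eq_Ioi ha0.le]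
    exact setIntegral_union (Set.Ioc_disjoint_Ioi le_rfl) measurableSet_Ioi
      (hfint.mono_set Set.Ioc_subset_Ioi_self) hfa
  rw [hsplit, hpow]
  rw [abs_le] at *
  constructor <;> linarith [near.1, near.2, hGa.1, hGa.2, hRint.1, hRint.2]

/-- For `1 < σ < 2` and integers `1 ≤ m ≤ k`, the kernel
`K(x) = ∫₀^∞ ξ^{σm}/(1+ξ^σ)^{1+k} cos(xξ) dξ` is bounded on `[0,∞)`, satisfies
`|K(x)| ≤ C x^{-(1+σ)}` for `x ≥ 1`, and is integrable on `(0,∞)`. -/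
theorem kernel_Kkm_properties (σ : ℝ) (hσ1 : 1 < σ) (hσ2 : σ < 2)
    (k m : ℕ) (hm : 1 ≤ m) (hmk : m ≤ k) (K : ℝ → ℝ)
    (hK : ∀ x : ℝ, K x =
      ∫ ξ in Set.Ioi (0:ℝ), ξ ^ (σ * (m : ℝ)) / (1 + ξ ^ σ) ^ (1 + k) * Real.cos (x * ξ)) :
    (∃ M : ℝ, ∀ x : ℝ, 0 ≤ x → |K x| ≤ M) ∧
    (∃ C : ℝ, 0 < C ∧ ∀ x : ℝ, 1 ≤ x → |K x| ≤ C * x ^ (-(1 + σ))) ∧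
    IntegrableOn K (Set.Ioi 0) := by
  obtain ⟨f, hfdef⟩ : ∃ f : ℝ → ℝ, f = fun ξ => (ξ ^ σ) ^ m / (1 + ξ ^ σ) ^ (1 + k) := ⟨_, rfl⟩
  have hf : KSpan σ f := by
    rw [hfdef]; exact KSpan.base m (1 + k) hm (by omega)
  have hK' : ∀ x, K x = ∫ ξ in Set.Ioi (0:ℝ), f ξ * Real.cos (x * ξ) := by
    intro x
    rw [hK x]
    refine setIntegral_congr_fun measurableSet_Ioi fun ξ hξ => ?_
    simp only [hfdef]
    rw [Real.rpow_mul (le_of_lt hξ), Real.rpow_natCast]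
  have hfi := hf.integrableOn hσ1
  have hle : ∀ x ξ : ℝ, ‖f ξ * Real.cos (x * ξ)‖ ≤ ‖f ξ‖ := by
    intro x ξ
    rw [norm_mul]
    exact mul_le_of_le_one_right (norm_nonneg _) (Real.abs_cos_le_one _)
  have hbd : ∀ x, |K x| ≤ ∫ ξ in Set.Ioi (0:ℝ), ‖f ξ‖ := by
    intro x
    rw [hK' x]
    exact norm_integral_le_of_norm_le hfi.norm (Eventually.of_forall (hle x))
  have hcont : Continuous K := by
    rw [funext hK']
    refine continuous_of_dominated (bound := fun ξ => ‖f ξ‖) (fun x => ?_)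
      (fun x => Eventually.of_forall (hle x)) hfi.norm (Eventually.of_forall fun ξ => by fun_prop)
    exact (hf.contOn.mul (by fun_prop)).aestronglyMeasurable measurableSet_Ioi
  obtain ⟨C, hC, hdec⟩ := hf.decay hσ1 hσ2
  have hdec' : ∀ x : ℝ, 1 ≤ x → |K x| ≤ C * x ^ (-(1 + σ)) := by
    intro x hx
    rw [hK' x]; exact hdec x hx
  refine ⟨⟨_, fun x _ => hbd x⟩, ⟨C, hC, hdec'⟩, ?_⟩
  rw [← Set.Ioc_union_Ioi_eq_Ioi (zero_le_one (α := ℝ))]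
  refine IntegrableOn.union ?_ ?_
  · exact Measure.integrableOn_of_bounded (by simp)
      hcont.aestronglyMeasurable (Eventually.of_forall hbd)
  · have hi : IntegrableOn (fun ξ : ℝ => C * ξ ^ (-(1 + σ))) (Set.Ioi 1) :=
      (integrableOn_Ioi_rpow_of_lt (by linarith) one_pos).const_mul C
    refine Integrable.mono' hi hcont.aestronglyMeasurable ?_
    exact (ae_restrict_iff' measurableSet_Ioi).2 (Eventually.of_forall fun ξ hξ => hdec' ξ (le_of_lt hξ))
end

section
/- Let 1 ≤ σ < 2 and let k, m be positive integers with 1 ≤ m ≤ k. Then there exists a constant C > 0 such that for all x ≥ 1, the absolutely convergent integral I₁(x) := ∫₀^∞ ξ^{σ(m+2)−2}/(1 + ξ^σ)^{3+k} cos(xξ) dξ satisfies |I₁(x)| ≤ C/x. -/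
open MeasureTheory Filter Real

lemma I1_aux_cont (σ a : ℝ) (hσ : 1 ≤ σ) (ha : 0 ≤ a) (N : ℕ) :
    ContinuousOn (fun ξ : ℝ => ξ ^ a / (1 + ξ ^ σ) ^ N) (Set.Ici 0) := by
  apply ContinuousOn.div
  · exact (Real.continuous_rpow_const ha).continuousOn
  · exact ((continuous_const.add (Real.continuous_rpow_const (by linarith))).pow N).continuousOn
  · intro ξ hξ
    have : 0 ≤ ξ ^ σ := Real.rpow_nonneg hξ σ
    positivity

lemma I1_aux_bound (σ a : ℝ) (N : ℕ) (ξ : ℝ) (hξ : 0 < ξ) :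
    ‖ξ ^ a / (1 + ξ ^ σ) ^ N‖ ≤ ξ ^ (a - σ * N) := by
  have h0 : 0 < ξ ^ σ := Real.rpow_pos_of_pos hξ σ
  have h1 : 0 < ξ ^ a := Real.rpow_pos_of_pos hξ a
  rw [Real.norm_of_nonneg (by positivity), Real.rpow_sub hξ, Real.rpow_mul hξ.le,
    Real.rpow_natCast]
  gcongr
  linarith

lemma I1_aux_int (σ a : ℝ) (hσ : 1 ≤ σ) (ha : 0 ≤ a) (N : ℕ) (h : a - σ * N < -1) :
    IntegrableOn (fun ξ : ℝ => ξ ^ a / (1 + ξ ^ σ) ^ N) (Set.Ioi 0) := by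
  have hc := I1_aux_cont σ a hσ ha N
  rw [← Set.Ioc_union_Ioi_eq_Ioi (zero_le_one (α := ℝ))]
  apply IntegrableOn.union
  · exact ((hc.mono Set.Icc_subset_Ici_self).integrableOn_Icc).mono_set Set.Ioc_subset_Icc_self
  · refine Integrable.mono' (integrableOn_Ioi_rpow_of_lt h zero_lt_one) ?_ ?_
    · exact (hc.mono (Set.Ioi_subset_Ici (zero_le_one (α := ℝ)))).aestronglyMeasurable
        measurableSet_Ioi
    · filter_upwards [ae_restrict_mem measurableSet_Ioi] with y hy
      exact I1_aux_bound σ a N y (zero_lt_one.trans hy)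

lemma I1_aux_deriv (σ p : ℝ) (n : ℕ) (ξ : ℝ) (hξ : 0 < ξ) :
    HasDerivAt (fun ξ : ℝ => ξ ^ p / (1 + ξ ^ σ) ^ (n + 1))
      (p * (ξ ^ (p - 1) / (1 + ξ ^ σ) ^ (n + 1))
        - (n + 1) * σ * (ξ ^ (p + σ - 1) / (1 + ξ ^ σ) ^ (n + 2))) ξ := by
  have h0 : 0 < ξ ^ σ := Real.rpow_pos_of_pos hξ σ
  have h1 := Real.hasDerivAt_rpow_const (x := ξ) (p := p) (Or.inl hξ.ne')
  have h2 := ((Real.hasDerivAt_rpow_const (x := ξ) (p := σ) (Or.inl hξ.ne')).const_add 1).pow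
    (n + 1)
  have h3 := h1.div h2 (by simp only [Pi.pow_apply]; positivity)
  refine h3.congr_deriv ?_
  have e : ξ ^ (p + σ - 1) = ξ ^ p * ξ ^ (σ - 1) := by
    rw [← Real.rpow_add hξ]; ring_nf
  simp only [Pi.pow_apply, Nat.add_sub_cancel]
  rw [e]
  have : (1 + ξ ^ σ) ≠ 0 := by positivity
  push_cast
  field_simp
  try ring

/-- For `1 ≤ σ < 2` and integers `1 ≤ m ≤ k`, there is `C > 0` such that for `x ≥ 1` the
absolutely convergent integral `I₁(x) = ∫₀^∞ ξ^{σ(m+2)−2}/(1+ξ^σ)^{3+k} cos(xξ) dξ`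
satisfies `|I₁(x)| ≤ C/x`. -/
theorem I1_decay (σ : ℝ) (hσ1 : 1 ≤ σ) (hσ2 : σ < 2)
    (k m : ℕ) (hm : 1 ≤ m) (hmk : m ≤ k) :
    ∃ C : ℝ, 0 < C ∧ ∀ x : ℝ, 1 ≤ x →
      IntegrableOn
        (fun ξ : ℝ => ξ ^ (σ * ((m : ℝ) + 2) - 2) / (1 + ξ ^ σ) ^ (3 + k) * Real.cos (x * ξ))
        (Set.Ioi 0) ∧
      |∫ ξ in Set.Ioi (0:ℝ),
          ξ ^ (σ * ((m : ℝ) + 2) - 2) / (1 + ξ ^ σ) ^ (3 + k) * Real.cos (x * ξ)| ≤ C / x := by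
  have hm' : (1:ℝ) ≤ m := by exact_mod_cast hm
  have hmk' : (m:ℝ) ≤ k := by exact_mod_cast hmk
  obtain ⟨p, hp⟩ : ∃ p, p = σ * ((m : ℝ) + 2) - 2 := ⟨_, rfl⟩
  have hp1 : 1 ≤ p := by nlinarith
  have hpN : p - σ * ((k:ℝ) + 3) < -1 := by nlinarith
  rw [← hp, show 3 + k = (k + 2) + 1 by ring]
  set f : ℝ → ℝ := fun ξ => ξ ^ p / (1 + ξ ^ σ) ^ (k + 2 + 1) with hf
  set g : ℝ → ℝ := fun ξ => p * (ξ ^ (p - 1) / (1 + ξ ^ σ) ^ (k + 2 + 1))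
        - ((k + 2 : ℕ) + 1) * σ * (ξ ^ (p + σ - 1) / (1 + ξ ^ σ) ^ (k + 2 + 2)) with hg
  have hfc : ContinuousOn f (Set.Ici 0) := I1_aux_cont σ p hσ1 (by linarith) _
  have hfi : IntegrableOn f (Set.Ioi 0) :=
    I1_aux_int σ p hσ1 (by linarith) _ (by push_cast; linarith)
  have hgi : IntegrableOn g (Set.Ioi 0) := by
    apply Integrable.sub
    · exact (I1_aux_int σ (p-1) hσ1 (by linarith) _ (by push_cast; linarith)).const_mul _
    · exact (I1_aux_int σ (p+σ-1) hσ1 (by linarith) _ (by push_cast; linarith)).const_mul _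
  have hfg : ∀ ξ ∈ Set.Ioi (0:ℝ), HasDerivAt f (g ξ) ξ := fun ξ hξ => I1_aux_deriv σ p _ ξ hξ
  have hft : Tendsto f atTop (nhds 0) := by
    have h1 := tendsto_rpow_neg_atTop (y := σ * ((k:ℝ)+3) - p) (by linarith)
    refine squeeze_zero_norm' ?_ h1
    filter_upwards [eventually_gt_atTop 0] with y hy
    refine (I1_aux_bound σ p _ y hy).trans (le_of_eq ?_)
    congr 1; push_cast; ring
  have hI : 0 ≤ ∫ ξ in Set.Ioi (0:ℝ), ‖g ξ‖ := integral_nonneg fun _ => norm_nonneg _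
  refine ⟨(∫ ξ in Set.Ioi (0:ℝ), ‖g ξ‖) + 1, by linarith, fun x hx => ?_⟩
  have hx0 : 0 < x := by linarith
  have hci : IntegrableOn (fun ξ => f ξ * Real.cos (x * ξ)) (Set.Ioi 0) := by
    refine Integrable.mul_bdd (c := 1) hfi (by fun_prop) (ae_of_all _ fun y => ?_)
    exact Real.abs_cos_le_one _
  have hsi : IntegrableOn (fun ξ => g ξ * Real.sin (x * ξ)) (Set.Ioi 0) := by
    refine Integrable.mul_bdd (c := 1) hgi (by fun_prop) (ae_of_all _ fun y => ?_)
    exact Real.abs_sin_le_one _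
  refine ⟨hci, ?_⟩
  have key := integral_Ioi_of_hasDerivAt_of_tendsto (a := 0) (m := 0)
    (f := fun ξ => f ξ * Real.sin (x * ξ))
    (f' := fun ξ => g ξ * Real.sin (x * ξ) + x * (f ξ * Real.cos (x * ξ)))
    ((hfc 0 Set.self_mem_Ici).mul (by fun_prop)) ?_ (hsi.add (hci.const_mul x)) ?_
  · rw [integral_add hsi (hci.const_mul x), integral_const_mul] at key
    simp only [mul_zero, Real.sin_zero, sub_zero] at key
    have hb : |∫ ξ in Set.Ioi (0:ℝ), g ξ * Real.sin (x * ξ)| ≤ ∫ ξ in Set.Ioi (0:ℝ), ‖g ξ‖ := by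
      rw [← Real.norm_eq_abs]
      refine norm_integral_le_of_norm_le hgi.norm (ae_of_all _ fun y => ?_)
      rw [norm_mul]
      exact mul_le_of_le_one_right (norm_nonneg _) (Real.abs_sin_le_one _)
    rw [le_div_iff₀ hx0]
    change |∫ ξ in Set.Ioi (0:ℝ), f ξ * Real.cos (x * ξ)| * x ≤ _
    rw [← abs_of_pos hx0, ← abs_mul, abs_of_pos hx0, mul_comm, eq_neg_of_add_eq_zero_right key,
      abs_neg]
    linarith
  · intro ξ hξ
    have h1 : HasDerivAt (fun ξ => Real.sin (x * ξ)) (Real.cos (x * ξ) * x) ξ := by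
      simpa using ((hasDerivAt_id ξ).const_mul x).sin
    exact ((hfg ξ hξ).mul h1).congr_deriv (by ring)
  · refine squeeze_zero_norm (fun y => ?_) (by simpa using hft.norm)
    rw [norm_mul]
    exact mul_le_of_le_one_right (norm_nonneg _) (Real.abs_sin_le_one _)
end

section
/- Let 1 < σ < 2 and let k ≥ 1 be an integer. Then lim_{x→+∞} x^{σ−1} ∫₀^∞ ξ^{σ−2}/(1 + ξ^σ)^{3+k} cos(xξ) dξ = ∫₀^π η^{σ−2} cos η dη + (2 − σ) ∫_π^∞ η^{σ−3} sin η dη, where all integrals converge absolutely. -/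
open MeasureTheory Filter Real

lemma aux_den (σ t : ℝ) (m : ℕ) (ht : 0 ≤ t) : 1 ≤ (1 + t ^ σ) ^ m :=
  one_le_pow₀ (by have := Real.rpow_nonneg ht σ; linarith)

lemma aux_contOn (σ : ℝ) (m : ℕ) (x : ℝ) (hx : 0 < x) :
    ContinuousOn (fun η : ℝ => η ^ (σ - 2) / (1 + (η / x) ^ σ) ^ m) (Set.Ioi 0) := by
  intro η hη
  have hη : 0 < η := hη
  have h0 : 0 < η / x := by positivity
  have := aux_den σ (η / x) m h0.le
  apply ContinuousAt.continuousWithinAt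
  refine ContinuousAt.div (Real.continuousAt_rpow_const _ _ (Or.inl hη.ne')) ?_ (by positivity)
  refine ContinuousAt.pow (continuousAt_const.add ?_) m
  exact ContinuousAt.rpow_const (by fun_prop) (Or.inl h0.ne')

lemma aux_int (σ : ℝ) (hσ1 : 1 < σ) (m : ℕ) (hm : 1 ≤ m) (x : ℝ) :
    IntegrableOn (fun ξ : ℝ => ξ ^ (σ - 2) / (1 + ξ ^ σ) ^ m * Real.cos (x * ξ)) (Set.Ioi 0) := by
  have hc : ContinuousOn (fun ξ : ℝ => ξ ^ (σ - 2) / (1 + ξ ^ σ) ^ m * Real.cos (x * ξ))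
      (Set.Ioi 0) := by
    have := aux_contOn σ m 1 one_pos
    simp only [div_one] at this
    exact this.mul (by fun_prop)
  have hb : ∀ ξ : ℝ, 0 < ξ → ‖ξ ^ (σ - 2) / (1 + ξ ^ σ) ^ m * Real.cos (x * ξ)‖
      ≤ ξ ^ (σ - 2) / (1 + ξ ^ σ) ^ m := by
    intro ξ h
    have h1 : 0 ≤ ξ ^ (σ - 2) / (1 + ξ ^ σ) ^ m := by positivity
    rw [norm_mul, Real.norm_of_nonneg h1]
    exact mul_le_of_le_one_right h1 (Real.abs_cos_le_one _)
  rw [← Set.Ioc_union_Ioi_eq_Ioi (zero_le_one' ℝ)]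
  refine IntegrableOn.union ?_ ?_
  · have hi : IntegrableOn (fun ξ : ℝ => ξ ^ (σ - 2)) (Set.Ioc 0 1) := by
      rw [← intervalIntegrable_iff_integrableOn_Ioc_of_le zero_le_one]
      exact intervalIntegral.intervalIntegrable_rpow' (by linarith)
    refine Integrable.mono' hi ((hc.mono Set.Ioc_subset_Ioi_self).aestronglyMeasurable measurableSet_Ioc) ?_
    refine (ae_restrict_iff' measurableSet_Ioc).2 (Eventually.of_forall fun ξ h => ?_)
    refine (hb ξ h.1).trans (div_le_self (Real.rpow_nonneg h.1.le _) (aux_den _ _ _ h.1.le))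
  · have hi : IntegrableOn (fun ξ : ℝ => ξ ^ (-2 : ℝ)) (Set.Ioi 1) :=
      integrableOn_Ioi_rpow_of_lt (by norm_num) one_pos
    refine Integrable.mono' hi ((hc.mono (Set.Ioi_subset_Ioi zero_le_one)).aestronglyMeasurable
      measurableSet_Ioi) ?_
    refine (ae_restrict_iff' measurableSet_Ioi).2 (Eventually.of_forall fun ξ h => ?_)
    have h0 : 0 < ξ := lt_trans one_pos h
    refine (hb ξ h0).trans ?_
    have h1 : 0 < ξ ^ σ := by positivity
    have h2 : ξ ^ σ ≤ (1 + ξ ^ σ) ^ m :=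
      le_trans (by linarith) (le_self_pow₀ (by linarith : 1 ≤ 1 + ξ ^ σ) (by omega))
    rw [div_le_iff₀ (by positivity)]
    calc ξ ^ (σ - 2) = ξ ^ (-2 : ℝ) * ξ ^ σ := by rw [← Real.rpow_add h0]; ring_nf
      _ ≤ _ := by gcongr

lemma aux_deriv (σ : ℝ) (m : ℕ) (x : ℝ) (hx : 0 < x) (η : ℝ) (hη : 0 < η) :
    HasDerivAt (fun η : ℝ => η ^ (σ - 2) / (1 + (η / x) ^ σ) ^ m)
      (η ^ (σ - 3) * ((σ - 2) / (1 + (η / x) ^ σ) ^ m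
        - m * σ * (η / x) ^ σ / (1 + (η / x) ^ σ) ^ (m + 1))) η := by
  have h0 : 0 < η / x := by positivity
  have h1 : 0 < (η / x) ^ σ := by positivity
  have d1 := Real.hasDerivAt_rpow_const (x := η) (p := σ - 2) (Or.inl hη.ne')
  have d2 := ((((hasDerivAt_id η).div_const x).rpow_const (p := σ) (Or.inl h0.ne')).const_add 1).pow m
  have d3 := d1.div d2 (by
    simp only [id, Pi.pow_apply]; exact pow_ne_zero _ (by positivity))
  refine d3.congr_deriv ?_
  simp only [id]
  have e1 : η ^ (σ - 2 - 1) = η ^ (σ - 3) := by ring_nf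
  have e2 : η ^ (σ - 2) = η ^ (σ - 3) * η := by
    rw [← Real.rpow_add_one hη.ne']; ring_nf
  have e3 : (η / x) ^ (σ - 1) = (η / x) ^ σ / (η / x) := Real.rpow_sub_one h0.ne' _
  simp only [Pi.pow_apply]
  rw [e1, e2, e3]
  rcases m with _ | m
  · simp; ring
  · generalize (η / x) ^ σ = A at *
    have : 1 + A ≠ 0 := by positivity
    simp only [Nat.add_sub_cancel]
    field_simp
    push_cast
    ring

lemma aux_bound (σ : ℝ) (hσ1 : 1 < σ) (hσ2 : σ < 2) (m : ℕ) (t : ℝ) (ht : 0 < t) :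
    |(σ - 2) / (1 + t ^ σ) ^ m - m * σ * t ^ σ / (1 + t ^ σ) ^ (m + 1)| ≤ (2 - σ) + m * σ := by
  have h1 : 0 < t ^ σ := by positivity
  have h2 := aux_den σ t m ht.le
  have h3 : 1 + t ^ σ ≤ (1 + t ^ σ) ^ (m + 1) := le_self_pow₀ (by linarith) (by omega)
  refine (abs_sub _ _).trans (add_le_add ?_ ?_)
  · rw [abs_div, abs_of_neg (by linarith), abs_of_pos (by positivity : 0 < (1 + t ^ σ) ^ m)]
    exact (div_le_self (by linarith) h2).trans (by linarith)
  · rw [abs_of_nonneg (by positivity), mul_div_assoc]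
    refine mul_le_of_le_one_right (by positivity) ?_
    rw [div_le_one (by positivity)]
    linarith

lemma aux_meas (σ : ℝ) (m : ℕ) (x : ℝ) : Measurable fun η : ℝ => η ^ (σ - 3) *
    ((σ - 2) / (1 + (η / x) ^ σ) ^ m
        - m * σ * (η / x) ^ σ / (1 + (η / x) ^ σ) ^ (m + 1)) * Real.sin η := by
  fun_prop

lemma aux_bd2 (σ : ℝ) (hσ1 : 1 < σ) (hσ2 : σ < 2) (m : ℕ) (x : ℝ) (hx : 0 < x) :
    ∀ᵐ η ∂(volume.restrict (Set.Ioi π)), ‖η ^ (σ - 3) *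
    ((σ - 2) / (1 + (η / x) ^ σ) ^ m
        - m * σ * (η / x) ^ σ / (1 + (η / x) ^ σ) ^ (m + 1)) * Real.sin η‖ ≤
      η ^ (σ - 3) * ((2 - σ) + m * σ) := by
  refine (ae_restrict_iff' measurableSet_Ioi).2 (Eventually.of_forall fun η h => ?_)
  have h0 : 0 < η := lt_trans pi_pos h
  have hb := aux_bound σ hσ1 hσ2 m (η / x) (by positivity)
  rw [norm_mul, norm_mul, Real.norm_of_nonneg (by positivity : 0 ≤ η ^ (σ - 3))]
  refine (mul_le_of_le_one_right (by positivity) (Real.abs_sin_le_one _)).trans ?_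
  exact mul_le_mul_of_nonneg_left hb (by positivity)

lemma aux_tend (σ : ℝ) (hσ1 : 1 < σ) (η : ℝ) :
    Tendsto (fun x : ℝ => (η / x) ^ σ) atTop (nhds 0) := by
  have h : Tendsto (fun x : ℝ => η / x) atTop (nhds 0) := tendsto_const_nhds.div_atTop tendsto_id
  have := h.rpow_const (p := σ) (Or.inr (by linarith))
  rwa [Real.zero_rpow (by linarith)] at this

theorem I3_limit (σ : ℝ) (hσ1 : 1 < σ) (hσ2 : σ < 2) (k : ℕ) (hk : 1 ≤ k) :
    (∀ x : ℝ, IntegrableOn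
      (fun ξ : ℝ => ξ ^ (σ - 2) / (1 + ξ ^ σ) ^ (3 + k) * Real.cos (x * ξ)) (Set.Ioi 0)) ∧
    IntervalIntegrable (fun η : ℝ => η ^ (σ - 2) * Real.cos η) volume 0 π ∧
    IntegrableOn (fun η : ℝ => η ^ (σ - 3) * Real.sin η) (Set.Ioi π) ∧
    Tendsto
      (fun x : ℝ => x ^ (σ - 1) *
        ∫ ξ in Set.Ioi (0:ℝ), ξ ^ (σ - 2) / (1 + ξ ^ σ) ^ (3 + k) * Real.cos (x * ξ))
      atTop
      (nhds ((∫ η in (0:ℝ)..π, η ^ (σ - 2) * Real.cos η) +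
        (2 - σ) * ∫ η in Set.Ioi π, η ^ (σ - 3) * Real.sin η)) := by
  obtain ⟨m, hm, hm1⟩ : ∃ m, m = 3 + k ∧ 1 ≤ m := ⟨_, rfl, by omega⟩
  rw [← hm]
  have hr3 : IntegrableOn (fun η : ℝ => η ^ (σ - 3)) (Set.Ioi π) :=
    integrableOn_Ioi_rpow_of_lt (by linarith) pi_pos
  have hr2 : IntervalIntegrable (fun η : ℝ => η ^ (σ - 2)) volume 0 π :=
    intervalIntegral.intervalIntegrable_rpow' (by linarith)
  have hI := aux_int σ hσ1 m hm1
  refine ⟨hI, ?_, ?_, ?_⟩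
  · exact hr2.mul_continuousOn (by fun_prop)
  · refine Integrable.mul_bdd (c := 1) hr3 (by fun_prop) (Eventually.of_forall fun η => ?_)
    exact Real.abs_sin_le_one _
  -- the two limits
  have L1 : Tendsto (fun x : ℝ => ∫ η in (0:ℝ)..π,
      η ^ (σ - 2) / (1 + (η / x) ^ σ) ^ m * Real.cos η) atTop
      (nhds (∫ η in (0:ℝ)..π, η ^ (σ - 2) * Real.cos η)) := by
    refine intervalIntegral.tendsto_integral_filter_of_dominated_convergence
      (fun η => η ^ (σ - 2)) ?_ ?_ hr2 ?_
    · exact Eventually.of_forall fun x => Measurable.aestronglyMeasurable (by fun_prop)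
    · filter_upwards [eventually_gt_atTop 0] with x hx
      refine Eventually.of_forall fun η h => ?_
      rw [Set.uIoc_of_le pi_pos.le] at h
      have h0 : 0 < η := h.1
      rw [norm_mul, Real.norm_of_nonneg (by positivity : 0 ≤ η ^ (σ - 2) / (1 + (η / x) ^ σ) ^ m)]
      refine (mul_le_of_le_one_right (by positivity) (Real.abs_cos_le_one _)).trans ?_
      exact div_le_self (by positivity) (aux_den _ _ _ (by positivity))
    · refine Eventually.of_forall fun η h => ?_
      have := ((tendsto_const_nhds (x := η ^ (σ - 2))).div (((aux_tend σ hσ1 η).const_add 1).pow m)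
        (by simp)).mul_const (Real.cos η)
      simpa using this
  have L2 : Tendsto (fun x : ℝ => ∫ η in Set.Ioi π, η ^ (σ - 3) *
    ((σ - 2) / (1 + (η / x) ^ σ) ^ m
        - m * σ * (η / x) ^ σ / (1 + (η / x) ^ σ) ^ (m + 1)) * Real.sin η) atTop
      (nhds (∫ η in Set.Ioi π, η ^ (σ - 3) * (σ - 2) * Real.sin η)) := by
    refine tendsto_integral_filter_of_dominated_convergence
      (fun η => η ^ (σ - 3) * ((2 - σ) + m * σ)) ?_ ?_ (hr3.mul_const _) ?_
    · exact Eventually.of_forall fun x => (aux_meas σ m x).aestronglyMeasurable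
    · filter_upwards [eventually_gt_atTop 0] with x hx
      exact aux_bd2 σ hσ1 hσ2 m x hx
    · refine Eventually.of_forall fun η => ?_
      have ht := aux_tend σ hσ1 η
      have a1 := (tendsto_const_nhds (x := σ - 2)).div ((ht.const_add 1).pow m) (by simp)
      have a2 := (ht.const_mul (m * σ)).div ((ht.const_add 1).pow (m + 1)) (by simp)
      have := ((a1.sub a2).const_mul (η ^ (σ - 3))).mul_const (Real.sin η)
      simpa using this
  have L := L1.sub L2
  have e : (∫ η in (0:ℝ)..π, η ^ (σ - 2) * Real.cos η) +
        (2 - σ) * ∫ η in Set.Ioi π, η ^ (σ - 3) * Real.sin η =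
      (∫ η in (0:ℝ)..π, η ^ (σ - 2) * Real.cos η) -
        ∫ η in Set.Ioi π, η ^ (σ - 3) * (σ - 2) * Real.sin η := by
    have : ∀ η : ℝ, η ^ (σ - 3) * (σ - 2) * Real.sin η = (σ - 2) * (η ^ (σ - 3) * Real.sin η) :=
      fun η => by ring
    simp only [this]
    rw [integral_const_mul]; ring
  rw [e]
  refine L.congr' ?_
  filter_upwards [eventually_gt_atTop 0] with x hx
  set g : ℝ → ℝ := fun η => η ^ (σ - 2) / (1 + (η / x) ^ σ) ^ m * Real.cos η with hg
  have hgx : ∀ ξ ∈ Set.Ioi (0:ℝ), g (x * ξ) =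
      x ^ (σ - 2) * (ξ ^ (σ - 2) / (1 + ξ ^ σ) ^ m * Real.cos (x * ξ)) := by
    intro ξ hξ
    have hξ : 0 < ξ := hξ
    simp only [hg]
    rw [mul_div_cancel_left₀ _ hx.ne', Real.mul_rpow hx.le hξ.le]
    ring
  have hgi : IntegrableOn g (Set.Ioi 0) := by
    have h1 : IntegrableOn (fun ξ => g (x * ξ)) (Set.Ioi 0) :=
      IntegrableOn.congr_fun ((hI x).const_mul (x ^ (σ - 2))) (fun ξ h => (hgx ξ h).symm) measurableSet_Ioi
    have := (integrableOn_Ioi_comp_mul_left_iff g 0 hx).1 h1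
    simpa using this
  have hsub : x ^ (σ - 1) * (∫ ξ in Set.Ioi (0:ℝ),
      ξ ^ (σ - 2) / (1 + ξ ^ σ) ^ m * Real.cos (x * ξ)) = ∫ η in Set.Ioi 0, g η := by
    have h1 := integral_comp_mul_left_Ioi g 0 hx
    rw [setIntegral_congr_fun measurableSet_Ioi hgx, integral_const_mul, mul_zero, smul_eq_mul] at h1
    have h2 : x ^ (σ - 1) = x * x ^ (σ - 2) := by
      rw [mul_comm, ← Real.rpow_add_one hx.ne']; ring_nf
    rw [h2, mul_assoc, h1, mul_inv_cancel_left₀ hx.ne']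
  rw [hsub]
  have hsplit : ∫ η in Set.Ioi 0, g η = (∫ η in (0:ℝ)..π, g η) + ∫ η in Set.Ioi π, g η := by
    rw [intervalIntegral.integral_of_le pi_pos.le, ← Set.Ioc_union_Ioi_eq_Ioi pi_pos.le]
    exact setIntegral_union (Set.Ioc_disjoint_Ioi le_rfl) measurableSet_Ioi
      (hgi.mono_set fun y hy => hy.1) (hgi.mono_set fun y hy => lt_trans pi_pos hy)
  rw [hsplit, sub_eq_add_neg]
  congr 1
  have hcont : ContinuousAt (fun η : ℝ => η ^ (σ - 2) / (1 + (η / x) ^ σ) ^ m * Real.sin η) π :=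
    (((aux_contOn σ m x hx).mul Real.continuous_sin.continuousOn).continuousAt
      (Ioi_mem_nhds pi_pos))
  have hz : Tendsto (fun η : ℝ => η ^ (σ - 2) / (1 + (η / x) ^ σ) ^ m * Real.sin η)
      (nhdsWithin π (Set.Ioi π)) (nhds 0) := by
    have := hcont.tendsto.mono_left (nhdsWithin_le_nhds (s := Set.Ioi π))
    simpa using this
  have hinf : Tendsto (fun η : ℝ => η ^ (σ - 2) / (1 + (η / x) ^ σ) ^ m * Real.sin η)
      atTop (nhds 0) := by
    have h1 : Tendsto (fun η : ℝ => η ^ (σ - 2)) atTop (nhds 0) := by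
      have := tendsto_rpow_neg_atTop (y := 2 - σ) (by linarith)
      simpa using this
    refine squeeze_zero_norm' ?_ h1
    filter_upwards [eventually_gt_atTop 0] with η h0
    rw [norm_mul, Real.norm_of_nonneg (by positivity : 0 ≤ η ^ (σ - 2) / (1 + (η / x) ^ σ) ^ m)]
    refine (mul_le_of_le_one_right (by positivity) (Real.abs_sin_le_one _)).trans ?_
    exact div_le_self (by positivity) (aux_den _ _ _ (by positivity))
  have := integral_Ioi_mul_deriv_eq_deriv_mul
    (u := fun η : ℝ => η ^ (σ - 2) / (1 + (η / x) ^ σ) ^ m) (v := Real.sin) (v' := Real.cos)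
    (fun η h => aux_deriv σ m x hx η (lt_trans pi_pos h))
    (fun η _ => Real.hasDerivAt_sin η)
    (hgi.mono_set fun y hy => lt_trans pi_pos hy)
    (Integrable.mono' (hr3.mul_const ((2 - σ) + m * σ)) (aux_meas σ m x).aestronglyMeasurable
      (aux_bd2 σ hσ1 hσ2 m x hx))
    hz hinf
  simp only [hg]
  rw [this]
  simp
end

section
/- Let 1 < σ < 2 and let k, m be integers with 2 ≤ m ≤ k. Define K(x) := ∫₀^∞ ξ^{σm}/(1 + ξ^σ)^{1+k} cos(xξ) dξ for x ≥ 0 (the integral converges absolutely since σ(k + 1 − m) > 1). Then x^{1+σ} K(x) → 0 as x → +∞. -/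
open MeasureTheory Filter Real

/-- The basic building block. -/
noncomputable def gKk (σ a : ℝ) (n : ℕ) (ξ : ℝ) : ℝ := ξ ^ a / (1 + ξ ^ σ) ^ n

/-- Its half-line Fourier transform. -/
noncomputable def eKk (σ a : ℝ) (n : ℕ) (x : ℝ) : ℂ :=
  ∫ ξ in Set.Ioi (0:ℝ), (gKk σ a n ξ : ℂ) * Complex.exp (((x * ξ : ℝ) : ℂ) * Complex.I)

lemma gKk_nonneg (σ a : ℝ) (n : ℕ) {ξ : ℝ} (h : 0 < ξ) : 0 ≤ gKk σ a n ξ := by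
  unfold gKk; positivity

lemma gKk_le_left (σ a : ℝ) (n : ℕ) {ξ : ℝ} (h : 0 < ξ) : gKk σ a n ξ ≤ ξ ^ a := by
  unfold gKk
  apply div_le_self (by positivity)
  apply one_le_pow₀
  have : 0 < ξ ^ σ := by positivity
  linarith

lemma gKk_le_right (σ a : ℝ) (n : ℕ) {ξ : ℝ} (h : 0 < ξ) :
    gKk σ a n ξ ≤ ξ ^ (a - σ * n) := by
  unfold gKk
  rw [Real.rpow_sub h, Real.rpow_mul h.le, Real.rpow_natCast]
  have : 0 < ξ ^ σ := by positivity
  gcongr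
  linarith

lemma gKk_hasDerivAt (σ a : ℝ) (n : ℕ) {ξ : ℝ} (h : 0 < ξ) :
    HasDerivAt (gKk σ a n)
      (a * gKk σ (a - 1) n ξ - n * σ * gKk σ (a + σ - 1) (n + 1) ξ) ξ := by
  have hp : 0 < ξ ^ σ := by positivity
  have h1 := Real.hasDerivAt_rpow_const (x := ξ) (p := a) (Or.inl h.ne')
  have h2 := ((Real.hasDerivAt_rpow_const (x := ξ) (p := σ) (Or.inl h.ne')).const_add 1).fun_pow n
  have h3 := h1.fun_div h2 (by positivity)
  refine h3.congr_deriv ?_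
  unfold gKk
  have e : ξ ^ (a + σ - 1) = ξ ^ a * ξ ^ (σ - 1) := by
    rw [← Real.rpow_add h]; congr 1; ring
  rw [e]
  have hq : (1 + ξ ^ σ) ≠ 0 := by positivity
  cases n with
  | zero => simp
  | succ n =>
    simp only [Nat.add_sub_cancel]
    field_simp
    ring

lemma gKk_contOn (σ a : ℝ) (n : ℕ) : ContinuousOn (gKk σ a n) (Set.Ioi 0) :=
  fun _ h => (gKk_hasDerivAt σ a n h).continuousAt.continuousWithinAt

lemma gKk_int (σ a : ℝ) (n : ℕ) (ha : -1 < a) (hd : a - σ * n < -1) :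
    IntegrableOn (gKk σ a n) (Set.Ioi 0) := by
  rw [← Set.Ioc_union_Ioi_eq_Ioi (zero_le_one' ℝ)]
  refine IntegrableOn.union ?_ ?_
  · have h1 : IntegrableOn (fun ξ : ℝ => ξ ^ a) (Set.Ioc 0 1) :=
      (intervalIntegrable_iff_integrableOn_Ioc_of_le zero_le_one).1
        (intervalIntegral.intervalIntegrable_rpow' ha)
    refine Integrable.mono' h1
      (((gKk_contOn σ a n).mono fun x hx => hx.1).aestronglyMeasurable measurableSet_Ioc) ?_
    refine (ae_restrict_mem measurableSet_Ioc).mono fun ξ hξ => ?_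
    rw [Real.norm_of_nonneg (gKk_nonneg _ _ _ hξ.1)]
    exact gKk_le_left _ _ _ hξ.1
  · have h1 := integrableOn_Ioi_rpow_of_lt hd zero_lt_one
    refine Integrable.mono' h1
      (((gKk_contOn σ a n).mono (Set.Ioi_subset_Ioi zero_le_one)).aestronglyMeasurable
        measurableSet_Ioi) ?_
    refine (ae_restrict_mem measurableSet_Ioi).mono fun ξ hξ => ?_
    have h0 : 0 < ξ := lt_trans zero_lt_one hξ
    rw [Real.norm_of_nonneg (gKk_nonneg _ _ _ h0)]
    exact gKk_le_right _ _ _ h0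

lemma gKk_int_exp (σ a : ℝ) (n : ℕ) (ha : -1 < a) (hd : a - σ * n < -1) (x : ℝ) :
    IntegrableOn (fun ξ : ℝ => (gKk σ a n ξ : ℂ) *
      Complex.exp (((x * ξ : ℝ) : ℂ) * Complex.I)) (Set.Ioi 0) := by
  refine Integrable.mono' (gKk_int σ a n ha hd) ?_ ?_
  · refine ContinuousOn.aestronglyMeasurable ?_ measurableSet_Ioi
    refine (Complex.continuous_ofReal.comp_continuousOn (gKk_contOn σ a n)).mul ?_
    exact Continuous.continuousOn (by fun_prop)
  · refine (ae_restrict_mem measurableSet_Ioi).mono fun ξ hξ => ?_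
    rw [norm_mul, Complex.norm_exp_ofReal_mul_I, mul_one, Complex.norm_real,
      Real.norm_of_nonneg (gKk_nonneg _ _ _ hξ)]

lemma eKk_parts (σ a : ℝ) (n : ℕ) (hσ : 0 < σ) (ha : 0 < a) (hd : a - σ * n < -1) (x : ℝ) :
    (x * Complex.I) * eKk σ a n x =
      -((a : ℂ) * eKk σ (a - 1) n x - (n * σ : ℂ) * eKk σ (a + σ - 1) (n + 1) x) := by
  have i0 := gKk_int_exp σ a n (by linarith) hd x
  have i1 := gKk_int_exp σ (a - 1) n (by linarith) (by linarith) x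
  have i2 := gKk_int_exp σ (a + σ - 1) (n + 1) (by linarith) (by push_cast; linarith) x
  have i12 : Integrable (fun ξ : ℝ => (a : ℂ) * ((gKk σ (a - 1) n ξ : ℂ) *
      Complex.exp (((x * ξ : ℝ) : ℂ) * Complex.I)) - (n * σ : ℂ) *
      ((gKk σ (a + σ - 1) (n + 1) ξ : ℂ) * Complex.exp (((x * ξ : ℝ) : ℂ) * Complex.I)))
      (volume.restrict (Set.Ioi 0)) := (i1.const_mul (a : ℂ)).sub (i2.const_mul (n * σ : ℂ))
  have i3 := ((i1.const_mul (a : ℂ)).sub (i2.const_mul (n * σ : ℂ))).add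
    (i0.const_mul (x * Complex.I))
  have key := integral_Ioi_of_hasDerivAt_of_tendsto (a := (0:ℝ)) (m := (0:ℂ))
    (f := fun ξ : ℝ => (gKk σ a n ξ : ℂ) * Complex.exp (((x * ξ : ℝ) : ℂ) * Complex.I))
    (f' := fun ξ : ℝ => ((a : ℂ) * ((gKk σ (a - 1) n ξ : ℂ) *
      Complex.exp (((x * ξ : ℝ) : ℂ) * Complex.I)) - (n * σ : ℂ) *
      ((gKk σ (a + σ - 1) (n + 1) ξ : ℂ) * Complex.exp (((x * ξ : ℝ) : ℂ) * Complex.I)))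
      + (x * Complex.I) * ((gKk σ a n ξ : ℂ) * Complex.exp (((x * ξ : ℝ) : ℂ) * Complex.I)))
    ?_ ?_ i3 ?_
  · rw [integral_add i12 (i0.const_mul _),
      integral_sub (i1.const_mul _) (i2.const_mul _), integral_const_mul, integral_const_mul,
      integral_const_mul] at key
    have z : gKk σ a n 0 = 0 := by
      unfold gKk; rw [Real.zero_rpow ha.ne', zero_div]
    rw [z] at key
    simp only [Complex.ofReal_zero, zero_mul, sub_zero] at key
    unfold eKk
    linear_combination key
  · refine ContinuousAt.continuousWithinAt ?_
    refine ContinuousAt.mul ?_ (by fun_prop)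
    refine Complex.continuous_ofReal.continuousAt.comp ?_
    unfold gKk
    refine ContinuousAt.div (Real.continuousAt_rpow_const _ _ (Or.inr ha.le)) ?_ ?_
    · exact (continuousAt_const.add (Real.continuousAt_rpow_const _ _ (Or.inr hσ.le))).pow n
    · rw [Real.zero_rpow hσ.ne']; simp
  · intro ξ hξ
    have h1 := (gKk_hasDerivAt σ a n hξ).ofReal_comp
    have h2 : HasDerivAt (fun ξ : ℝ => Complex.exp (((x * ξ : ℝ) : ℂ) * Complex.I))
        (Complex.exp (((x * ξ : ℝ) : ℂ) * Complex.I) * (((x * 1 : ℝ) : ℂ) * Complex.I)) ξ :=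
      ((((hasDerivAt_id ξ).const_mul x).ofReal_comp).mul_const Complex.I).cexp
    refine (h1.mul h2).congr_deriv ?_
    push_cast
    ring
  · have hneg : Tendsto (fun ξ : ℝ => ξ ^ (a - σ * n)) atTop (nhds 0) := by
      have := tendsto_rpow_neg_atTop (y := -(a - σ * n)) (by linarith)
      simpa using this
    refine squeeze_zero_norm' ?_ hneg
    filter_upwards [eventually_gt_atTop 0] with ξ hξ
    rw [norm_mul, Complex.norm_exp_ofReal_mul_I, mul_one, Complex.norm_real,
      Real.norm_of_nonneg (gKk_nonneg _ _ _ hξ)]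
    exact gKk_le_right _ _ _ hξ

lemma eKk_bound (σ : ℝ) (hσ : 0 < σ) (j : ℕ) : ∀ (a : ℝ) (n : ℕ), (j : ℝ) - 1 < a →
    a - σ * n < -1 → ∃ C : ℝ, ∀ x : ℝ, 0 < x → x ^ j * ‖eKk σ a n x‖ ≤ C := by
  induction j with
  | zero =>
    intro a n ha hd
    refine ⟨∫ ξ in Set.Ioi (0:ℝ), gKk σ a n ξ, fun x _ => ?_⟩
    rw [pow_zero, one_mul]
    refine norm_integral_le_of_norm_le (gKk_int σ a n (by simpa using ha) hd) ?_
    refine (ae_restrict_mem measurableSet_Ioi).mono fun ξ hξ => ?_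
    rw [norm_mul, Complex.norm_exp_ofReal_mul_I, mul_one, Complex.norm_real,
      Real.norm_of_nonneg (gKk_nonneg _ _ _ hξ)]
  | succ j ih =>
    intro a n ha hd
    push_cast at ha
    have hj : (0:ℝ) ≤ j := Nat.cast_nonneg j
    obtain ⟨C1, h1⟩ := ih (a - 1) n (by linarith) (by linarith)
    obtain ⟨C2, h2⟩ := ih (a + σ - 1) (n + 1) (by linarith) (by push_cast; linarith)
    refine ⟨a * C1 + n * σ * C2, fun x hx => ?_⟩
    have hp := congrArg norm (eKk_parts σ a n hσ (by linarith) hd x)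
    have ha0 : 0 < a := by linarith
    have hle : x * ‖eKk σ a n x‖ ≤ a * ‖eKk σ (a - 1) n x‖ +
        n * σ * ‖eKk σ (a + σ - 1) (n + 1) x‖ := by
      rw [norm_mul, norm_mul, Complex.norm_I, mul_one, Complex.norm_real,
        Real.norm_of_nonneg hx.le, norm_neg] at hp
      rw [hp]
      refine (norm_sub_le _ _).trans (le_of_eq ?_)
      rw [norm_mul, norm_mul, norm_mul, Complex.norm_real, Complex.norm_real,
        Real.norm_of_nonneg ha0.le, Real.norm_of_nonneg hσ.le, Complex.norm_natCast]
    calc x ^ (j + 1) * ‖eKk σ a n x‖ = x ^ j * (x * ‖eKk σ a n x‖) := by ring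
      _ ≤ x ^ j * (a * ‖eKk σ (a - 1) n x‖ + n * σ * ‖eKk σ (a + σ - 1) (n + 1) x‖) := by
        gcongr
      _ = a * (x ^ j * ‖eKk σ (a - 1) n x‖) +
          n * σ * (x ^ j * ‖eKk σ (a + σ - 1) (n + 1) x‖) := by ring
      _ ≤ _ := by
        have := h1 x hx
        have := h2 x hx
        gcongr

/-- For `1 < σ < 2` and integers `2 ≤ m ≤ k`, the kernel
`K(x) = ∫₀^∞ ξ^{σm}/(1+ξ^σ)^{1+k} cos(xξ) dξ` satisfies `x^{1+σ} K(x) → 0` as `x → +∞`. -/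
theorem kernel_Kkm_decay_m_ge_two (σ : ℝ) (hσ1 : 1 < σ) (hσ2 : σ < 2)
    (k m : ℕ) (hm : 2 ≤ m) (hmk : m ≤ k) (K : ℝ → ℝ)
    (hK : ∀ x : ℝ, K x =
      ∫ ξ in Set.Ioi (0:ℝ), ξ ^ (σ * (m : ℝ)) / (1 + ξ ^ σ) ^ (1 + k) * Real.cos (x * ξ)) :
    Tendsto (fun x : ℝ => x ^ (1 + σ) * K x) atTop (nhds 0) := by
  have hm' : (2:ℝ) ≤ m := by exact_mod_cast hm
  have hmk' : (m:ℝ) ≤ k := by exact_mod_cast hmk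
  have ha : ((3:ℕ):ℝ) - 1 < σ * m := by push_cast; nlinarith
  have hd : σ * m - σ * ((1 + k : ℕ) : ℝ) < -1 := by push_cast; nlinarith
  obtain ⟨C, hC⟩ := eKk_bound σ (by linarith) 3 (σ * m) (1 + k) ha hd
  have hre : ∀ x, K x = (eKk σ (σ * m) (1 + k) x).re := by
    intro x
    have hi := gKk_int_exp σ (σ * m) (1 + k) (by push_cast at ha; linarith) hd x
    have := Complex.reCLM.integral_comp_comm hi
    rw [hK]
    unfold eKk
    rw [Complex.reCLM_apply] at this
    rw [← this]
    refine integral_congr_ae (Eventually.of_forall fun ξ => ?_)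
    simp only [Complex.reCLM_apply]
    rw [Complex.re_ofReal_mul, Complex.exp_ofReal_mul_I_re]
    rfl
  have hneg : Tendsto (fun x : ℝ => C * x ^ (-(2 - σ))) atTop (nhds 0) := by
    simpa using (tendsto_rpow_neg_atTop (y := 2 - σ) (by linarith)).const_mul C
  refine squeeze_zero_norm' ?_ hneg
  filter_upwards [eventually_gt_atTop 0] with x hx
  have e : x ^ (1 + σ) = x ^ (-(2 - σ)) * x ^ 3 := by
    rw [← Real.rpow_natCast, ← Real.rpow_add hx]; congr 1; push_cast; ring
  have hp : 0 < x ^ (-(2 - σ)) := by positivity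
  rw [norm_mul, Real.norm_of_nonneg (by positivity), e, hre, mul_assoc, mul_comm C]
  refine mul_le_mul_of_nonneg_left (le_trans ?_ (hC x hx)) hp.le
  gcongr
  exact Complex.abs_re_le_norm _
end

section
/- Let 1 < σ < 2, let p, q be integers with 2 ≤ p < q, and let a₁, a₂ ∈ ℝ. Define G_σ(x) := (1/(2π)) ∫_ℝ e^{iξx}/(1 + |ξ|^σ) dξ. Suppose φ : ℝ → ℝ is continuous, bounded, satisfies φ(x) → 0 as |x| → ∞, and satisfies the convolution equation φ(x) = ∫_ℝ G_σ(x − y) (a₁ φ(y)^p + a₂ φ(y)^q) dy for all x ∈ ℝ. Then there exists a constant C > 0 such that |φ(x)| ≤ C ⟨x⟩^{−(1+σ)} for all x ∈ ℝ. -/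
open MeasureTheory Filter Real

namespace PD

lemma hu {ξ : ℝ} (hξ : 0 < ξ) (s : ℝ) : HasDerivAt (fun t : ℝ => t ^ s) (s * (ξ ^ s / ξ)) ξ := by
  have := Real.hasDerivAt_rpow_const (x := ξ) (p := s) (Or.inl hξ.ne')
  rwa [Real.rpow_sub_one hξ.ne'] at this

noncomputable def f0 (σ ξ : ℝ) : ℝ := 1 / (1 + ξ ^ σ)
noncomputable def f1 (σ ξ : ℝ) : ℝ := -σ * ξ ^ (σ - 1) / (1 + ξ ^ σ) ^ 2
noncomputable def f2 (σ ξ : ℝ) : ℝ :=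
  -σ * ξ ^ (σ - 2) * ((σ - 1) - (σ + 1) * ξ ^ σ) / (1 + ξ ^ σ) ^ 3
noncomputable def f3 (σ ξ : ℝ) : ℝ :=
  -σ * ξ ^ (σ - 3) * (((σ - 2) * ((σ - 1) - (σ + 1) * ξ ^ σ) - (σ + 1) * σ * ξ ^ σ) * (1 + ξ ^ σ)
    - 3 * σ * ξ ^ σ * ((σ - 1) - (σ + 1) * ξ ^ σ)) / (1 + ξ ^ σ) ^ 4

lemma rp1 {σ ξ : ℝ} (hξ : 0 < ξ) : ξ ^ (σ - 1) = ξ ^ σ / ξ := Real.rpow_sub_one hξ.ne' _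
lemma rp2 {σ ξ : ℝ} (hξ : 0 < ξ) : ξ ^ (σ - 2) = ξ ^ σ / ξ ^ 2 := by
  rw [Real.rpow_sub hξ]; norm_num
lemma rp3 {σ ξ : ℝ} (hξ : 0 < ξ) : ξ ^ (σ - 3) = ξ ^ σ / ξ ^ 3 := by
  rw [Real.rpow_sub hξ]; norm_num

lemma d0 {σ ξ : ℝ} (hξ : 0 < ξ) : HasDerivAt (f0 σ) (f1 σ ξ) ξ := by
  have hp : 0 < ξ ^ σ := Real.rpow_pos_of_pos hξ _
  have h := ((hu hξ σ).const_add 1).fun_inv (by positivity)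
  have e : f0 σ = fun t => (1 + t ^ σ)⁻¹ := by ext t; simp [f0]
  rw [e]; refine h.congr_deriv (Eq.symm ?_)
  rw [f1, rp1 hξ]; field_simp

lemma d1 {σ ξ : ℝ} (hξ : 0 < ξ) : HasDerivAt (f1 σ) (f2 σ ξ) ξ := by
  have hp : 0 < ξ ^ σ := Real.rpow_pos_of_pos hξ _
  have h := ((hu hξ (σ-1)).const_mul (-σ)).fun_div
    (((hu hξ σ).const_add 1).fun_pow 2) (by positivity)
  have e : f1 σ = fun t => -σ * t ^ (σ - 1) / (1 + t ^ σ) ^ 2 := by ext t; simp [f1]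
  rw [e]; refine h.congr_deriv (Eq.symm ?_)
  rw [f2, rp2 hξ, rp1 hξ]; field_simp; ring

lemma d2 {σ ξ : ℝ} (hξ : 0 < ξ) : HasDerivAt (f2 σ) (f3 σ ξ) ξ := by
  have hp : 0 < ξ ^ σ := Real.rpow_pos_of_pos hξ _
  have h := (((hu hξ (σ-2)).const_mul (-σ)).fun_mul
    (((hu hξ σ).const_mul (σ+1)).const_sub (σ - 1))).fun_div
    (((hu hξ σ).const_add 1).fun_pow 3) (by positivity)
  have e : f2 σ = fun t => -σ * t ^ (σ - 2) * ((σ - 1) - (σ + 1) * t ^ σ) / (1 + t ^ σ) ^ 3 := by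
    ext t; simp [f2]
  rw [e]; refine h.congr_deriv (Eq.symm ?_)
  rw [f3, rp3 hξ, rp2 hξ]; field_simp; ring

section
variable {σ : ℝ} (h1 : 1 < σ) (h2 : σ < 2)
include h1 h2

lemma f1_bd {ξ : ℝ} (hξ : 0 < ξ) : |f1 σ ξ| ≤ 2 / ξ := by
  have hp : 0 < ξ ^ σ := Real.rpow_pos_of_pos hξ _
  rw [f1, rp1 hξ, abs_div, abs_mul, abs_neg, abs_of_pos (show 0 < σ by linarith),
    abs_of_pos (show 0 < ξ ^ σ / ξ by positivity), abs_of_pos (show 0 < (1 + ξ ^ σ) ^ 2 by positivity),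
    div_le_div_iff₀ (by positivity) hξ]
  have : σ * (ξ ^ σ / ξ) * ξ = σ * ξ ^ σ := by field_simp
  rw [this]
  nlinarith

lemma f2_bd {ξ : ℝ} (hξ : 0 < ξ) : |f2 σ ξ| ≤ 6 * ξ ^ (σ - 2) / (1 + ξ ^ σ) ^ 2 := by
  have hp : 0 < ξ ^ σ := Real.rpow_pos_of_pos hξ _
  have hp2 : 0 < ξ ^ (σ - 2) := Real.rpow_pos_of_pos hξ _
  have hb : |(σ - 1) - (σ + 1) * ξ ^ σ| ≤ 3 * (1 + ξ ^ σ) := by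
    rw [abs_le]; constructor <;> nlinarith
  rw [f2, abs_div, abs_mul, abs_mul, abs_neg, abs_of_pos (show 0 < σ by linarith),
    abs_of_pos hp2, abs_of_pos (show 0 < (1 + ξ ^ σ) ^ 3 by positivity),
    div_le_div_iff₀ (by positivity) (by positivity)]
  calc σ * ξ ^ (σ - 2) * |σ - 1 - (σ + 1) * ξ ^ σ| * (1 + ξ ^ σ) ^ 2
      ≤ 2 * ξ ^ (σ - 2) * (3 * (1 + ξ ^ σ)) * (1 + ξ ^ σ) ^ 2 := by gcongr
    _ = _ := by ring

lemma f2_bd1 {ξ : ℝ} (hξ : 0 < ξ) : |f2 σ ξ| ≤ 6 * ξ ^ (σ - 2) := by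
  have hp : 0 < ξ ^ σ := Real.rpow_pos_of_pos hξ _
  have hp2 : 0 < ξ ^ (σ - 2) := Real.rpow_pos_of_pos hξ _
  refine (f2_bd h1 h2 hξ).trans (div_le_self (by positivity) ?_)
  nlinarith

lemma f2_bd2 {ξ : ℝ} (hξ : 0 < ξ) : |f2 σ ξ| ≤ 6 * ξ ^ (-2 : ℝ) := by
  have hp : 0 < ξ ^ σ := Real.rpow_pos_of_pos hξ _
  refine (f2_bd h1 h2 hξ).trans ?_
  rw [div_le_iff₀ (by positivity), rp2 hξ, Real.rpow_neg hξ.le]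
  norm_num
  rw [mul_assoc]
  gcongr
  rw [div_eq_inv_mul]
  gcongr
  nlinarith

lemma f3_bd {ξ : ℝ} (hξ : 0 < ξ) : |f3 σ ξ| ≤ 100 * ξ ^ (σ - 3) := by
  have hp : 0 < ξ ^ σ := Real.rpow_pos_of_pos hξ _
  have hp2 : 0 < ξ ^ (σ - 3) := Real.rpow_pos_of_pos hξ _
  have hb : |(σ - 1) - (σ + 1) * ξ ^ σ| ≤ 3 * (1 + ξ ^ σ) := by
    rw [abs_le]; constructor <;> nlinarith
  have hs : 0 < σ := by linarith
  set B := (σ - 1) - (σ + 1) * ξ ^ σ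
  have hc : |((σ - 2) * B - (σ + 1) * σ * ξ ^ σ) * (1 + ξ ^ σ) - 3 * σ * ξ ^ σ * B|
      ≤ 50 * (1 + ξ ^ σ) ^ 2 := by
    calc _ ≤ |((σ - 2) * B - (σ + 1) * σ * ξ ^ σ) * (1 + ξ ^ σ)| + |3 * σ * ξ ^ σ * B| := abs_sub _ _
      _ ≤ (|(σ - 2) * B| + |(σ + 1) * σ * ξ ^ σ|) * (1 + ξ ^ σ) + |3 * σ * ξ ^ σ * B| := by
          rw [abs_mul (_ - _), abs_of_pos (show 0 < 1 + ξ ^ σ by positivity)]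
          gcongr
          exact abs_sub _ _
      _ = ((2 - σ) * |B| + (σ + 1) * σ * ξ ^ σ) * (1 + ξ ^ σ) + 3 * σ * ξ ^ σ * |B| := by
          rw [abs_mul (σ - 2), abs_mul _ B, abs_of_neg (show σ - 2 < 0 by linarith),
            abs_of_pos (show 0 < (σ + 1) * σ * ξ ^ σ by positivity),
            abs_of_pos (show 0 < 3 * σ * ξ ^ σ by positivity)]
          ring
      _ ≤ (1 * (3 * (1 + ξ ^ σ)) + (2 + 1) * 2 * (1 + ξ ^ σ)) * (1 + ξ ^ σ)
          + 3 * 2 * (1 + ξ ^ σ) * (3 * (1 + ξ ^ σ)) := by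
          gcongr <;> linarith
      _ ≤ _ := by nlinarith [sq_nonneg (1 + ξ ^ σ)]
  rw [f3, abs_div, abs_mul, abs_mul, abs_neg, abs_of_pos hs,
    abs_of_pos hp2, abs_of_pos (show 0 < (1 + ξ ^ σ) ^ 4 by positivity),
    div_le_iff₀ (by positivity)]
  calc σ * ξ ^ (σ - 3) * |_| 
      ≤ 2 * ξ ^ (σ - 3) * (50 * (1 + ξ ^ σ) ^ 2) := by gcongr
    _ = 100 * ξ ^ (σ - 3) * (1 + ξ ^ σ) ^ 2 := by ring
    _ ≤ _ := by
      gcongr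
      · linarith
      · norm_num

end
end PD

namespace PD
section
set_option linter.unusedSectionVars false
variable {σ : ℝ} (h1 : 1 < σ) (h2 : σ < 2)
include h1 h2

lemma int_base : Integrable (fun ξ : ℝ => 1 / (1 + |ξ| ^ σ)) := by
  have hI := integrable_rpow_neg_one_add_norm_sq (E := ℝ) (μ := volume) (r := σ) (by simpa using h1)
  refine hI.mono' ?_ (Eventually.of_forall fun x => ?_)
  · apply Measurable.aestronglyMeasurable; fun_prop
  · have hp : 0 ≤ |x| ^ σ := Real.rpow_nonneg (abs_nonneg _) _
    rw [Real.norm_of_nonneg (by positivity), neg_div, Real.rpow_neg (by positivity), one_div]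
    apply inv_anti₀ (by positivity)
    have := Real.rpow_add_le_add_rpow (p := σ / 2) (a := 1) (b := ‖x‖ ^ 2) zero_le_one (by positivity) (by linarith) (by linarith)
    refine this.trans (le_of_eq ?_)
    rw [Real.one_rpow, ← Real.rpow_natCast, ← Real.rpow_mul (norm_nonneg _)]
    congr 2
    push_cast; ring

lemma int_f0 : IntegrableOn (f0 σ) (Set.Ioi 0) := by
  refine (int_base h1 h2).integrableOn.congr_fun (fun x hx => ?_) measurableSet_Ioi
  simp only [f0]
  rw [abs_of_pos hx]

lemma meas_f2 : Measurable (f2 σ) := by unfold f2; fun_prop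
lemma meas_f3 : Measurable (f3 σ) := by unfold f3; fun_prop

lemma int_rpow {δ : ℝ} (hδ : 0 < δ) : IntegrableOn (fun ξ : ℝ => ξ ^ (σ - 2)) (Set.Ioc 0 δ) := by
  rw [← intervalIntegrable_iff_integrableOn_Ioc_of_le hδ.le]
  exact intervalIntegral.intervalIntegrable_rpow' (by linarith)

lemma int_f2_Ioc {δ : ℝ} (hδ : 0 < δ) : IntegrableOn (f2 σ) (Set.Ioc 0 δ) := by
  refine ((int_rpow h1 h2 hδ).const_mul 6).mono' (meas_f2 h1 h2).aestronglyMeasurable ?_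
  filter_upwards [ae_restrict_mem measurableSet_Ioc] with ξ hξ
  exact f2_bd1 h1 h2 hξ.1

lemma int_f2_Ioi {δ : ℝ} (hδ : 0 < δ) : IntegrableOn (f2 σ) (Set.Ioi δ) := by
  refine ((integrableOn_Ioi_rpow_of_lt (a := -2) (by norm_num) hδ).const_mul 6).mono'
    (meas_f2 h1 h2).aestronglyMeasurable ?_
  filter_upwards [ae_restrict_mem measurableSet_Ioi] with ξ hξ
  exact f2_bd2 h1 h2 (hδ.trans hξ)

lemma int_f3_Ioi {δ : ℝ} (hδ : 0 < δ) : IntegrableOn (f3 σ) (Set.Ioi δ) := by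
  refine ((integrableOn_Ioi_rpow_of_lt (a := σ - 3) (by linarith) hδ).const_mul 100).mono'
    (meas_f3 h1 h2).aestronglyMeasurable ?_
  filter_upwards [ae_restrict_mem measurableSet_Ioi] with ξ hξ
  exact f3_bd h1 h2 (hδ.trans hξ)

lemma int_f2 : IntegrableOn (f2 σ) (Set.Ioi 0) := by
  rw [← Set.Ioc_union_Ioi_eq_Ioi zero_le_one]
  exact (int_f2_Ioc h1 h2 one_pos).union (int_f2_Ioi h1 h2 one_pos)

omit h1 h2 in
lemma mul_cos {g : ℝ → ℝ} {s : Set ℝ} (hg : IntegrableOn g s) (x : ℝ) :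
    IntegrableOn (fun ξ => g ξ * Real.cos (ξ * x)) s := by
  refine Integrable.mul_bdd (c := 1) hg (by fun_prop) ?_
  exact Eventually.of_forall fun ξ => Real.abs_cos_le_one _

omit h1 h2 in
lemma mul_sin {g : ℝ → ℝ} {s : Set ℝ} (hg : IntegrableOn g s) (x : ℝ) :
    IntegrableOn (fun ξ => g ξ * Real.sin (ξ * x)) s := by
  refine Integrable.mul_bdd (c := 1) hg (by fun_prop) ?_
  exact Eventually.of_forall fun ξ => Real.abs_sin_le_one _

omit h1 h2 in
lemma lim_aux {g : ℝ → ℝ} (c : ℝ → ℝ) (hg : Tendsto g atTop (nhds 0)) (hc : ∀ ξ, |c ξ| ≤ 1) :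
    Tendsto (fun ξ => g ξ * c ξ) atTop (nhds 0) := by
  refine squeeze_zero_norm (fun ξ => ?_) (by simpa using hg.norm)
  rw [norm_mul]
  exact mul_le_of_le_one_right (norm_nonneg _) (hc ξ)

lemma lim_f0 : Tendsto (f0 σ) atTop (nhds 0) := by
  unfold f0
  simp_rw [one_div]
  exact tendsto_inv_atTop_zero.comp (tendsto_atTop_add_const_left _ _ (tendsto_rpow_atTop (by linarith)))

lemma lim_f1 : Tendsto (f1 σ) atTop (nhds 0) := by
  have : Tendsto (fun ξ : ℝ => 2 / ξ) atTop (nhds 0) := tendsto_const_nhds.div_atTop tendsto_id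
  refine squeeze_zero_norm' ?_ this
  filter_upwards [eventually_gt_atTop 0] with ξ hξ
  exact f1_bd h1 h2 hξ

lemma lim_f2 : Tendsto (f2 σ) atTop (nhds 0) := by
  have : Tendsto (fun ξ : ℝ => 6 * ξ ^ (-2 : ℝ)) atTop (nhds 0) := by
    simpa using (tendsto_rpow_neg_atTop (y := 2) (by norm_num)).const_mul 6
  refine squeeze_zero_norm' ?_ this
  filter_upwards [eventually_gt_atTop 0] with ξ hξ
  exact f2_bd2 h1 h2 hξ

lemma ibp1 {x : ℝ} (hx : 0 < x) :
    ∫ ξ in Set.Ioi 0, f0 σ ξ * Real.cos (ξ * x) =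
      - (1 / x ^ 2) * ∫ ξ in Set.Ioi 0, f2 σ ξ * Real.cos (ξ * x) := by
  have hA := mul_cos (int_f0 h1 h2) x
  have hB := (mul_cos (int_f2 h1 h2) x).const_mul (1 / x ^ 2)
  have key : ∫ ξ in Set.Ioi 0, (f0 σ ξ * Real.cos (ξ * x) + 1 / x ^ 2 * (f2 σ ξ * Real.cos (ξ * x)))
      = (0 * (1 / x) + 0 * (1 / x ^ 2)) - (f0 σ 0 * Real.sin (0 * x) * (1 / x) + f1 σ 0 * Real.cos (0 * x) * (1 / x ^ 2)) := by
    refine integral_Ioi_of_hasDerivAt_of_tendsto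
      (f := fun ξ => f0 σ ξ * Real.sin (ξ * x) * (1 / x) + f1 σ ξ * Real.cos (ξ * x) * (1 / x ^ 2))
      ?_ ?_ (hA.add hB) ?_
    · have c0 : ContinuousAt (fun t : ℝ => t ^ σ) 0 := Real.continuousAt_rpow_const _ _ (Or.inr (by linarith))
      have c1 : ContinuousAt (fun t : ℝ => t ^ (σ - 1)) 0 := Real.continuousAt_rpow_const _ _ (Or.inr (by linarith))
      have z : (1 : ℝ) + 0 ^ σ ≠ 0 := by
        rw [Real.zero_rpow (by linarith)]; norm_num
      have k0 : ContinuousAt (f0 σ) 0 := continuousAt_const.div (continuousAt_const.add c0) z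
      have k1 : ContinuousAt (f1 σ) 0 :=
        (continuousAt_const.mul c1).div ((continuousAt_const.add c0).pow 2) (pow_ne_zero _ z)
      apply ContinuousAt.continuousWithinAt
      fun_prop
    · intro ξ hξ
      have hid : HasDerivAt (fun ξ : ℝ => ξ * x) x ξ := by simpa using (hasDerivAt_id ξ).mul_const x
      refine ((((d0 (σ := σ) hξ).fun_mul hid.sin).mul_const (1 / x)).fun_add
        (((d1 (σ := σ) hξ).fun_mul hid.cos).mul_const (1 / x ^ 2))).congr_deriv ?_
      field_simp
      ring
    · refine Tendsto.add (Tendsto.mul_const _ ?_) (Tendsto.mul_const _ ?_)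
      · exact lim_aux _ (lim_f0 h1 h2) fun ξ => Real.abs_sin_le_one _
      · exact lim_aux _ (lim_f1 h1 h2) fun ξ => Real.abs_cos_le_one _
  rw [integral_add hA hB, integral_const_mul] at key
  have : f1 σ 0 = 0 := by
    rw [f1, Real.zero_rpow (by linarith)]; simp
  rw [this] at key
  simp at key
  simp
  linarith

lemma ibp2 {x δ : ℝ} (hx : 0 < x) (hδ : 0 < δ) :
    ∫ ξ in Set.Ioi δ, f2 σ ξ * Real.cos (ξ * x) =
      - (1 / x) * (f2 σ δ * Real.sin (δ * x)) - (1 / x) * ∫ ξ in Set.Ioi δ, f3 σ ξ * Real.sin (ξ * x) := by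
  have hA := mul_cos (int_f2_Ioi h1 h2 hδ) x
  have hB := (mul_sin (int_f3_Ioi h1 h2 hδ) x).const_mul (1 / x)
  have key : ∫ ξ in Set.Ioi δ, (f2 σ ξ * Real.cos (ξ * x) + 1 / x * (f3 σ ξ * Real.sin (ξ * x)))
      = (0 * (1 / x)) - (f2 σ δ * Real.sin (δ * x) * (1 / x)) := by
    refine integral_Ioi_of_hasDerivAt_of_tendsto'
      (f := fun ξ => f2 σ ξ * Real.sin (ξ * x) * (1 / x))
      ?_ (hA.add hB) ?_
    · intro ξ hξ
      have hid : HasDerivAt (fun ξ : ℝ => ξ * x) x ξ := by simpa using (hasDerivAt_id ξ).mul_const x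
      refine ((((d2 (σ := σ) (hδ.trans_le hξ)).fun_mul hid.sin).mul_const (1 / x))).congr_deriv ?_
      field_simp
      ring
    · refine (Tendsto.mul_const _ ?_)
      exact lim_aux _ (lim_f2 h1 h2) fun ξ => Real.abs_sin_le_one _
  rw [integral_add hA hB, integral_const_mul] at key
  linarith

lemma J_bd {x : ℝ} (hx : 0 < x) :
    |∫ ξ in Set.Ioi 0, f0 σ ξ * Real.cos (ξ * x)| ≤
      (6 / (σ - 1) + 6 + 100 / (2 - σ)) * x ^ (-(1 + σ)) := by
  have hδ : 0 < x⁻¹ := inv_pos.2 hx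
  have e1 : |∫ ξ in Set.Ioc 0 x⁻¹, f2 σ ξ * Real.cos (ξ * x)| ≤ 6 * (x⁻¹ ^ (σ - 1) / (σ - 1)) := by
    have := norm_integral_le_of_norm_le (μ := volume.restrict (Set.Ioc 0 x⁻¹))
      (f := fun ξ => f2 σ ξ * Real.cos (ξ * x)) ((int_rpow h1 h2 hδ).const_mul 6) (by
        filter_upwards [ae_restrict_mem measurableSet_Ioc] with ξ hξ
        rw [norm_mul]
        exact (mul_le_of_le_one_right (norm_nonneg _) (Real.abs_cos_le_one _)).trans (f2_bd1 h1 h2 hξ.1))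
    refine this.trans (le_of_eq ?_)
    rw [integral_const_mul, ← intervalIntegral.integral_of_le hδ.le, integral_rpow (Or.inl (by linarith))]
    rw [show σ - 2 + 1 = σ - 1 by ring, Real.zero_rpow (by linarith), sub_zero]
  have e2 : |∫ ξ in Set.Ioi x⁻¹, f3 σ ξ * Real.sin (ξ * x)| ≤ 100 * (x⁻¹ ^ (σ - 2) / (2 - σ)) := by
    have := norm_integral_le_of_norm_le (μ := volume.restrict (Set.Ioi x⁻¹))
      (f := fun ξ => f3 σ ξ * Real.sin (ξ * x))
      ((integrableOn_Ioi_rpow_of_lt (a := σ - 3) (by linarith) hδ).const_mul 100) (by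
        filter_upwards [ae_restrict_mem measurableSet_Ioi] with ξ hξ
        rw [norm_mul]
        exact (mul_le_of_le_one_right (norm_nonneg _) (Real.abs_sin_le_one _)).trans (f3_bd h1 h2 (hδ.trans hξ)))
    refine this.trans (le_of_eq ?_)
    rw [integral_const_mul, integral_Ioi_rpow_of_lt (by linarith) hδ]
    rw [show σ - 3 + 1 = - (2 - σ) by ring, neg_div_neg_eq]
    ring_nf
  have e3 : |f2 σ x⁻¹ * Real.sin (x⁻¹ * x)| ≤ 6 * x⁻¹ ^ (σ - 2) := by
    rw [abs_mul]
    exact (mul_le_of_le_one_right (abs_nonneg _) (Real.abs_sin_le_one _)).trans (f2_bd1 h1 h2 hδ)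
  have hsplit : ∫ ξ in Set.Ioi 0, f2 σ ξ * Real.cos (ξ * x) =
      (∫ ξ in Set.Ioc 0 x⁻¹, f2 σ ξ * Real.cos (ξ * x)) + ∫ ξ in Set.Ioi x⁻¹, f2 σ ξ * Real.cos (ξ * x) := by
    rw [← Set.Ioc_union_Ioi_eq_Ioi hδ.le]
    exact setIntegral_union (Set.Ioc_disjoint_Ioi le_rfl) measurableSet_Ioi
      (mul_cos (int_f2_Ioc h1 h2 hδ) x) (mul_cos (int_f2_Ioi h1 h2 hδ) x)
  have r1 : x⁻¹ ^ (σ - 1) = x ^ (-(1 + σ)) * x ^ 2 := by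
    rw [Real.inv_rpow hx.le, ← Real.rpow_neg hx.le, ← Real.rpow_natCast x 2, ← Real.rpow_add hx]
    congr 1; push_cast; ring
  have r2 : x⁻¹ ^ (σ - 2) = x ^ (-(1 + σ)) * x ^ 3 := by
    rw [Real.inv_rpow hx.le, ← Real.rpow_neg hx.le, ← Real.rpow_natCast x 3, ← Real.rpow_add hx]
    congr 1; push_cast; ring
  rw [ibp1 h1 h2 hx, hsplit, ibp2 h1 h2 hx hδ, abs_mul, abs_neg, abs_of_pos (show 0 < 1 / x ^ 2 by positivity)]
  set A := ∫ ξ in Set.Ioc 0 x⁻¹, f2 σ ξ * Real.cos (ξ * x)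
  set B := ∫ ξ in Set.Ioi x⁻¹, f3 σ ξ * Real.sin (ξ * x)
  set E := f2 σ x⁻¹ * Real.sin (x⁻¹ * x)
  have t : |A + (-(1 / x) * E - 1 / x * B)| ≤ |A| + (1 / x) * |E| + (1 / x) * |B| := by
    calc _ ≤ |A| + (|-(1 / x) * E| + |1 / x * B|) :=
          (abs_add_le _ _).trans (by gcongr; exact abs_sub _ _)
      _ = _ := by
        rw [abs_mul (-(1 / x)) E, abs_mul (1 / x) B, abs_neg, abs_of_pos (show 0 < 1 / x by positivity)]; ring
  have hs1 : 0 < σ - 1 := by linarith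
  have hs2 : 0 < 2 - σ := by linarith
  calc _ ≤ 1 / x ^ 2 * (6 * (x⁻¹ ^ (σ - 1) / (σ - 1)) + (1 / x) * (6 * x⁻¹ ^ (σ - 2)) + (1 / x) * (100 * (x⁻¹ ^ (σ - 2) / (2 - σ)))) := by
        gcongr
        exact t.trans (by gcongr)
    _ = _ := by
      rw [r1, r2]; field_simp

lemma J_bd0 (x : ℝ) :
    |∫ ξ in Set.Ioi 0, f0 σ ξ * Real.cos (ξ * x)| ≤ ∫ ξ in Set.Ioi 0, f0 σ ξ := by
  refine norm_integral_le_of_norm_le (f := fun ξ => f0 σ ξ * Real.cos (ξ * x)) (int_f0 h1 h2) ?_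
  filter_upwards [ae_restrict_mem measurableSet_Ioi] with ξ hξ
  have hp : 0 < ξ ^ σ := Real.rpow_pos_of_pos hξ _
  have : 0 ≤ f0 σ ξ := by unfold f0; positivity
  rw [norm_mul, Real.norm_of_nonneg this]
  exact mul_le_of_le_one_right this (Real.abs_cos_le_one _)

lemma G_eq (x : ℝ) : Gsigma σ x = (1 / π) * ∫ ξ in Set.Ioi 0, f0 σ ξ * Real.cos (ξ * |x|) := by
  have hint : Integrable (fun ξ : ℝ =>
      Complex.exp (Complex.I * (ξ : ℂ) * (x : ℂ)) / ((1 + |ξ| ^ σ : ℝ) : ℂ)) := by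
    refine (int_base h1 h2).mono' ?_ (Eventually.of_forall fun ξ => ?_)
    · apply Measurable.aestronglyMeasurable; fun_prop
    · have hp : 0 ≤ |ξ| ^ σ := Real.rpow_nonneg (abs_nonneg _) _
      rw [norm_div, show Complex.I * (ξ : ℂ) * (x : ℂ) = ((ξ * x : ℝ) : ℂ) * Complex.I by push_cast; ring,
        Complex.norm_exp_ofReal_mul_I, Complex.norm_real, Real.norm_of_nonneg (by positivity)]
  have hre : (∫ ξ : ℝ, Complex.exp (Complex.I * (ξ : ℂ) * (x : ℂ)) / ((1 + |ξ| ^ σ : ℝ) : ℂ)).re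
      = ∫ ξ : ℝ, (fun t => f0 σ t * Real.cos (t * |x|)) |ξ| := by
    rw [← RCLike.re_eq_complex_re, ← integral_re hint]
    congr 1
    ext ξ
    rw [RCLike.re_eq_complex_re, Complex.div_ofReal_re,
      show Complex.I * (ξ : ℂ) * (x : ℂ) = ((ξ * x : ℝ) : ℂ) * Complex.I by push_cast; ring,
      Complex.exp_ofReal_mul_I_re]
    simp only [f0]
    rw [← abs_mul, Real.cos_abs]; ring
  rw [Gsigma, hre, integral_comp_abs (f := fun t => f0 σ t * Real.cos (t * |x|)), ← mul_assoc]
  congr 1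
  field_simp

lemma G_bd : ∃ K : ℝ, 0 < K ∧ ∀ x, |Gsigma σ x| ≤ K * (1 + x ^ 2) ^ (-(1 + σ) / 2) := by
  set C0 := ∫ ξ in Set.Ioi 0, f0 σ ξ
  set C1 := (6 / (σ - 1) + 6 + 100 / (2 - σ))
  have hC0 : 0 ≤ C0 := (abs_nonneg _).trans (J_bd0 h1 h2 0)
  have hs1 : 0 < σ - 1 := by linarith
  have hs2 : 0 < 2 - σ := by linarith
  have hC1 : 0 < C1 := by positivity
  refine ⟨(C0 + C1) * 2 ^ ((1 + σ) / 2), by positivity, fun x => ?_⟩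
  have hG : |Gsigma σ x| ≤ |∫ ξ in Set.Ioi 0, f0 σ ξ * Real.cos (ξ * |x|)| := by
    rw [G_eq h1 h2, abs_mul]
    refine mul_le_of_le_one_left (abs_nonneg _) ?_
    rw [abs_of_pos (by positivity), div_le_one Real.pi_pos]
    linarith [Real.pi_gt_three]
  refine hG.trans ?_
  rw [mul_assoc, neg_div, Real.rpow_neg (by positivity), ← div_eq_mul_inv, ← Real.div_rpow (by norm_num) (by positivity)]
  rcases le_total |x| 1 with h | h
  · have : (1 : ℝ) ≤ (2 / (1 + x ^ 2)) ^ ((1 + σ) / 2) := by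
      apply Real.one_le_rpow _ (by linarith)
      rw [one_le_div (by positivity)]
      have := (sq_le_one_iff_abs_le_one x).2 h
      linarith
    calc _ ≤ C0 := J_bd0 h1 h2 _
      _ ≤ (C0 + C1) * 1 := by linarith
      _ ≤ _ := by gcongr
  · have hx : 0 < |x| := by linarith
    have : |x| ^ (-(1 + σ)) ≤ (2 / (1 + x ^ 2)) ^ ((1 + σ) / 2) := by
      have : |x| ^ (-(1 + σ)) = (1 / x ^ 2) ^ ((1 + σ) / 2) := by
        rw [← sq_abs x, one_div, Real.inv_rpow (by positivity), ← Real.rpow_neg (by positivity),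
          ← Real.rpow_natCast |x| 2, ← Real.rpow_mul hx.le]
        congr 1; push_cast; ring
      rw [this]
      apply Real.rpow_le_rpow (by positivity) _ (by linarith)
      have h2 : 1 ≤ x ^ 2 := (one_le_sq_iff_one_le_abs x).2 h
      rw [div_le_div_iff₀ (by positivity) (by positivity)]
      linarith
    calc _ ≤ C1 * |x| ^ (-(1 + σ)) := J_bd h1 h2 hx
      _ ≤ (C0 + C1) * _ := by gcongr; linarith

end
end PD

namespace PD

noncomputable def w (σ x : ℝ) : ℝ := (1 + x ^ 2) ^ (-(1 + σ) / 2)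

lemma w_pos (σ x : ℝ) : 0 < w σ x := Real.rpow_pos_of_pos (by positivity) _

lemma w_cont (σ : ℝ) : Continuous (w σ) := by
  unfold w
  refine Continuous.rpow_const (by fun_prop) (fun x => Or.inl (by positivity))

lemma w_half {σ x y : ℝ} (h1 : 1 < σ) (h : |x| ≤ 2 * |y|) : w σ y ≤ 4 ^ ((1 + σ) / 2) * w σ x := by
  unfold w
  rw [neg_div, Real.rpow_neg (by positivity), Real.rpow_neg (by positivity), ← div_eq_mul_inv,
    ← Real.div_rpow (by norm_num) (by positivity), ← Real.inv_rpow (by positivity)]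
  apply Real.rpow_le_rpow (by positivity) _ (by linarith)
  rw [inv_eq_one_div, div_le_div_iff₀ (by positivity) (by positivity)]
  have : x ^ 2 ≤ 4 * y ^ 2 := by
    rw [← sq_abs x, ← sq_abs y]; nlinarith [abs_nonneg x, abs_nonneg y]
  linarith

lemma w_int {σ : ℝ} (h1 : 1 < σ) : Integrable (w σ) := by
  have hI := integrable_rpow_neg_one_add_norm_sq (E := ℝ) (μ := volume) (r := 1 + σ) (by simp; linarith)
  refine hI.congr (Eventually.of_forall fun x => ?_)
  simp only [w, Real.norm_eq_abs, sq_abs]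

lemma w_prod {σ : ℝ} (h1 : 1 < σ) (x y : ℝ) :
    w σ (x - y) * w σ y ≤ 4 ^ ((1 + σ) / 2) * w σ x * (w σ (x - y) + w σ y) := by
  have p1 := w_pos σ (x - y)
  have p2 := w_pos σ y
  have p3 := w_pos σ x
  have p4 : (0 : ℝ) < 4 ^ ((1 + σ) / 2) := by positivity
  have tri : |x| ≤ |x - y| + |y| := by simpa using abs_add_le (x - y) y
  rcases le_total |x - y| |y| with h | h
  · have := w_half (σ := σ) (x := x) (y := y) h1 (by linarith)
    nlinarith [mul_le_mul_of_nonneg_left this p1.le, mul_pos (mul_pos p4 p3) p2]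
  · have := w_half (σ := σ) (x := x) (y := x - y) h1 (by linarith)
    nlinarith [mul_le_mul_of_nonneg_right this p2.le, mul_pos (mul_pos p4 p3) p1]

lemma conv_bd {σ : ℝ} (h1 : 1 < σ) : ∃ B : ℝ, 0 < B ∧ ∀ (α β K : ℝ), 0 ≤ α → 0 ≤ β → 0 < K →
    ∀ (F : ℝ → ℝ) (x : ℝ), (∀ y, |F y| ≤ K * w σ (x - y) * (α + β * w σ y)) →
    |∫ y, F y| ≤ K * B * (α + β * w σ x) := by
  set I := ∫ y, w σ y
  have hI : 0 ≤ I := integral_nonneg fun y => (w_pos σ y).le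
  set c : ℝ := 4 ^ ((1 + σ) / 2)
  have hc : 0 < c := by positivity
  refine ⟨I + c * (2 * I) + 1, by positivity, fun α β K hα hβ hK F x hF => ?_⟩
  have i1 : Integrable (fun y => w σ (x - y)) := (w_int h1).comp_sub_left x
  have e1 : ∫ y, w σ (x - y) = I := integral_sub_left_eq_self (w σ) volume x
  have i2 := w_int h1
  have i3 : Integrable (fun y => w σ (x - y) + w σ y) := i1.add i2
  have hint : Integrable (fun y => K * α * w σ (x - y) + K * β * c * w σ x * (w σ (x - y) + w σ y)) :=
    (i1.const_mul _).add (i3.const_mul _)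
  have := norm_integral_le_of_norm_le (f := F) hint (Eventually.of_forall fun y => by
    refine (hF y).trans ?_
    have := mul_le_mul_of_nonneg_left (w_prod h1 x y) (mul_nonneg hK.le hβ)
    linarith)
  refine this.trans ?_
  rw [integral_add (i1.const_mul _) (i3.const_mul _), integral_const_mul, integral_const_mul,
    integral_add i1 i2, e1]
  have p3 := (w_pos σ x).le
  have q1 : 0 ≤ K * α * (c * (2 * I) + 1) := by positivity
  have q2 : 0 ≤ K * (β * w σ x) * (I + 1) := by positivity
  change K * α * I + K * β * c * w σ x * (I + I) ≤ _
  linarith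

end PD

/-- If `φ` is continuous, bounded, vanishes at infinity, and solves
`φ = G_σ ∗ (a₁ φ^p + a₂ φ^q)`, then `|φ(x)| ≤ C ⟨x⟩^{−(1+σ)}`. -/
theorem solution_polynomial_decay (σ : ℝ) (hσ1 : 1 < σ) (hσ2 : σ < 2)
    (p q : ℕ) (hp : 2 ≤ p) (hpq : p < q) (a₁ a₂ : ℝ) (φ : ℝ → ℝ)
    (hcont : Continuous φ) (hbdd : ∃ M : ℝ, ∀ x : ℝ, |φ x| ≤ M)
    (hdecay : Tendsto φ (cocompact ℝ) (nhds 0))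
    (heq : ∀ x : ℝ, φ x = ∫ y : ℝ, Gsigma σ (x - y) * (a₁ * φ y ^ p + a₂ * φ y ^ q)) :
    ∃ C : ℝ, 0 < C ∧ ∀ x : ℝ, |φ x| ≤ C * (1 + x ^ 2) ^ (-(1 + σ) / 2) := by
  obtain ⟨M, hM⟩ := hbdd
  obtain ⟨K, hK, hG⟩ := PD.G_bd hσ1 hσ2
  obtain ⟨B, hB, hconv⟩ := PD.conv_bd hσ1
  have hM0 : 0 ≤ M := (abs_nonneg _).trans (hM 0)
  set ε := 1 / (2 * (K * B)) with hε
  have hε0 : 0 < ε := by positivity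
  -- splitting of the nonlinearity
  obtain ⟨D, hD0, hD⟩ : ∃ D : ℝ, 0 < D ∧ ∀ y, |a₁ * φ y ^ p + a₂ * φ y ^ q| ≤ ε * |φ y| + D * PD.w σ y := by
    set A := |a₁| + |a₂| + 1
    have hA : 0 < A := by positivity
    have hev : ∀ᶠ y in cocompact ℝ, |φ y| < min 1 (ε / A) := by
      have := hdecay.abs
      rw [abs_zero] at this
      exact this.eventually_lt_const (by positivity)
    obtain ⟨t, ht, hsub⟩ := mem_cocompact.1 hev
    have hNc : Continuous (fun y => (a₁ * φ y ^ p + a₂ * φ y ^ q) / PD.w σ y) :=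
      Continuous.div (by fun_prop) (PD.w_cont σ) (fun y => (PD.w_pos σ y).ne')
    obtain ⟨D, hD⟩ := ht.exists_bound_of_continuousOn hNc.continuousOn
    refine ⟨|D| + 1, by positivity, fun y => ?_⟩
    have hw := PD.w_pos σ y
    by_cases hy : y ∈ t
    · have := hD y hy
      rw [norm_div, Real.norm_of_nonneg hw.le, div_le_iff₀ hw] at this
      rw [Real.norm_eq_abs] at this
      have h3 : D * PD.w σ y ≤ (|D| + 1) * PD.w σ y := by
        gcongr; linarith [le_abs_self D]
      have : 0 ≤ ε * |φ y| := by positivity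
      linarith
    · have hlt : |φ y| < min 1 (ε / A) := hsub hy
      have l1 : |φ y| ≤ 1 := (hlt.trans_le (min_le_left _ _)).le
      have l2 : |φ y| ≤ ε / A := (hlt.trans_le (min_le_right _ _)).le
      have pp : |φ y| ^ p ≤ |φ y| ^ 2 := pow_le_pow_of_le_one (abs_nonneg _) l1 hp
      have pq : |φ y| ^ q ≤ |φ y| ^ 2 := pow_le_pow_of_le_one (abs_nonneg _) l1 (by omega)
      have : |a₁ * φ y ^ p + a₂ * φ y ^ q| ≤ ε * |φ y| := by
        calc _ ≤ |a₁| * |φ y| ^ p + |a₂| * |φ y| ^ q := by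
              refine (abs_add_le _ _).trans (le_of_eq ?_)
              rw [abs_mul, abs_mul, abs_pow, abs_pow]
          _ ≤ |a₁| * |φ y| ^ 2 + |a₂| * |φ y| ^ 2 := by gcongr
          _ ≤ A * (|φ y| * |φ y|) := by nlinarith [sq_nonneg |φ y|]
          _ ≤ A * (ε / A * |φ y|) := by gcongr
          _ = ε * |φ y| := by field_simp
      have : 0 ≤ (|D| + 1) * PD.w σ y := by positivity
      linarith
  set β := 2 * (K * B) * D with hβ
  have hβ0 : 0 < β := by positivity
  have iter : ∀ n : ℕ, ∀ x, |φ x| ≤ M * (1 / 2) ^ n + β * PD.w σ x := by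
    intro n
    induction n with
    | zero =>
      intro x
      have := PD.w_pos σ x
      have := hM x
      have : 0 ≤ β * PD.w σ x := by positivity
      simp; linarith
    | succ n ih =>
      intro x
      have h := hconv (ε * (M * (1 / 2) ^ n)) (ε * β + D) K (by positivity) (by positivity) hK
        (fun y => Gsigma σ (x - y) * (a₁ * φ y ^ p + a₂ * φ y ^ q)) x (fun y => by
          have hw := PD.w_pos σ (x - y)
          rw [abs_mul]
          refine mul_le_mul (hG _) ?_ (abs_nonneg _) (by positivity)
          have := mul_le_mul_of_nonneg_left (ih y) hε0.le
          linarith [hD y])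
      rw [← heq x] at h
      refine h.trans (le_of_eq ?_)
      rw [hβ, hε, pow_succ]
      field_simp
      ring
  refine ⟨β, hβ0, fun x => ?_⟩
  have hlim : Tendsto (fun n : ℕ => M * (1 / 2 : ℝ) ^ n + β * PD.w σ x) atTop (nhds (M * 0 + β * PD.w σ x)) :=
    ((tendsto_pow_atTop_nhds_zero_of_lt_one (by norm_num) (by norm_num)).const_mul M).add_const _
  have := ge_of_tendsto' hlim (fun n => iter n x)
  simpa [PD.w] using this
end
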